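/- For every N ≥ 2, θ ∈ (0, π/2], ã > 0, d > 0 and m > 0 there exists a constant C > 0, depending only on N, θ, ã, d and m, such that the following holds: for every bounded domain Ω ⊂ ℝ^N with diameter at most d satisfying the (θ,ã)-uniform interior cone condition and every torsion function u on Ω which is C¹ up to the boundary with |∇u(x)| ≥ m for all x ∈ ∂Ω and ∫_Ω |∇²u|² dx < ∞, the function h(x) := |x−z|²/2 − u(x), with z the barycenter of Ω and R := N|Ω|/H^{N−1}(∂Ω), satisfies (∫_{∂Ω} |∇h|² dH^{N−1})^{1/2} ≤ C (∫_{∂Ω} (|∇u|² − R²)² dH^{N−1})^{1/2}. -/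

import Mathlib

open MeasureTheory Metric Set Real RealInnerProductSpace

noncomputable section

/-- Euclidean space `ℝ^N`. -/
abbrev Euc (N : ℕ) : Type := EuclideanSpace ℝ (Fin N)

/-- The `(i,j)` entry of the Hessian matrix of `u` at `x`. -/
def hessEntry {N : ℕ} (u : Euc N → ℝ) (x : Euc N) (i j : Fin N) : ℝ :=
  fderiv ℝ (fun y => fderiv ℝ u y (EuclideanSpace.single j (1 : ℝ))) x
    (EuclideanSpace.single i (1 : ℝ))

/-- Squared Frobenius norm of the Hessian of `u` at `x`. -/
def hessNormSq {N : ℕ} (u : Euc N → ℝ) (x : Euc N) : ℝ :=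
  ∑ i, ∑ j, (hessEntry u x i j) ^ 2

/-- The Laplacian of `u` at `x` (trace of the Hessian). -/
def lap {N : ℕ} (u : Euc N → ℝ) (x : Euc N) : ℝ := ∑ i, hessEntry u x i i

/-- `u` is a torsion function on `Ω`: continuous on the closure, `C²` inside,
`Δu = N` in `Ω` and `u = 0` on `∂Ω`. -/
def IsTorsion {N : ℕ} (Ω : Set (Euc N)) (u : Euc N → ℝ) : Prop :=
  ContinuousOn u (closure Ω) ∧ ContDiffOn ℝ 2 u Ω ∧
    (∀ x ∈ Ω, lap u x = N) ∧ ∀ x ∈ frontier Ω, u x = 0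

/-- `G` is a `b₀`-John domain. -/
def IsJohn {N : ℕ} (b₀ : ℝ) (G : Set (Euc N)) : Prop :=
  ∀ a ∈ G, ∀ b ∈ G, a ≠ b → ∃ γ : ℝ → Euc N,
    ContinuousOn γ (Icc 0 1) ∧ γ 0 = a ∧ γ 1 = b ∧ (∀ t ∈ Icc (0:ℝ) 1, γ t ∈ G) ∧
    ∀ t ∈ Icc (0:ℝ) 1, b₀⁻¹ * min (dist (γ t) a) (dist (γ t) b) ≤ infDist (γ t) (frontier G)

/-- `(θ, a)`-uniform interior cone condition. -/
def UnifConeCond {N : ℕ} (θ a : ℝ) (G : Set (Euc N)) : Prop :=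
  ∀ x ∈ frontier G, ∃ ω : Euc N, ‖ω‖ = 1 ∧
    ∀ w ∈ ball x a ∩ closure G, ∀ y : Euc N,
      ⟪y, ω⟫ > ‖y‖ * Real.cos θ → ‖y‖ < a → w + y ∈ G

/-- `r`-uniform interior sphere condition. -/
def IntSphere {N : ℕ} (r : ℝ) (Ω : Set (Euc N)) : Prop :=
  ∀ x ∈ frontier Ω, ∃ c : Euc N, ball c r ⊆ Ω ∧ dist x c = r

/-- `r`-uniform exterior sphere condition. -/
def ExtSphere {N : ℕ} (r : ℝ) (Ω : Set (Euc N)) : Prop :=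
  ∀ x ∈ frontier Ω, ∃ c : Euc N, ball c r ⊆ (closure Ω)ᶜ ∧ dist x c = r

section Calculus

variable {E F : Type*} [NormedAddCommGroup E] [NormedSpace ℝ E] [NormedAddCommGroup F]
  [NormedSpace ℝ F]

theorem enorm_sub_le_lintegral_fderiv [CompleteSpace F] {Ω : Set E} (hΩ : IsOpen Ω) {v : E → F}
    (hv : ContDiffOn ℝ 1 v Ω) {x e : E} {T : ℝ} (hT : 0 ≤ T)
    (hseg : ∀ t ∈ Icc 0 T, x + t • e ∈ Ω) :
    ‖v (x + T • e) - v x‖ₑ ≤ ∫⁻ t in Ioc 0 T, ‖fderiv ℝ v (x + t • e)‖ₑ * ‖e‖ₑ := by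
  have hline : ∀ t : ℝ, HasDerivAt (fun t : ℝ => x + t • e) e t := fun t => by
    simpa using ((hasDerivAt_id t).smul_const e).const_add x
  have hder : ∀ t ∈ Icc 0 T, HasDerivAt (fun t : ℝ => v (x + t • e))
      (fderiv ℝ v (x + t • e) e) t := fun t ht => by
    have hd := ((hv.contDiffAt (hΩ.mem_nhds (hseg t ht))).differentiableAt
      one_ne_zero).hasFDerivAt
    exact hd.comp_hasDerivAt t (hline t)
  have hcont : ContinuousOn (fun t : ℝ => fderiv ℝ v (x + t • e) e) (Icc 0 T) := by
    have h1 : ContinuousOn (fun t : ℝ => fderiv ℝ v (x + t • e)) (Icc 0 T) :=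
      (hv.continuousOn_fderiv_of_isOpen hΩ le_rfl).comp (by fun_prop) hseg
    exact h1.clm_apply continuousOn_const
  have hint : IntervalIntegrable (fun t : ℝ => fderiv ℝ v (x + t • e) e) volume 0 T :=
    ContinuousOn.intervalIntegrable (by rwa [uIcc_of_le hT])
  have hftc := intervalIntegral.integral_eq_sub_of_hasDerivAt
    (fun t ht => hder t (by rwa [uIcc_of_le hT] at ht)) hint
  simp only [zero_smul, add_zero] at hftc
  rw [← hftc, intervalIntegral.integral_of_le hT]
  refine (enorm_integral_le_lintegral_enorm _).trans (lintegral_mono fun t => ?_)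
  exact ContinuousLinearMap.le_opENorm _ _

theorem sq_lintegral_mul_le {α : Type*} [MeasurableSpace α] (μ : Measure α) {f g : α → ENNReal}
    (hf : AEMeasurable f μ) (hg : AEMeasurable g μ) :
    (∫⁻ a, f a * g a ∂μ) ^ 2 ≤ (∫⁻ a, f a ^ 2 ∂μ) * ∫⁻ a, g a ^ 2 ∂μ := by
  have h := ENNReal.lintegral_mul_le_Lp_mul_Lq μ Real.HolderConjugate.two_two hf hg
  calc (∫⁻ a, f a * g a ∂μ) ^ 2 ≤ _ := pow_le_pow_left' h 2
    _ = _ := by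
      rw [mul_pow, ← ENNReal.rpow_natCast, ← ENNReal.rpow_natCast, ← ENNReal.rpow_mul,
        ← ENNReal.rpow_mul]
      simp

theorem enorm_add_sq_le {F : Type*} [SeminormedAddCommGroup F] (x y : F) :
    ‖x + y‖ₑ ^ 2 ≤ 2 * ‖x‖ₑ ^ 2 + 2 * ‖y‖ₑ ^ 2 := by
  have h : ‖x + y‖₊ ^ 2 ≤ 2 * ‖x‖₊ ^ 2 + 2 * ‖y‖₊ ^ 2 := by
    rw [← NNReal.coe_le_coe]
    push_cast
    have := norm_add_le x y
    nlinarith [sq_nonneg (‖x‖ - ‖y‖), norm_nonneg (x + y)]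
  simp only [enorm_eq_nnnorm]
  exact_mod_cast h

end Calculus

section BallPoincare

variable {N : ℕ} {F : Type*} [NormedAddCommGroup F] [NormedSpace ℝ F]

theorem lintegral_comp_affine_le {φ : Euc N → ENNReal} {t : ℝ} (ht : 1 / 2 ≤ t) (b : Euc N) :
    (∫⁻ y, φ (b + t • y)) ≤ 2 ^ N * ∫⁻ y, φ y := by
  have ht0 : 0 < t := by linarith
  have h1 : ∫⁻ y, φ (b + t • y) = ENNReal.ofReal (|(t ^ N)⁻¹|) * ∫⁻ y, φ (b + y) := by
    have := Measure.map_addHaar_smul (volume : Measure (Euc N)) ht0.ne'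
    rw [finrank_euclideanSpace_fin] at this
    have h2 := (Homeomorph.smulOfNeZero t ht0.ne').measurableEmbedding.lintegral_map
      (μ := (volume : Measure (Euc N))) (fun y => φ (b + y))
    change ∫⁻ y, φ (b + y) ∂(Measure.map (t • ·) volume) = ∫⁻ y, φ (b + t • y) at h2
    rw [← h2, this, lintegral_smul_measure]
    rfl
  rw [h1, lintegral_add_left_eq_self (fun y => φ y) b]
  gcongr
  rw [abs_of_nonneg (by positivity)]
  calc ENNReal.ofReal ((t ^ N)⁻¹) ≤ ENNReal.ofReal (2 ^ N) := by
        apply ENNReal.ofReal_le_ofReal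
        rw [← inv_pow]
        gcongr
        rw [inv_le_comm₀ ht0 two_pos]; linarith
    _ = 2 ^ N := by rw [ENNReal.ofReal_pow (by norm_num)]; norm_num

theorem aemeasurable_enorm_fderiv_sq {Ω : Set (Euc N)} (hΩ : IsOpen Ω) {v : Euc N → F}
    (hv : ContDiffOn ℝ 1 v Ω) :
    Measurable (Ω.indicator fun x => ‖fderiv ℝ v x‖ₑ ^ 2) := by
  have h : ContinuousOn (fun x => ‖fderiv ℝ v x‖ₑ ^ 2) Ω :=
    (ENNReal.continuous_pow 2).comp_continuousOn
      (continuous_enorm.comp_continuousOn (hv.continuousOn_fderiv_of_isOpen hΩ le_rfl))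
  classical
  rw [← piecewise_eq_indicator]
  exact h.measurable_piecewise continuousOn_const hΩ.measurableSet

theorem ball_poincare [CompleteSpace F] (p : Euc N) {r : ℝ} (hr : 0 < r) {v : Euc N → F}
    (hv : ContDiffOn ℝ 1 v (ball p r)) :
    ∃ c : F, (∫⁻ x in ball p r, ‖v x - c‖ₑ ^ 2) ≤
      ENNReal.ofReal (2 * r) ^ 2 * 2 ^ N * ∫⁻ x in ball p r, ‖fderiv ℝ v x‖ₑ ^ 2 := by
  set B := ball p r with hB
  set φ : Euc N → ENNReal := B.indicator fun x => ‖fderiv ℝ v x‖ₑ ^ 2 with hφ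
  have hφm : Measurable φ := aemeasurable_enorm_fderiv_sq isOpen_ball hv
  have hBm : MeasurableSet B := measurableSet_ball
  have hφI : ∫⁻ x, φ x = ∫⁻ x in B, ‖fderiv ℝ v x‖ₑ ^ 2 := lintegral_indicator hBm _
  have hpt : ∀ x ∈ B, ∀ y ∈ B, ‖v y - v x‖ₑ ^ 2 ≤
      ENNReal.ofReal (2 * r) ^ 2 * ∫⁻ t in Ioc (0:ℝ) 1, φ (x + t • (y - x)) := by
    intro x hx y hy
    have hseg : ∀ t ∈ Icc (0:ℝ) 1, x + t • (y - x) ∈ B := fun t ht =>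
      (convex_ball p r).add_smul_sub_mem hx hy ht
    have h1 := enorm_sub_le_lintegral_fderiv isOpen_ball hv zero_le_one hseg
    rw [one_smul, add_sub_cancel] at h1
    have hcont : ContinuousOn (fun t : ℝ => fderiv ℝ v (x + t • (y - x))) (Icc 0 1) :=
      (hv.continuousOn_fderiv_of_isOpen isOpen_ball le_rfl).comp (by fun_prop) hseg
    have hm : AEMeasurable (fun t : ℝ => ‖fderiv ℝ v (x + t • (y - x))‖ₑ)
        (volume.restrict (Ioc (0:ℝ) 1)) :=
      ((continuous_enorm.comp_continuousOn hcont).mono Ioc_subset_Icc_self).aemeasurable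
        measurableSet_Ioc
    calc ‖v y - v x‖ₑ ^ 2 ≤ _ := pow_le_pow_left' h1 2
      _ ≤ _ := sq_lintegral_mul_le _ hm aemeasurable_const
      _ = ‖y - x‖ₑ ^ 2 * ∫⁻ t in Ioc (0:ℝ) 1, φ (x + t • (y - x)) := by
        rw [lintegral_const, Measure.restrict_apply_univ, Real.volume_Ioc, sub_zero,
          ENNReal.ofReal_one, mul_one, mul_comm]
        congr 1
        refine setLIntegral_congr_fun measurableSet_Ioc fun t ht => ?_
        simp only [hφ]
        rw [indicator_of_mem (hseg t (Ioc_subset_Icc_self ht))]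
      _ ≤ _ := by
        gcongr
        rw [← ofReal_norm]
        apply ENNReal.ofReal_le_ofReal
        rw [← dist_eq_norm]
        have := dist_triangle_right y x p
        rw [hB, mem_ball] at hx hy
        linarith
  have hjoint : Measurable fun q : (Euc N × Euc N) × ℝ => φ (q.1.1 + q.2 • (q.1.2 - q.1.1)) :=
    hφm.comp (by fun_prop)
  have hdouble : (∫⁻ x in B, ∫⁻ y in B, ∫⁻ t in Ioc (0:ℝ) 1, φ (x + t • (y - x))) ≤
      volume B * (2 ^ N * ∫⁻ x, φ x) := by
    have hsw : ∀ x, ∫⁻ y in B, ∫⁻ t in Ioc (0:ℝ) 1, φ (x + t • (y - x)) =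
        ∫⁻ t in Ioc (0:ℝ) 1, ∫⁻ y in B, φ (x + t • (y - x)) := fun x =>
      lintegral_lintegral_swap
        (hφm.comp (by fun_prop : Measurable fun q : Euc N × ℝ =>
          x + q.2 • (q.1 - x))).aemeasurable
    simp_rw [hsw]
    have hsw2 : ∫⁻ x in B, ∫⁻ t in Ioc (0:ℝ) 1, ∫⁻ y in B, φ (x + t • (y - x)) =
        ∫⁻ t in Ioc (0:ℝ) 1, ∫⁻ x in B, ∫⁻ y in B, φ (x + t • (y - x)) := by
      refine lintegral_lintegral_swap (Measurable.aemeasurable ?_)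
      refine Measurable.lintegral_prod_right' (f := fun q : (Euc N × ℝ) × Euc N =>
        φ (q.1.1 + q.1.2 • (q.2 - q.1.1))) ?_
      exact hφm.comp (by fun_prop)
    rw [hsw2]
    have hbd : ∀ t ∈ Ioc (0:ℝ) 1, (∫⁻ x in B, ∫⁻ y in B, φ (x + t • (y - x))) ≤
        volume B * (2 ^ N * ∫⁻ x, φ x) := by
      intro t ht
      rcases le_total (1 / 2) t with h | h
      · calc (∫⁻ x in B, ∫⁻ y in B, φ (x + t • (y - x)))
            ≤ ∫⁻ x in B, (2 ^ N * ∫⁻ x, φ x) := by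
              refine lintegral_mono fun x => (setLIntegral_le_lintegral _ _).trans ?_
              refine le_of_eq_of_le ?_ (lintegral_comp_affine_le (φ := φ) h (x - t • x))
              refine lintegral_congr fun y => congrArg φ ?_
              module
          _ = _ := by rw [setLIntegral_const, mul_comm]
      · rw [lintegral_lintegral_swap (f := fun x y => φ (x + t • (y - x))) ((hφm.comp (by fun_prop :
          Measurable fun q : Euc N × Euc N => q.1 + t • (q.2 - q.1))).aemeasurable)]
        calc (∫⁻ y in B, ∫⁻ x in B, φ (x + t • (y - x)))
            ≤ ∫⁻ x in B, (2 ^ N * ∫⁻ x, φ x) := by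
              refine lintegral_mono fun y => (setLIntegral_le_lintegral _ _).trans ?_
              refine le_of_eq_of_le ?_ (lintegral_comp_affine_le (φ := φ)
                (by linarith : 1 / 2 ≤ 1 - t) (t • y))
              refine lintegral_congr fun x => congrArg φ ?_
              module
          _ = _ := by rw [setLIntegral_const, mul_comm]
    calc _ ≤ ∫⁻ t in Ioc (0:ℝ) 1, volume B * (2 ^ N * ∫⁻ x, φ x) :=
          setLIntegral_mono measurable_const hbd
      _ = _ := by simp
  have hvc : ContinuousOn v B := hv.continuousOn
  have hB0 : volume B ≠ 0 := (measure_ball_pos _ _ hr).ne'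
  have hBt : volume B ≠ ⊤ := measure_ball_lt_top.ne
  set G : Euc N → ENNReal := fun x => ∫⁻ y in B, ∫⁻ t in Ioc (0:ℝ) 1, φ (x + t • (y - x)) with hG
  have hGm : Measurable G := by
    refine Measurable.lintegral_prod_right' (f := fun q : Euc N × Euc N =>
        ∫⁻ t in Ioc (0:ℝ) 1, φ (q.1 + t • (q.2 - q.1))) ?_
    exact Measurable.lintegral_prod_right' hjoint
  obtain ⟨x, hxB, hx⟩ : ∃ x ∈ B, G x ≤ 2 ^ N * ∫⁻ x, φ x := by
    obtain ⟨x, hxB, hx⟩ := exists_le_setLAverage hB0 hBt hGm.aemeasurable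
    refine ⟨x, hxB, hx.trans ?_⟩
    rw [setLAverage_eq]
    refine ENNReal.div_le_of_le_mul ?_
    rw [mul_comm]
    exact hdouble
  refine ⟨v x, ?_⟩
  calc (∫⁻ y in B, ‖v y - v x‖ₑ ^ 2)
      ≤ ∫⁻ y in B, ENNReal.ofReal (2 * r) ^ 2 * ∫⁻ t in Ioc (0:ℝ) 1, φ (x + t • (y - x)) :=
        setLIntegral_mono' hBm fun y hy => hpt x hxB y hy
    _ = ENNReal.ofReal (2 * r) ^ 2 * G x := by
        rw [lintegral_const_mul' _ _ (by finiteness)]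
    _ ≤ _ := by
        rw [mul_assoc, ← hφI]
        gcongr

end BallPoincare

section Cone

variable {N : ℕ}

/-- Near `x`, the set `Ω` contains the cones of direction `ω`, height `τ` and opening `s`. -/
def FatCone (s τ r : ℝ) (Ω : Set (Euc N)) (x ω : Euc N) : Prop :=
  ‖ω‖ = 1 ∧ ∀ w ∈ ball x r ∩ closure Ω, ∀ t ∈ Ioo 0 τ, ball (w + t • ω) (t * s) ⊆ Ω

theorem norm_mul_cos_lt_inner {θ : ℝ} (hθ : θ ∈ Ioc (0:ℝ) (π / 2)) {ω b : Euc N} (hω : ‖ω‖ = 1)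
    (hb : ‖b‖ < sin θ) : ‖ω + b‖ * cos θ < ⟪ω + b, ω⟫ := by
  have hc : 0 ≤ cos θ := cos_nonneg_of_mem_Icc ⟨by linarith [hθ.1, pi_pos], hθ.2⟩
  have hβ : |⟪b, ω⟫| ≤ ‖b‖ := by simpa [hω] using abs_real_inner_le_norm b ω
  have hin : ⟪ω + b, ω⟫ = 1 + ⟪b, ω⟫ := by
    rw [inner_add_left, real_inner_self_eq_norm_sq, hω, one_pow]
  have hnorm : ‖ω + b‖ ^ 2 = 1 + 2 * ⟪b, ω⟫ + ‖b‖ ^ 2 := by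
    rw [norm_add_sq_real, hω, real_inner_comm]; ring
  have hs := sin_sq_add_cos_sq θ
  have hpos : 0 < 1 + ⟪b, ω⟫ := by
    have := (abs_le.1 hβ).1
    linarith [sin_le_one θ]
  rw [hin]
  rcases hc.eq_or_lt with h0 | h0
  · rw [← h0, mul_zero]; exact hpos
  refine lt_of_pow_lt_pow_left₀ 2 hpos.le ?_
  rw [mul_pow, hnorm]
  have hb2 : ‖b‖ ^ 2 < sin θ ^ 2 := pow_lt_pow_left₀ hb (norm_nonneg b) two_ne_zero
  have h2 : cos θ ^ 2 * ‖b‖ ^ 2 < cos θ ^ 2 * sin θ ^ 2 := by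
    have := pow_pos h0 2
    gcongr
  nlinarith [sq_nonneg (1 + ⟪b, ω⟫ - cos θ ^ 2)]

theorem UnifConeCond.fatCone {θ a : ℝ} (hθ : θ ∈ Ioc (0:ℝ) (π / 2)) {Ω : Set (Euc N)}
    (h : UnifConeCond θ a Ω) {x : Euc N} (hx : x ∈ frontier Ω) :
    ∃ ω, FatCone (sin θ) (a / 2) a Ω x ω := by
  obtain ⟨ω, hω, hcone⟩ := h x hx
  refine ⟨ω, hω, fun w hw t ht y hy => ?_⟩
  have ht0 : 0 < t := ht.1
  set b : Euc N := t⁻¹ • (y - (w + t • ω)) with hb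
  have hbn : ‖b‖ < sin θ := by
    rw [mem_ball, dist_eq_norm] at hy
    rw [hb, norm_smul, norm_inv, Real.norm_of_nonneg ht0.le, inv_mul_lt_iff₀ ht0]
    exact hy
  have hyw : y = w + t • (ω + b) := by
    rw [hb, smul_add, smul_smul, mul_inv_cancel₀ ht0.ne', one_smul]; abel
  rw [hyw]
  refine hcone w hw _ ?_ ?_
  · rw [inner_smul_left, norm_smul, Real.norm_of_nonneg ht0.le, mul_assoc]
    exact mul_lt_mul_of_pos_left (norm_mul_cos_lt_inner hθ hω hbn) ht0
  · rw [norm_smul, Real.norm_of_nonneg ht0.le]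
    have h1 : ‖ω + b‖ ≤ 2 := by
      refine (norm_add_le _ _).trans ?_
      rw [hω]; linarith [sin_le_one θ]
    calc t * ‖ω + b‖ ≤ t * 2 := by gcongr
      _ < a := by linarith [ht.2]

theorem le_infDist_compl_of_ball_subset {Ω : Set (Euc N)} (hΩ : (Ωᶜ).Nonempty) {x : Euc N} {r : ℝ}
    (h : ball x r ⊆ Ω) : r ≤ infDist x Ωᶜ := by
  refine (le_infDist hΩ).2 fun y hy => ?_
  by_contra! hlt
  exact hy (h (by rwa [mem_ball, dist_comm]))

theorem mem_of_infDist_compl_pos {Ω : Set (Euc N)} {x : Euc N}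
    (h : 0 < infDist x Ωᶜ) : x ∈ Ω := by
  by_contra hx
  rw [infDist_zero_of_mem (show x ∈ Ωᶜ from hx)] at h
  exact lt_irrefl _ h

theorem infDist_compl_pos {Ω : Set (Euc N)} (ho : IsOpen Ω) (hΩ : (Ωᶜ).Nonempty) {x : Euc N}
    (hx : x ∈ Ω) : 0 < infDist x Ωᶜ :=
  (ho.isClosed_compl.notMem_iff_infDist_pos hΩ).1 (by simpa using hx)

theorem FatCone.le_infDist {s τ r : ℝ} {Ω : Set (Euc N)} (hΩ : (Ωᶜ).Nonempty) {x ω : Euc N}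
    (h : FatCone s τ r Ω x ω) {w : Euc N} (hw : w ∈ closure Ω) (hwx : dist w x < r) {t : ℝ}
    (ht : t ∈ Ioo 0 τ) : t * s ≤ infDist (w + t • ω) Ωᶜ :=
  le_infDist_compl_of_ball_subset hΩ (h.2 w ⟨hwx, hw⟩ t ht)

theorem FatCone.mono {s τ r r' : ℝ} {Ω : Set (Euc N)} {x y ω : Euc N}
    (h : FatCone s τ r Ω x ω) (hr : dist x y + r' ≤ r) : FatCone s τ r' Ω y ω := by
  refine ⟨h.1, fun w hw => h.2 w ⟨?_, hw.2⟩⟩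
  have := hw.1
  rw [mem_ball] at this ⊢
  linarith [dist_triangle w y x, dist_comm x y]

theorem exists_frontier_dist_eq {Ω : Set (Euc N)} (ho : IsOpen Ω) (hΩ : (Ωᶜ).Nonempty) {x : Euc N}
    (hx : x ∈ Ω) : ∃ y ∈ frontier Ω, dist x y = infDist x Ωᶜ := by
  obtain ⟨y, hy, hxy⟩ := ho.isClosed_compl.exists_infDist_eq_dist hΩ x
  refine ⟨y, ⟨?_, ?_⟩, hxy.symm⟩
  · have hb : ball x (infDist x Ωᶜ) ⊆ Ω := ball_infDist_compl_subset
    refine closure_mono hb ?_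
    rw [closure_ball _ (infDist_compl_pos ho hΩ hx).ne', mem_closedBall, dist_comm, hxy]
  · rw [ho.interior_eq]; exact hy

/-- The weighted Dirichlet energy. -/
def wEnergy {F : Type*} [NormedAddCommGroup F] [NormedSpace ℝ F] (Ω : Set (Euc N))
    (v : Euc N → F) : ENNReal :=
  ∫⁻ x in Ω, ENNReal.ofReal (infDist x Ωᶜ) ^ 2 * ‖fderiv ℝ v x‖ₑ ^ 2

variable {F : Type*} [NormedAddCommGroup F] [NormedSpace ℝ F]

theorem setLIntegral_fderiv_le_wEnergy {Ω S : Set (Euc N)} (hS : MeasurableSet S)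
    {η : ℝ} (hη : 0 < η) (v : Euc N → F) (h : ∀ x ∈ S, η ≤ infDist x Ωᶜ) :
    (∫⁻ x in S, ‖fderiv ℝ v x‖ₑ ^ 2) ≤ (ENNReal.ofReal η ^ 2)⁻¹ * wEnergy Ω v := by
  have hSΩ : S ⊆ Ω := fun x hx => mem_of_infDist_compl_pos (hη.trans_le (h x hx))
  have h0 : ENNReal.ofReal η ^ 2 ≠ 0 := by simp [hη]
  rw [← ENNReal.mul_le_iff_le_inv h0 (by finiteness), ← lintegral_const_mul' _ _ (by finiteness)]
  refine (setLIntegral_mono' hS fun x hx => ?_).trans (lintegral_mono_set hSΩ)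
  gcongr
  exact h x hx

theorem translate_le_wEnergy [CompleteSpace F] {Ω S : Set (Euc N)} (ho : IsOpen Ω)
    (hS : MeasurableSet S) {v : Euc N → F}
    (hv : ContDiffOn ℝ 1 v Ω) {η : ℝ} (hη : 0 < η) {e : Euc N} (he : ‖e‖ ≤ η)
    (h : ∀ x ∈ S, ∀ t ∈ Icc (0:ℝ) 1, η ≤ infDist (x + t • e) Ωᶜ) :
    (∫⁻ x in S, ‖v (x + e) - v x‖ₑ ^ 2) ≤ wEnergy Ω v := by
  set Z : Set (Euc N) := {x | η ≤ infDist x Ωᶜ} with hZ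
  have hZm : MeasurableSet Z := measurableSet_le measurable_const measurable_infDist
  have hZΩ : Z ⊆ Ω := fun x hx => mem_of_infDist_compl_pos (hη.trans_le hx)
  set φ : Euc N → ENNReal := Z.indicator fun x => ‖fderiv ℝ v x‖ₑ ^ 2 with hφ
  have hφm : Measurable φ := by
    have h1 := (aemeasurable_enorm_fderiv_sq ho hv).indicator hZm
    rwa [indicator_indicator, inter_eq_left.2 hZΩ] at h1
  have hpt : ∀ x ∈ S, ‖v (x + e) - v x‖ₑ ^ 2 ≤
      ∫⁻ t in Ioc (0:ℝ) 1, ‖e‖ₑ ^ 2 * φ (x + t • e) := by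
    intro x hx
    have hseg : ∀ t ∈ Icc (0:ℝ) 1, x + t • e ∈ Ω := fun t ht => hZΩ (h x hx t ht)
    have h1 := enorm_sub_le_lintegral_fderiv ho hv zero_le_one hseg
    rw [one_smul] at h1
    have hcont : ContinuousOn (fun t : ℝ => fderiv ℝ v (x + t • e)) (Icc 0 1) :=
      (hv.continuousOn_fderiv_of_isOpen ho le_rfl).comp (by fun_prop) hseg
    have hm : AEMeasurable (fun t : ℝ => ‖fderiv ℝ v (x + t • e)‖ₑ)
        (volume.restrict (Ioc (0:ℝ) 1)) :=
      ((continuous_enorm.comp_continuousOn hcont).mono Ioc_subset_Icc_self).aemeasurable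
        measurableSet_Ioc
    calc ‖v (x + e) - v x‖ₑ ^ 2 ≤ _ := pow_le_pow_left' h1 2
      _ ≤ _ := sq_lintegral_mul_le _ hm aemeasurable_const
      _ = ‖e‖ₑ ^ 2 * ∫⁻ t in Ioc (0:ℝ) 1, φ (x + t • e) := by
        rw [lintegral_const, Measure.restrict_apply_univ, Real.volume_Ioc, sub_zero,
          ENNReal.ofReal_one, mul_one, mul_comm]
        congr 1
        refine setLIntegral_congr_fun measurableSet_Ioc fun t ht => ?_
        simp only [hφ]
        have hmem : x + t • e ∈ Z := h x hx t (Ioc_subset_Icc_self ht)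
        rw [indicator_of_mem hmem]
      _ = _ := by rw [lintegral_const_mul' _ _ (by finiteness)]
  have hφI : ∀ b, (∫⁻ x, φ (x + b)) ≤ (ENNReal.ofReal η ^ 2)⁻¹ * wEnergy Ω v := by
    intro b
    rw [lintegral_add_right_eq_self φ b, hφ, lintegral_indicator hZm]
    exact setLIntegral_fderiv_le_wEnergy hZm hη v fun x hx => hx
  calc (∫⁻ x in S, ‖v (x + e) - v x‖ₑ ^ 2)
      ≤ ∫⁻ x in S, ∫⁻ t in Ioc (0:ℝ) 1, ‖e‖ₑ ^ 2 * φ (x + t • e) := setLIntegral_mono' hS hpt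
    _ = ∫⁻ t in Ioc (0:ℝ) 1, ∫⁻ x in S, ‖e‖ₑ ^ 2 * φ (x + t • e) :=
      lintegral_lintegral_swap (f := fun x t => ‖e‖ₑ ^ 2 * φ (x + t • e))
        ((hφm.comp (by fun_prop : Measurable fun q : Euc N × ℝ =>
          q.1 + q.2 • e)).const_mul _).aemeasurable
    _ ≤ ∫⁻ t in Ioc (0:ℝ) 1, wEnergy Ω v := by
      refine lintegral_mono fun t => (setLIntegral_le_lintegral _ _).trans ?_
      rw [lintegral_const_mul' _ _ (by finiteness)]
      have he' : ‖e‖ₑ ≤ ENNReal.ofReal η := by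
        rw [← ofReal_norm]; exact ENNReal.ofReal_le_ofReal he
      have h0 : ENNReal.ofReal η ^ 2 ≠ 0 := by simp [hη]
      calc _ ≤ ENNReal.ofReal η ^ 2 * ((ENNReal.ofReal η ^ 2)⁻¹ * wEnergy Ω v) :=
            mul_le_mul' (pow_le_pow_left' he' 2) (hφI _)
        _ = _ := by rw [← mul_assoc, ENNReal.mul_inv_cancel h0 (by finiteness), one_mul]
    _ = _ := by simp

end Cone

section Hardy

theorem lintegral_rpow_neg_three_halves_le {δ T : ℝ} (hδ : 0 < δ) (hT : 0 < T) :
    (∫⁻ t in Ioc 0 T, ENNReal.ofReal ((t + δ) ^ (-(3 / 2) : ℝ))) ≤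
      ENNReal.ofReal (2 * δ ^ (-(1 / 2) : ℝ)) := by
  have hcont : ContinuousOn (fun t : ℝ => (t + δ) ^ (-(3 / 2) : ℝ)) (Icc 0 T) := by
    refine ContinuousOn.rpow_const (by fun_prop) fun t ht => Or.inl ?_
    linarith [ht.1]
  have hint : IntegrableOn (fun t : ℝ => (t + δ) ^ (-(3 / 2) : ℝ)) (Ioc 0 T) :=
    (hcont.integrableOn_Icc).mono_set Ioc_subset_Icc_self
  rw [← ofReal_integral_eq_lintegral_ofReal hint]
  · refine ENNReal.ofReal_le_ofReal ?_
    rw [← intervalIntegral.integral_of_le hT.le,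
      intervalIntegral.integral_comp_add_right (fun t : ℝ => t ^ (-(3 / 2) : ℝ)) δ,
      integral_rpow]
    · have h1 : (-(3 / 2) + 1 : ℝ) = -(1 / 2) := by norm_num
      rw [h1, zero_add]
      have : 0 ≤ (T + δ) ^ (-(1 / 2) : ℝ) := by positivity
      have h2 : ∀ x y : ℝ, (x - y) / (-(1 / 2)) = 2 * y - 2 * x := fun x y => by ring
      rw [h2]
      linarith
    · right
      refine ⟨by norm_num, ?_⟩
      rw [uIcc_of_le (by linarith), mem_Icc]
      intro h
      linarith [h.1]
  · filter_upwards [ae_restrict_mem measurableSet_Ioc] with t ht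
    have : 0 < t + δ := by linarith [ht.1]
    positivity

theorem lintegral_rpow_neg_half {b : ℝ} (hb : 0 < b) :
    (∫⁻ t in Ioo 0 b, ENNReal.ofReal ((b - t) ^ (-(1 / 2) : ℝ))) =
      ENNReal.ofReal (2 * b ^ (1 / 2 : ℝ)) := by
  have hI : IntervalIntegrable (fun t : ℝ => (b - t) ^ (-(1 / 2) : ℝ)) volume 0 b := by
    have h := (intervalIntegral.intervalIntegrable_rpow' (a := 0) (b := b)
      (r := (-(1 / 2) : ℝ)) (by norm_num)).comp_sub_left b
    simp only [sub_zero, sub_self] at h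
    exact h.symm
  have hint : IntegrableOn (fun t : ℝ => (b - t) ^ (-(1 / 2) : ℝ)) (Ioo 0 b) :=
    ((intervalIntegrable_iff_integrableOn_Ioc_of_le hb.le).1 hI).mono_set Ioo_subset_Ioc_self
  rw [← ofReal_integral_eq_lintegral_ofReal hint]
  · rw [← integral_Ioc_eq_integral_Ioo, ← intervalIntegral.integral_of_le hb.le,
      intervalIntegral.integral_comp_sub_left (fun t : ℝ => t ^ (-(1 / 2) : ℝ)) b,
      integral_rpow (Or.inl (by norm_num))]
    have h1 : (-(1 / 2) + 1 : ℝ) = 1 / 2 := by norm_num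
    rw [h1, sub_self, sub_zero, zero_rpow (by norm_num)]
    congr 1
    ring
  · filter_upwards [ae_restrict_mem measurableSet_Ioo] with t ht
    have : 0 < b - t := by linarith [ht.2]
    positivity

variable {N : ℕ} {F : Type*} [NormedAddCommGroup F] [NormedSpace ℝ F]

/-- Integral of `δ^(-1/2)` along the part of a line lying in `A`. -/
theorem lintegral_line_le {Ω A : Set (Euc N)} {s T : ℝ} (hs : 0 < s) {ω : Euc N}
    (hA : ∀ w ∈ A, ∀ t ∈ Ioc 0 T, t * s ≤ infDist (w + t • ω) Ωᶜ) (y : Euc N) :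
    (∫⁻ t in Ioc 0 T, A.indicator (fun w => ENNReal.ofReal (infDist w Ωᶜ ^ (-(1 / 2) : ℝ)))
      (y - t • ω)) ≤ ENNReal.ofReal (2 / s * infDist y Ωᶜ ^ (1 / 2 : ℝ)) := by
  set V : Set ℝ := {t | t ∈ Ioc 0 T ∧ y - t • ω ∈ A} with hV
  rcases V.eq_empty_or_nonempty with hemp | ⟨t1, ht1⟩
  · have : ∀ t ∈ Ioc 0 T, A.indicator (fun w => ENNReal.ofReal (infDist w Ωᶜ ^ (-(1 / 2) : ℝ)))
        (y - t • ω) = 0 := fun t ht => by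
      refine indicator_of_notMem (fun h => ?_) _
      exact (hemp ▸ (⟨ht, h⟩ : t ∈ V) : t ∈ (∅ : Set ℝ))
    rw [setLIntegral_congr_fun measurableSet_Ioc this]
    simp
  have hbdd : BddAbove V := ⟨T, fun t ht => ht.1.2⟩
  set b := sSup V with hb
  have hb0 : 0 < b := ht1.1.1.trans_le (le_csSup hbdd ht1)
  have hbT : b ≤ T := csSup_le ⟨t1, ht1⟩ fun t ht => ht.1.2
  have hby : b * s ≤ infDist y Ωᶜ := by
    rw [← le_div_iff₀ hs]
    refine csSup_le ⟨t1, ht1⟩ fun t ht => ?_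
    rw [le_div_iff₀ hs]
    simpa using hA _ ht.2 t ht.1
  have hlow : ∀ t ∈ V, t < b → (b - t) * s ≤ infDist (y - t • ω) Ωᶜ := by
    intro t ht htb
    rw [← le_div_iff₀ hs, sub_le_iff_le_add]
    refine csSup_le ⟨t1, ht1⟩ fun t' ht' => ?_
    rw [← sub_le_iff_le_add, le_div_iff₀ hs]
    rcases le_or_gt t' t with h | h
    · exact (mul_nonpos_of_nonpos_of_nonneg (by linarith) hs.le).trans infDist_nonneg
    · have := hA _ ht'.2 (t' - t) ⟨by linarith, by linarith [ht'.1.2, ht.1.1]⟩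
      rwa [show y - t' • ω + (t' - t) • ω = y - t • ω by module] at this
  calc _ ≤ ∫⁻ t in Ioc 0 T, (Ioo 0 b).indicator (fun t =>
        ENNReal.ofReal (((b - t) * s) ^ (-(1 / 2) : ℝ))) t := by
        refine lintegral_mono_ae ?_
        filter_upwards [ae_restrict_mem measurableSet_Ioc,
          (Measure.ae_ne (volume.restrict (Ioc 0 T)) b)] with t ht htb
        by_cases hmem : y - t • ω ∈ A
        · have htV : t ∈ V := ⟨ht, hmem⟩
          have hlt : t < b := lt_of_le_of_ne (le_csSup hbdd htV) htb
          have hIoo : t ∈ Ioo 0 b := ⟨ht.1, hlt⟩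
          rw [indicator_of_mem hmem, indicator_of_mem hIoo]
          refine ENNReal.ofReal_le_ofReal ?_
          exact rpow_le_rpow_of_nonpos (mul_pos (by linarith) hs) (hlow t htV hlt) (by norm_num)
        · rw [indicator_of_notMem hmem]
          exact zero_le
    _ ≤ ∫⁻ t, (Ioo 0 b).indicator (fun t =>
        ENNReal.ofReal (((b - t) * s) ^ (-(1 / 2) : ℝ))) t := setLIntegral_le_lintegral _ _
    _ = ∫⁻ t in Ioo 0 b, ENNReal.ofReal (s ^ (-(1 / 2) : ℝ)) *
          ENNReal.ofReal ((b - t) ^ (-(1 / 2) : ℝ)) := by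
        rw [lintegral_indicator measurableSet_Ioo]
        refine setLIntegral_congr_fun measurableSet_Ioo fun t ht => ?_
        rw [mul_rpow (by linarith [ht.2]) hs.le, mul_comm, ENNReal.ofReal_mul (by positivity)]
    _ = ENNReal.ofReal (s ^ (-(1 / 2) : ℝ) * (2 * b ^ (1 / 2 : ℝ))) := by
        rw [lintegral_const_mul' _ _ (by finiteness), lintegral_rpow_neg_half hb0,
          ← ENNReal.ofReal_mul (by positivity)]
    _ ≤ _ := by
        refine ENNReal.ofReal_le_ofReal ?_
        have h1 : b ^ (1 / 2 : ℝ) ≤ (infDist y Ωᶜ / s) ^ (1 / 2 : ℝ) := by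
          refine rpow_le_rpow hb0.le ?_ (by norm_num)
          rwa [le_div_iff₀ hs]
        have h2 : s ^ (1 / 2 : ℝ) * s ^ (1 / 2 : ℝ) = s := by
          rw [← rpow_add hs]; norm_num
        have h3 : 0 < s ^ (1 / 2 : ℝ) := by positivity
        rw [div_rpow infDist_nonneg hs.le] at h1
        calc s ^ (-(1 / 2) : ℝ) * (2 * b ^ (1 / 2 : ℝ))
            ≤ s ^ (-(1 / 2) : ℝ) * (2 * (infDist y Ωᶜ ^ (1 / 2 : ℝ) / s ^ (1 / 2 : ℝ))) := by
              gcongr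
          _ = 2 / (s ^ (1 / 2 : ℝ) * s ^ (1 / 2 : ℝ)) * infDist y Ωᶜ ^ (1 / 2 : ℝ) := by
              rw [rpow_neg hs.le]
              field_simp
          _ = _ := by rw [h2]

theorem cone_dist_lower {Ω : Set (Euc N)} {s : ℝ} (hs : 0 < s) (hs1 : s ≤ 1) {w ω : Euc N}
    (hω : ‖ω‖ = 1) {t : ℝ} (ht : 0 ≤ t) (h : t * s ≤ infDist (w + t • ω) Ωᶜ) :
    s / 3 * (t + infDist w Ωᶜ) ≤ infDist (w + t • ω) Ωᶜ := by
  have h1 : infDist w Ωᶜ ≤ infDist (w + t • ω) Ωᶜ + t := by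
    have := infDist_le_infDist_add_dist (s := Ωᶜ) (x := w) (y := w + t • ω)
    rwa [dist_self_add_right, norm_smul, hω, mul_one, Real.norm_of_nonneg ht] at this
  nlinarith [mul_nonneg ht (by linarith : 0 ≤ 1 - s), mul_nonneg ht hs.le,
    infDist_nonneg (x := w + t • ω) (s := Ωᶜ)]

/-- The constant in the Hardy inequality on cones. -/
def hardyConst (s : ℝ) : ENNReal :=
  ENNReal.ofReal ((s / 3) ^ (-(3 / 2) : ℝ) * 2) * ENNReal.ofReal (2 / s)

theorem hardy_cone [CompleteSpace F] {Ω A : Set (Euc N)} (ho : IsOpen Ω) (hΩ : (Ωᶜ).Nonempty)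
    (hAm : MeasurableSet A) (hAΩ : A ⊆ Ω) {s T : ℝ} (hs : 0 < s) (hs1 : s ≤ 1) (hT : 0 < T)
    {ω : Euc N} (hω : ‖ω‖ = 1)
    (hA : ∀ w ∈ A, ∀ t ∈ Ioc 0 T, t * s ≤ infDist (w + t • ω) Ωᶜ) {v : Euc N → F}
    (hv : ContDiffOn ℝ 1 v Ω) :
    (∫⁻ w in A, ‖v (w + T • ω) - v w‖ₑ ^ 2) ≤ hardyConst s * wEnergy Ω v := by
  set δ : Euc N → ℝ := fun x => infDist x Ωᶜ with hδ
  have hδm : Measurable δ := measurable_infDist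
  set K : ENNReal := ENNReal.ofReal ((s / 3) ^ (-(3 / 2) : ℝ) * 2) with hK
  set Θ : Euc N → ENNReal := A.indicator fun w => ENNReal.ofReal (δ w ^ (-(1 / 2) : ℝ)) with hΘ
  set ψ : Euc N → ENNReal := Ω.indicator fun x => ‖fderiv ℝ v x‖ₑ ^ 2 with hψ
  set Ψ : Euc N → ENNReal := fun x => ENNReal.ofReal (δ x ^ (3 / 2 : ℝ)) * ψ x with hΨ
  have hψm : Measurable ψ := aemeasurable_enorm_fderiv_sq ho hv
  have hΨm : Measurable Ψ := (hδm.pow_const _).ennreal_ofReal.mul hψm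
  have hΘm : Measurable Θ := (hδm.pow_const _).ennreal_ofReal.indicator hAm
  have hpt : ∀ w ∈ A, ‖v (w + T • ω) - v w‖ₑ ^ 2 ≤
      ∫⁻ t in Ioc 0 T, K * (Θ w * Ψ (w + t • ω)) := by
    intro w hw
    have hδw : 0 < δ w := infDist_compl_pos ho hΩ (hAΩ hw)
    have hposd : ∀ t ∈ Icc 0 T, 0 < δ (w + t • ω) := by
      intro t ht
      rcases ht.1.eq_or_lt with h | h
      · rw [← h, zero_smul, add_zero]; exact hδw
      · exact (mul_pos h hs).trans_le (hA w hw t ⟨h, ht.2⟩)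
    have hseg : ∀ t ∈ Icc 0 T, w + t • ω ∈ Ω := fun t ht => mem_of_infDist_compl_pos (hposd t ht)
    have h1 := enorm_sub_le_lintegral_fderiv ho hv hT.le hseg
    have hω' : ‖ω‖ₑ = 1 := by rw [← ofReal_norm, hω, ENNReal.ofReal_one]
    simp only [hω', mul_one] at h1
    have hcont : ContinuousOn (fun t : ℝ => fderiv ℝ v (w + t • ω)) (Icc 0 T) :=
      (hv.continuousOn_fderiv_of_isOpen ho le_rfl).comp (by fun_prop) hseg
    have hm : AEMeasurable (fun t : ℝ => ‖fderiv ℝ v (w + t • ω)‖ₑ)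
        (volume.restrict (Ioc 0 T)) :=
      ((continuous_enorm.comp_continuousOn hcont).mono Ioc_subset_Icc_self).aemeasurable
        measurableSet_Ioc
    have hδl : Measurable fun t : ℝ => δ (w + t • ω) := hδm.comp (by fun_prop)
    have h2 : (∫⁻ t in Ioc 0 T, ‖fderiv ℝ v (w + t • ω)‖ₑ) =
        ∫⁻ t in Ioc 0 T, ENNReal.ofReal (δ (w + t • ω) ^ (-(3 / 4) : ℝ)) *
          (ENNReal.ofReal (δ (w + t • ω) ^ (3 / 4 : ℝ)) * ‖fderiv ℝ v (w + t • ω)‖ₑ) := by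
      refine setLIntegral_congr_fun measurableSet_Ioc fun t ht => ?_
      have hp := hposd t (Ioc_subset_Icc_self ht)
      beta_reduce
      rw [← mul_assoc, ← ENNReal.ofReal_mul (by positivity), ← rpow_add hp]
      norm_num
    have hsq : ∀ (x r : ℝ), 0 < x → ENNReal.ofReal (x ^ r) ^ 2 = ENNReal.ofReal (x ^ (2 * r)) := by
      intro x r hx
      rw [← ENNReal.ofReal_pow (by positivity), mul_comm, rpow_mul_natCast hx.le r 2 |>.symm]
      norm_num
    have h3 : (∫⁻ t in Ioc 0 T, ENNReal.ofReal (δ (w + t • ω) ^ (-(3 / 4) : ℝ)) ^ 2) ≤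
        K * Θ w := by
      calc _ ≤ ∫⁻ t in Ioc 0 T, ENNReal.ofReal ((s / 3) ^ (-(3 / 2) : ℝ)) *
            ENNReal.ofReal ((t + δ w) ^ (-(3 / 2) : ℝ)) := by
            refine setLIntegral_mono' measurableSet_Ioc fun t ht => ?_
            have hp := hposd t (Ioc_subset_Icc_self ht)
            rw [hsq _ _ hp, ← ENNReal.ofReal_mul (by positivity),
              ← mul_rpow (by positivity) (by linarith [ht.1])]
            refine ENNReal.ofReal_le_ofReal ?_
            have h5 := cone_dist_lower hs hs1 hω ht.1.le (hA w hw t ht)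
            rw [show (2 * -(3 / 4) : ℝ) = -(3 / 2) by norm_num]
            exact rpow_le_rpow_of_nonpos (mul_pos (by positivity) (by linarith [ht.1])) h5
              (by norm_num)
        _ ≤ ENNReal.ofReal ((s / 3) ^ (-(3 / 2) : ℝ)) *
            ENNReal.ofReal (2 * δ w ^ (-(1 / 2) : ℝ)) := by
            rw [lintegral_const_mul' _ _ (by finiteness)]
            gcongr
            exact lintegral_rpow_neg_three_halves_le hδw hT
        _ = _ := by
            rw [hΘ, indicator_of_mem hw, hK, ← ENNReal.ofReal_mul (by positivity),
              ← ENNReal.ofReal_mul (by positivity), mul_assoc]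
    calc ‖v (w + T • ω) - v w‖ₑ ^ 2 ≤ _ := pow_le_pow_left' h1 2
      _ ≤ (∫⁻ t in Ioc 0 T, ENNReal.ofReal (δ (w + t • ω) ^ (-(3 / 4) : ℝ)) ^ 2) *
          ∫⁻ t in Ioc 0 T, (ENNReal.ofReal (δ (w + t • ω) ^ (3 / 4 : ℝ)) *
            ‖fderiv ℝ v (w + t • ω)‖ₑ) ^ 2 := by
        rw [h2]
        exact sq_lintegral_mul_le _ (hδl.pow_const _).ennreal_ofReal.aemeasurable
          ((hδl.pow_const _).ennreal_ofReal.aemeasurable.mul hm)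
      _ ≤ (K * Θ w) * ∫⁻ t in Ioc 0 T, Ψ (w + t • ω) := by
        refine mul_le_mul' h3 (le_of_eq ?_)
        refine setLIntegral_congr_fun measurableSet_Ioc fun t ht => ?_
        have hp := hposd t (Ioc_subset_Icc_self ht)
        simp only [hΨ, hψ]
        rw [mul_pow, hsq _ _ hp, indicator_of_mem (hseg t (Ioc_subset_Icc_self ht))]
        norm_num
      _ = _ := by
        have hfin : K * Θ w ≠ ⊤ := by
          rw [hΘ, indicator_of_mem hw]; finiteness
        rw [← lintegral_const_mul' _ _ hfin]
        simp only [mul_assoc]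
  have hmul : ∀ y ∈ Ω, Ψ y * ENNReal.ofReal (2 / s * δ y ^ (1 / 2 : ℝ)) =
      ENNReal.ofReal (2 / s) * (ENNReal.ofReal (δ y) ^ 2 * ‖fderiv ℝ v y‖ₑ ^ 2) := by
    intro y hy
    have hp : 0 < δ y := infDist_compl_pos ho hΩ hy
    simp only [hΨ, hψ]
    rw [indicator_of_mem hy, ENNReal.ofReal_mul (by positivity), ← ENNReal.ofReal_pow hp.le]
    have : ENNReal.ofReal (δ y ^ 2) = ENNReal.ofReal (δ y ^ (3 / 2 : ℝ)) *
        ENNReal.ofReal (δ y ^ (1 / 2 : ℝ)) := by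
      rw [← ENNReal.ofReal_mul (by positivity), ← rpow_add hp, ← rpow_natCast]
      norm_num
    rw [this]
    ring
  calc (∫⁻ w in A, ‖v (w + T • ω) - v w‖ₑ ^ 2)
      ≤ ∫⁻ w in A, ∫⁻ t in Ioc 0 T, K * (Θ w * Ψ (w + t • ω)) := setLIntegral_mono' hAm hpt
    _ ≤ ∫⁻ w, ∫⁻ t in Ioc 0 T, K * (Θ w * Ψ (w + t • ω)) := setLIntegral_le_lintegral _ _
    _ = ∫⁻ t in Ioc 0 T, ∫⁻ w, K * (Θ w * Ψ (w + t • ω)) := by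
      refine lintegral_lintegral_swap (f := fun w t => K * (Θ w * Ψ (w + t • ω))) ?_
      refine (Measurable.const_mul (Measurable.mul ?_ ?_) _).aemeasurable
      · exact hΘm.comp measurable_fst
      · exact hΨm.comp (by fun_prop)
    _ = ∫⁻ t in Ioc 0 T, ∫⁻ y, K * (Θ (y - t • ω) * Ψ y) := by
      refine lintegral_congr fun t => ?_
      rw [← lintegral_add_right_eq_self (fun y => K * (Θ (y - t • ω) * Ψ y)) (t • ω)]
      simp only [add_sub_cancel_right]
    _ = ∫⁻ y, ∫⁻ t in Ioc 0 T, K * (Θ (y - t • ω) * Ψ y) := by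
      refine lintegral_lintegral_swap (f := fun t y => K * (Θ (y - t • ω) * Ψ y)) ?_
      refine (Measurable.const_mul (Measurable.mul ?_ ?_) _).aemeasurable
      · exact hΘm.comp (by fun_prop)
      · exact hΨm.comp measurable_snd
    _ ≤ ∫⁻ y, K * (Ω.indicator (fun y => ENNReal.ofReal (2 / s) *
          (ENNReal.ofReal (δ y) ^ 2 * ‖fderiv ℝ v y‖ₑ ^ 2)) y) := by
      refine lintegral_mono fun y => ?_
      rw [lintegral_const_mul' _ _ (by finiteness)]
      refine mul_le_mul' le_rfl ?_
      by_cases hy : y ∈ Ω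
      · rw [indicator_of_mem hy, ← hmul y hy, lintegral_mul_const (Ψ y)
          (show Measurable fun t : ℝ => Θ (y - t • ω) from hΘm.comp (by fun_prop)), mul_comm]
        exact mul_le_mul' le_rfl (lintegral_line_le hs hA y)
      · have : Ψ y = 0 := by simp only [hΨ, hψ]; rw [indicator_of_notMem hy, mul_zero]
        simp [this]
    _ = _ := by
      rw [lintegral_const_mul' _ _ (by finiteness), lintegral_indicator ho.measurableSet,
        lintegral_const_mul' _ _ (by finiteness), hardyConst, mul_assoc]
      rfl

end Hardy

section Chains

variable {N : ℕ}

/-- `p` and `q` are joined by a chain in `U` with steps shorter than `η`. -/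
def ChainConn {X : Type*} [PseudoMetricSpace X] (U : Set X) (η : ℝ) : X → X → Prop :=
  Relation.ReflTransGen fun p q => p ∈ U ∧ q ∈ U ∧ dist p q < η

namespace ChainConn

variable {X : Type*} [PseudoMetricSpace X] {U : Set X} {η : ℝ}

theorem symm {p q : X} (h : ChainConn U η p q) : ChainConn U η q p := by
  induction h with
  | refl => exact .refl
  | tail _ hab ih => exact .head ⟨hab.2.1, hab.1, by rw [dist_comm]; exact hab.2.2⟩ ih

theorem trans {p q r : X} (h : ChainConn U η p q) (h' : ChainConn U η q r) : ChainConn U η p r :=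
  Relation.ReflTransGen.trans h h'

theorem single {p q : X} (hp : p ∈ U) (hq : q ∈ U) (h : dist p q < η) : ChainConn U η p q :=
  Relation.ReflTransGen.single ⟨hp, hq, h⟩

theorem of_isPreconnected {S : Set X} (hS : IsPreconnected S) (hSU : S ⊆ U) (hη : 0 < η) {p q : X}
    (hp : p ∈ S) (hq : q ∈ S) : ChainConn U η p q := by
  refine hS.induction₂ (ChainConn U η) (fun x hx => ?_) (fun _ _ _ _ _ _ h h' => h.trans h')
    (fun _ _ _ _ h => h.symm) hp hq
  filter_upwards [inter_mem_nhdsWithin S (ball_mem_nhds x hη)] with y hy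
  exact single (hSU hx) (hSU hy.1) (by rw [dist_comm]; exact hy.2)

end ChainConn

theorem chainConn_add_smul {U : Set (Euc N)} {η T : ℝ} (hη : 0 < η) (hT : 0 ≤ T) {x ω : Euc N}
    (h : ∀ t ∈ Icc 0 T, x + t • ω ∈ U) : ChainConn U η x (x + T • ω) := by
  refine ChainConn.of_isPreconnected (S := (fun t : ℝ => x + t • ω) '' Icc 0 T)
    (isPreconnected_Icc.image _ (by fun_prop)) ?_ hη
    ⟨0, ⟨le_rfl, hT⟩, by simp⟩ ⟨T, ⟨hT, le_rfl⟩, rfl⟩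
  rintro _ ⟨t, ht, rfl⟩
  exact h t ht

variable {Ω : Set (Euc N)} {s a η : ℝ}

/-- Starting at depth `c`, moving in a cone direction keeps the depth above `c s / 4`. -/
theorem cone_move_depth (hΩ : (Ωᶜ).Nonempty) (hs : 0 < s) (hs1 : s ≤ 1) {r c : ℝ} (hc : 0 < c)
    {x ω w : Euc N} (hcone : FatCone s (a / 2) r Ω x ω) (hwx : dist w x < r)
    (hw : c ≤ infDist w Ωᶜ) {t : ℝ} (ht : 0 ≤ t) (hta : t < a / 2) :
    c * s / 4 ≤ infDist (w + t • ω) Ωᶜ := by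
  have hwΩ : w ∈ Ω := mem_of_infDist_compl_pos (hc.trans_le hw)
  rcases le_or_gt t (c / 2) with h | h
  · have := infDist_le_infDist_add_dist (s := Ωᶜ) (x := w) (y := w + t • ω)
    rw [dist_self_add_right, norm_smul, hcone.1, mul_one, Real.norm_of_nonneg ht] at this
    nlinarith
  · have := hcone.le_infDist hΩ (subset_closure hwΩ) hwx ⟨by linarith, hta⟩
    nlinarith

theorem exists_chain_anchor (ho : IsOpen Ω) (hconn : IsConnected Ω) (hΩ : (Ωᶜ).Nonempty)
    (hs : 0 < s) (hs1 : s ≤ 1) (ha : 0 < a) (hη : 0 < η)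
    (hB : ∀ x ∈ frontier Ω, ∃ ω, FatCone s (a / 2) a Ω x ω) {p q : Euc N}
    (hp : a / 8 * s ≤ infDist p Ωᶜ) (hq : a / 8 * s ≤ infDist q Ωᶜ) :
    ChainConn {x | a / 8 * s * s / 4 ≤ infDist x Ωᶜ} η p q := by
  set T := a / 8 with hT
  set c := T * s with hc
  have hT0 : 0 < T := by positivity
  have hc0 : 0 < c := by positivity
  set U : Set (Euc N) := {x | c * s / 4 ≤ infDist x Ωᶜ} with hU
  have hcU : ∀ x, c ≤ infDist x Ωᶜ → x ∈ U := fun x hx => by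
    change c * s / 4 ≤ _
    nlinarith
  have hTa : T < a / 2 := by rw [hT]; linarith
  set P : Euc N → Set (Euc N) := fun x =>
    {y | (y = x ∧ c ≤ infDist x Ωᶜ) ∨ ∃ ω, FatCone s (a / 2) (a / 2) Ω x ω ∧ y = x + T • ω} with hP
  have hstep : ∀ x ω r w, FatCone s (a / 2) r Ω x ω → dist w x < r → w ∈ Ω →
      c ≤ infDist (w + T • ω) Ωᶜ := fun x ω r w hcone hwx hw =>
    hcone.le_infDist hΩ (subset_closure hw) hwx ⟨hT0, hTa⟩
  have hmove : ∀ x ω r w, FatCone s (a / 2) r Ω x ω → dist w x < r → c ≤ infDist w Ωᶜ →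
      ChainConn U η w (w + T • ω) := by
    intro x ω r w hcone hwx hw
    exact chainConn_add_smul hη hT0.le fun t ht =>
      cone_move_depth hΩ hs hs1 hc0 hcone hwx hw ht.1 (ht.2.trans_lt hTa)
  have htwo : ∀ x ω ω', x ∈ Ω → FatCone s (a / 2) (a / 4) Ω x ω → FatCone s (a / 2) (a / 4) Ω x ω' →
      ChainConn U η (x + T • ω) (x + T • ω') := by
    intro x ω ω' hx h h'
    have hd : ∀ ω : Euc N, ‖ω‖ = 1 → dist (x + T • ω) x < a / 4 := fun ω hω => by
      rw [dist_self_add_left, norm_smul, hω, mul_one, Real.norm_of_nonneg hT0.le]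
      rw [hT]; linarith
    have h0 : dist x x < a / 4 := by rw [dist_self]; positivity
    have h1 := hmove x ω' _ (x + T • ω) h' (hd ω h.1) (hstep x ω _ x h h0 hx)
    have h2 := hmove x ω _ (x + T • ω') h (hd ω' h'.1) (hstep x ω' _ x h' h0 hx)
    rw [add_right_comm] at h2
    exact h1.trans h2.symm
  have hne : ∀ x ∈ Ω, (P x).Nonempty := by
    intro x hx
    rcases le_or_gt c (infDist x Ωᶜ) with h | h
    · exact ⟨x, Or.inl ⟨rfl, h⟩⟩
    · obtain ⟨y, hy, hxy⟩ := exists_frontier_dist_eq ho hΩ hx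
      obtain ⟨ω, hω⟩ := hB y hy
      refine ⟨x + T • ω, Or.inr ⟨ω, hω.mono ?_, rfl⟩⟩
      rw [dist_comm, hxy]
      have : c ≤ T := by rw [hc]; nlinarith
      linarith
  have key : ∀ x ∈ Ω, ∀ y ∈ Ω, (∀ p ∈ P x, ∀ q ∈ P y, ChainConn U η p q) := by
    intro x hx y hy
    refine hconn.isPreconnected.induction₂ (fun x y => ∀ p ∈ P x, ∀ q ∈ P y, ChainConn U η p q)
      (fun x hx => ?_) (fun x y z _ hy _ h h' p hp q hq => ?_) (fun x y _ _ h p hp q hq => ?_) hx hy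
    · have hr : 0 < min η (a / 4) := by positivity
      filter_upwards [inter_mem_nhdsWithin Ω (ball_mem_nhds x hr)] with y hy p hp q hq
      have hyΩ := hy.1
      have hxy : dist y x < η := (mem_ball.1 hy.2).trans_le (min_le_left _ _)
      have hxy' : dist y x < a / 4 := (mem_ball.1 hy.2).trans_le (min_le_right _ _)
      have hxx : dist x x < a / 2 := by rw [dist_self]; positivity
      have hyy : dist y y < a / 2 := by rw [dist_self]; positivity
      have hyx2 : dist y x < a / 2 := by linarith
      have hxy2 : dist x y < a / 2 := by rw [dist_comm]; linarith
      have hshift : ∀ ω, dist (x + T • ω) (y + T • ω) < η := fun ω => by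
        rw [dist_add_right, dist_comm]; exact hxy
      rcases hp with ⟨rfl, hpc⟩ | ⟨ω, hω, rfl⟩ <;> rcases hq with ⟨rfl, hqc⟩ | ⟨ω', hω', rfl⟩
      · exact ChainConn.single (hcU _ hpc) (hcU _ hqc) (by rw [dist_comm]; exact hxy)
      · refine (hmove y ω' _ p hω' hxy2 hpc).trans (ChainConn.single (hcU _ ?_) (hcU _ ?_)
          (hshift ω'))
        · exact hstep y ω' _ _ hω' hxy2 hx
        · exact hstep y ω' _ _ hω' hyy hyΩ
      · refine ChainConn.trans (ChainConn.single (hcU _ ?_) (hcU _ ?_) (hshift ω))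
          (hmove x ω _ q hω hyx2 hqc).symm
        · exact hstep x ω _ _ hω hxx hx
        · exact hstep x ω _ _ hω hyx2 hyΩ
      · refine (htwo x ω ω' hx (hω.mono ?_) (hω'.mono ?_)).trans
          (ChainConn.single (hcU _ ?_) (hcU _ ?_) (hshift ω'))
        · rw [dist_self]; linarith
        · linarith
        · exact hstep y ω' _ _ hω' hxy2 hx
        · exact hstep y ω' _ _ hω' hyy hyΩ
    · obtain ⟨r, hr⟩ := hne y hy
      exact (h p hp r hr).trans (h' r hr q hq)
    · exact (h q hq p hp).symm
  exact key p (mem_of_infDist_compl_pos (hc0.trans_le hp)) q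
    (mem_of_infDist_compl_pos (hc0.trans_le hq)) p (Or.inl ⟨rfl, hp⟩) q (Or.inl ⟨rfl, hq⟩)

/-- A quantity that at most doubles at each short step grows by a bounded factor along chains in a
set covered by `n` small balls. -/
theorem chain_growth {U : Set (Euc N)} {η ρ : ℝ} (hη : 5 * η ≤ ρ) (hη0 : 0 < η) {n : ℕ}
    {c : Fin n → Euc N}
    (hcov : ∀ x ∈ U, ∃ i, x ∈ ball (c i) η) {Φ : Euc N → ENNReal}
    (hΦ : ∀ p ∈ U, ∀ q ∈ U, dist p q ≤ ρ → Φ q ≤ 2 * Φ p) {p q : Euc N} (hp : p ∈ U) (hq : q ∈ U)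
    (h : ChainConn U η p q) : Φ q ≤ 2 ^ (n + 1) * Φ p := by
  classical
  let G : SimpleGraph (Fin n) := SimpleGraph.fromRel fun i j =>
    ∃ x ∈ U ∩ ball (c i) η, ∃ y ∈ U ∩ ball (c j) η, dist x y < η
  have hadj : ∀ i j, (i = j ∨ G.Adj i j) → ∀ x ∈ U ∩ ball (c i) η, ∀ y ∈ U ∩ ball (c j) η,
      Φ y ≤ 2 * Φ x := by
    intro i j hij x hx y hy
    refine hΦ x hx.1 y hy.1 (le_trans ?_ hη)
    have hxi := mem_ball.1 hx.2
    have hyj := mem_ball.1 hy.2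
    rcases hij with rfl | hij
    · linarith [dist_triangle_right x y (c i)]
    · have hex : ∃ x' ∈ U ∩ ball (c i) η, ∃ y' ∈ U ∩ ball (c j) η, dist x' y' < η := by
        rcases (SimpleGraph.fromRel_adj _ _ _).1 hij |>.2 with h | ⟨y', hy', x', hx', h⟩
        · exact h
        · exact ⟨x', hx', y', hy', by rwa [dist_comm]⟩
      obtain ⟨x', hx', y', hy', hlt⟩ := hex
      have h1 := mem_ball.1 hx'.2
      have h2 := mem_ball.1 hy'.2
      have := dist_triangle_right x x' (c i)
      have := dist_triangle_right y' y (c j)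
      linarith [dist_triangle4 x x' y' y]
  have hreach : ∀ {q}, ChainConn U η p q → ∀ i j, p ∈ ball (c i) η → q ∈ ball (c j) η →
      q ∈ U → G.Reachable i j := by
    intro q h
    induction h with
    | refl =>
      intro i j hi hj _
      by_cases hij : i = j
      · rw [hij]
      · exact SimpleGraph.Adj.reachable ((SimpleGraph.fromRel_adj _ _ _).2
          ⟨hij, Or.inl ⟨p, ⟨hp, hi⟩, p, ⟨hp, hj⟩, by simpa using hη0⟩⟩)
    | @tail y z _ hyz ih =>
      intro i j hi hj hz
      obtain ⟨k, hk⟩ := hcov y hyz.1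
      refine (ih i k hi hk hyz.1).trans ?_
      by_cases hij : k = j
      · rw [hij]
      · exact SimpleGraph.Adj.reachable ((SimpleGraph.fromRel_adj _ _ _).2
          ⟨hij, Or.inl ⟨y, ⟨hyz.1, hk⟩, z, ⟨hz, hj⟩, hyz.2.2⟩⟩)
  have hwalk : ∀ {i j} (w : G.Walk i j), ∀ x ∈ U ∩ ball (c i) η, ∀ y ∈ U ∩ ball (c j) η,
      Φ y ≤ 2 ^ (w.length + 1) * Φ x := by
    intro i j w
    induction w with
    | nil =>
      intro x hx y hy
      simpa using hadj _ _ (Or.inl rfl) x hx y hy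
    | @cons i k j hik w ih =>
      intro x hx y hy
      obtain ⟨y', hy', -⟩ : ∃ y' ∈ U ∩ ball (c k) η, True := by
        rcases (SimpleGraph.fromRel_adj _ _ _).1 hik |>.2 with ⟨_, _, y', hy', _⟩ | ⟨y', hy', _⟩
        · exact ⟨y', hy', trivial⟩
        · exact ⟨y', hy', trivial⟩
      calc Φ y ≤ 2 ^ (w.length + 1) * Φ y' := ih y' hy' y hy
        _ ≤ 2 ^ (w.length + 1) * (2 * Φ x) := by
          gcongr
          exact hadj _ _ (Or.inr hik) x hx y' hy'
        _ = _ := by rw [SimpleGraph.Walk.length_cons, ← mul_assoc, ← pow_succ]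
  obtain ⟨i, hi⟩ := hcov p hp
  obtain ⟨j, hj⟩ := hcov q hq
  obtain ⟨w, hw⟩ := (hreach h i j hi hj hq).exists_isPath
  refine (hwalk w p ⟨hp, hi⟩ q ⟨hq, hj⟩).trans ?_
  gcongr
  · norm_num
  · simpa using hw.length_lt.le

end Chains

section WeightedPoincare

variable {N : ℕ} {F : Type*} [NormedAddCommGroup F]

theorem setLIntegral_sq_le_sub {A : Set (Euc N)} (hA : MeasurableSet A) {f g : Euc N → F}
    (hg : ContinuousOn g A) :
    (∫⁻ x in A, ‖f x‖ₑ ^ 2) ≤ 2 * (∫⁻ x in A, ‖f x - g x‖ₑ ^ 2) + 2 * ∫⁻ x in A, ‖g x‖ₑ ^ 2 := by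
  have hm : AEMeasurable (fun x => 2 * ‖g x‖ₑ ^ 2) (volume.restrict A) :=
    (((ENNReal.continuous_pow 2).comp_continuousOn
      (continuous_enorm.comp_continuousOn hg)).aemeasurable hA).const_mul 2
  rw [← lintegral_const_mul' _ _ (by finiteness), ← lintegral_const_mul' _ _ (by finiteness),
    ← lintegral_add_right' _ hm]
  refine lintegral_mono fun x => ?_
  simpa using enorm_add_sq_le (f x - g x) (g x)

theorem setLIntegral_comp_add_right_le (A B : Set (Euc N)) (hA : MeasurableSet A)
    (hB : MeasurableSet B) (φ : Euc N → ENNReal) (e : Euc N) (h : ∀ x ∈ A, x + e ∈ B) :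
    (∫⁻ x in A, φ (x + e)) ≤ ∫⁻ x in B, φ x := by
  rw [← lintegral_indicator hA, ← lintegral_indicator hB,
    ← lintegral_add_right_eq_self (B.indicator φ) e]
  refine lintegral_mono fun x => ?_
  by_cases hx : x ∈ A
  · simp only [indicator_of_mem hx, indicator_of_mem (h x hx), le_refl]
  · rw [indicator_of_notMem hx]; exact zero_le

theorem exists_finite_cover (N : ℕ) (d : ℝ) {η : ℝ} (hη : 0 < η) :
    ∃ (n : ℕ) (c : Fin n → Euc N), ∀ x ∈ closedBall (0 : Euc N) d, ∃ i, x ∈ ball (c i) η := by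
  obtain ⟨t, -, htf, ht⟩ := (isCompact_closedBall (0 : Euc N) d).finite_cover_balls hη
  refine ⟨htf.toFinset.card, fun i => (htf.toFinset.equivFin.symm i : Euc N), fun x hx => ?_⟩
  obtain ⟨y, hy, hxy⟩ := mem_iUnion₂.1 (ht hx)
  refine ⟨htf.toFinset.equivFin ⟨y, by simpa using hy⟩, ?_⟩
  simpa using hxy

theorem exists_fatCone_of_infDist_lt {Ω : Set (Euc N)} {s a : ℝ} (ho : IsOpen Ω)
    (hΩ : (Ωᶜ).Nonempty) (hB : ∀ x ∈ frontier Ω, ∃ ω, FatCone s (a / 2) a Ω x ω) {x : Euc N}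
    (hx : x ∈ Ω) (h : infDist x Ωᶜ < a / 2) : ∃ ω, FatCone s (a / 2) (a / 2) Ω x ω := by
  obtain ⟨y, hy, hxy⟩ := exists_frontier_dist_eq ho hΩ hx
  obtain ⟨ω, hω⟩ := hB y hy
  refine ⟨ω, hω.mono ?_⟩
  rw [dist_comm, hxy]
  linarith

theorem weighted_poincare [NormedSpace ℝ F] [CompleteSpace F] (N : ℕ) {s a d : ℝ}
    (hs : 0 < s) (hs1 : s ≤ 1)
    (ha : 0 < a) :
    ∃ C : ENNReal, C ≠ ⊤ ∧ ∀ Ω : Set (Euc N), IsOpen Ω → IsConnected Ω → (Ωᶜ).Nonempty →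
      (∀ x ∈ Ω, ∀ y ∈ Ω, dist x y ≤ d) →
      (∀ x ∈ frontier Ω, ∃ ω, FatCone s (a / 2) a Ω x ω) →
      ∀ v : Euc N → F, ContDiffOn ℝ 1 v Ω →
        ∃ c : F, (∫⁻ x in Ω, ‖v x - c‖ₑ ^ 2) ≤ C * wEnergy Ω v := by
  set T := a / 8 with hT
  set c := T * s with hc
  set c' := c * s / 4 with hc'
  set ρ := c' / 4 with hρ
  set η := ρ / 5 with hη
  have hT0 : 0 < T := by positivity
  have hc0 : 0 < c := by positivity
  have hc'0 : 0 < c' := by positivity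
  have hρ0 : 0 < ρ := by positivity
  have hη0 : 0 < η := by positivity
  have hcT : c ≤ T := by rw [hc]; nlinarith
  have hc'c : c' ≤ c := by rw [hc']; nlinarith
  obtain ⟨n, e, he⟩ := exists_finite_cover N d hη0
  set K1 : ENNReal := ENNReal.ofReal (2 * ρ) ^ 2 * 2 ^ N * (ENNReal.ofReal (c' / 2) ^ 2)⁻¹ with hK1
  have hK1t : K1 ≠ ⊤ := by
    refine ENNReal.mul_ne_top (by finiteness) (ENNReal.inv_ne_top.2 ?_)
    simp [hc'0]
  set K2 : ENNReal := 2 ^ (n + 1) * (K1 + 2) with hK2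
  have hK2t : K2 ≠ ⊤ := by finiteness
  have hH : hardyConst s ≠ ⊤ := by unfold hardyConst; finiteness
  set K3 : ENNReal := n * K2 with hK3
  refine ⟨K3 + n * (2 * hardyConst s + 2 * K3), by finiteness, ?_⟩
  intro Ω ho hconn hΩ hdiam hB v hv
  set D := wEnergy Ω v with hD
  obtain ⟨b, hb⟩ := hconn.nonempty
  set ce : Fin n → Euc N := fun i => b + e i with hce
  have hcov : ∀ x ∈ Ω, ∃ i, x ∈ ball (ce i) η := by
    intro x hx
    obtain ⟨i, hi⟩ := he (x - b) (by
      rw [mem_closedBall, dist_zero_right, ← dist_eq_norm]; exact hdiam x hx b hb)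
    refine ⟨i, ?_⟩
    rw [mem_ball, dist_eq_norm] at hi ⊢
    convert hi using 2
    simp only [hce]; abel
  set U : Set (Euc N) := {x | c' ≤ infDist x Ωᶜ} with hU
  set Ωc : Set (Euc N) := {x | c ≤ infDist x Ωᶜ} with hΩc
  have hΩcm : MeasurableSet Ωc := measurableSet_le measurable_const measurable_infDist
  have hΩcΩ : Ωc ⊆ Ω := fun x hx => mem_of_infDist_compl_pos (hc0.trans_le hx)
  have hUΩ : U ⊆ Ω := fun x hx => mem_of_infDist_compl_pos (hc'0.trans_le hx)
  have hlayer : ∀ x ∈ Ω, x ∉ Ωc → ∃ ω, FatCone s (a / 2) (a / 2) Ω x ω := fun x hx hxc =>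
    exists_fatCone_of_infDist_lt ho hΩ hB hx (by
      have : infDist x Ωᶜ < c := not_le.1 hxc
      linarith)
  have hTIoo : ∀ t ∈ Ioc 0 T, t ∈ Ioo 0 (a / 2) := fun t ht => ⟨ht.1, by linarith [ht.2]⟩
  obtain ⟨p, hp⟩ : Ωc.Nonempty := by
    by_cases h : b ∈ Ωc
    · exact ⟨b, h⟩
    · obtain ⟨ω, hω⟩ := hlayer b hb h
      exact ⟨b + T • ω, hω.le_infDist hΩ (subset_closure hb) (by rw [dist_self]; positivity)
        (hTIoo T ⟨hT0, le_rfl⟩)⟩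
  have hnear : ∀ q ∈ U, ∀ x, dist x q < 2 * ρ → c' / 2 ≤ infDist x Ωᶜ := by
    intro q hq x hx
    have h1 : c' ≤ infDist q Ωᶜ := hq
    have := infDist_le_infDist_add_dist (s := Ωᶜ) (x := q) (y := x)
    rw [dist_comm] at this
    linarith
  have hballΩ : ∀ q ∈ U, ball q (2 * ρ) ⊆ Ω := fun q hq x hx =>
    mem_of_infDist_compl_pos (lt_of_lt_of_le (by positivity) (hnear q hq x hx))
  have hΩcU : Ωc ⊆ U := fun x hx => hc'c.trans hx
  have hball1 : ∀ q : Euc N, ball q ρ ⊆ ball q (2 * ρ) := fun q => ball_subset_ball (by linarith)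
  obtain ⟨c0, hc0'⟩ := ball_poincare p hρ0 (hv.mono ((hball1 p).trans (hballΩ p (hΩcU hp))))
  refine ⟨c0, ?_⟩
  set Fn : Euc N → ENNReal := fun q => ∫⁻ x in ball q ρ, ‖v x - c0‖ₑ ^ 2 with hFn
  have hFp : Fn p ≤ K1 * D := by
    refine hc0'.trans ?_
    rw [hK1, mul_assoc _ _ D]
    gcongr
    exact setLIntegral_fderiv_le_wEnergy measurableSet_ball (by positivity) v fun x hx =>
      hnear p (hΩcU hp) x (hball1 p hx)
  have hstep : ∀ p ∈ U, ∀ q ∈ U, dist p q ≤ ρ → Fn q + 2 * D ≤ 2 * (Fn p + 2 * D) := by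
    intro p hp q hq hpq
    have hin : ∀ x ∈ ball p ρ, ∀ t ∈ Icc (0:ℝ) 1, dist (x + t • (q - p)) p < 2 * ρ := by
      intro x hx t ht
      rw [mem_ball, dist_eq_norm] at hx
      rw [dist_comm, dist_eq_norm] at hpq
      rw [dist_eq_norm, add_sub_right_comm]
      refine (norm_add_le _ _).trans_lt ?_
      rw [norm_smul, Real.norm_of_nonneg ht.1]
      nlinarith [ht.2, norm_nonneg (q - p)]
    have h1 : Fn q ≤ ∫⁻ x in ball p ρ, ‖v (x + (q - p)) - c0‖ₑ ^ 2 := by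
      have := setLIntegral_comp_add_right_le (ball q ρ) (ball p ρ) measurableSet_ball
        measurableSet_ball (fun x => ‖v (x + (q - p)) - c0‖ₑ ^ 2) (p - q) (fun x hx => by
          rw [mem_ball, dist_eq_norm] at hx ⊢
          convert hx using 2; abel)
      refine le_trans (le_of_eq ?_) this
      refine lintegral_congr fun x => ?_
      rw [show x + (p - q) + (q - p) = x by abel]
    have h2 : ContinuousOn (fun x => v (x + (q - p)) - c0) (ball p ρ) := by
      refine ContinuousOn.sub (hv.continuousOn.comp (by fun_prop) fun x hx => ?_) continuousOn_const
      have := hin x hx 1 ⟨zero_le_one, le_rfl⟩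
      rw [one_smul] at this
      exact hballΩ p hp this
    have h3 : ContinuousOn (fun x => v x - c0) (ball p ρ) :=
      (hv.continuousOn.mono ((hball1 p).trans (hballΩ p hp))).sub continuousOn_const
    have h4 := setLIntegral_sq_le_sub (f := fun x => v (x + (q - p)) - c0) measurableSet_ball h3
    simp only [sub_sub_sub_cancel_right] at h4
    have h5 := translate_le_wEnergy (S := ball p ρ) ho measurableSet_ball hv (η := c' / 2)
      (by positivity) (e := q - p) (by rw [dist_comm, dist_eq_norm] at hpq; linarith)
      fun x hx t ht => hnear p hp _ (hin x hx t ht)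
    calc Fn q + 2 * D ≤ (2 * D + 2 * Fn p) + 2 * D := by
          gcongr
          refine h1.trans (h4.trans ?_)
          gcongr
      _ = _ := by ring
  have hFall : ∀ q ∈ Ωc, Fn q ≤ K2 * D := by
    intro q hq
    have hch := exists_chain_anchor ho hconn hΩ hs hs1 ha hη0 hB hp hq
    have := chain_growth (ρ := ρ) (η := η) (by rw [hη]; linarith) hη0 (c := ce)
      (fun x hx => hcov x (hUΩ hx)) (Φ := fun q => Fn q + 2 * D) hstep (hΩcU hp) (hΩcU hq) hch
    calc Fn q ≤ Fn q + 2 * D := le_self_add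
      _ ≤ 2 ^ (n + 1) * (Fn p + 2 * D) := this
      _ ≤ 2 ^ (n + 1) * (K1 * D + 2 * D) := by gcongr
      _ = _ := by rw [hK2]; ring
  have hM1 : (∫⁻ x in Ωc, ‖v x - c0‖ₑ ^ 2) ≤ K3 * D := by
    calc (∫⁻ x in Ωc, ‖v x - c0‖ₑ ^ 2)
        ≤ ∫⁻ x in ⋃ i, Ωc ∩ ball (ce i) η, ‖v x - c0‖ₑ ^ 2 := by
          refine lintegral_mono_set fun x hx => ?_
          obtain ⟨i, hi⟩ := hcov x (hΩcΩ hx)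
          exact mem_iUnion.2 ⟨i, hx, hi⟩
      _ ≤ ∑' i, ∫⁻ x in Ωc ∩ ball (ce i) η, ‖v x - c0‖ₑ ^ 2 := lintegral_iUnion_le _ _
      _ = ∑ i, ∫⁻ x in Ωc ∩ ball (ce i) η, ‖v x - c0‖ₑ ^ 2 := tsum_fintype _
      _ ≤ ∑ i : Fin n, K2 * D := by
          refine Finset.sum_le_sum fun i _ => ?_
          rcases (Ωc ∩ ball (ce i) η).eq_empty_or_nonempty with h | ⟨q, hq⟩
          · rw [h]; simp
          · refine le_trans (lintegral_mono_set fun x hx => ?_) (hFall q hq.1)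
            have h1 := mem_ball.1 hx.2
            have h2 := mem_ball.1 hq.2
            rw [mem_ball]
            linarith [dist_triangle_right x q (ce i)]
      _ = _ := by
          rw [Finset.sum_const, Finset.card_univ, Fintype.card_fin, nsmul_eq_mul, hK3]
          ring
  have hM2 : (∫⁻ x in Ω \ Ωc, ‖v x - c0‖ₑ ^ 2) ≤ n * (2 * hardyConst s + 2 * K3) * D := by
    calc (∫⁻ x in Ω \ Ωc, ‖v x - c0‖ₑ ^ 2)
        ≤ ∫⁻ x in ⋃ i, (Ω \ Ωc) ∩ ball (ce i) η, ‖v x - c0‖ₑ ^ 2 := by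
          refine lintegral_mono_set fun x hx => ?_
          obtain ⟨i, hi⟩ := hcov x hx.1
          exact mem_iUnion.2 ⟨i, hx, hi⟩
      _ ≤ ∑' i, ∫⁻ x in (Ω \ Ωc) ∩ ball (ce i) η, ‖v x - c0‖ₑ ^ 2 := lintegral_iUnion_le _ _
      _ = ∑ i, ∫⁻ x in (Ω \ Ωc) ∩ ball (ce i) η, ‖v x - c0‖ₑ ^ 2 := tsum_fintype _
      _ ≤ ∑ i : Fin n, (2 * hardyConst s + 2 * K3) * D := by
          refine Finset.sum_le_sum fun i _ => ?_
          rcases ((Ω \ Ωc) ∩ ball (ce i) η).eq_empty_or_nonempty with h | ⟨x, hx⟩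
          · rw [h]; simp
          obtain ⟨ω, hω⟩ := hlayer x hx.1.1 hx.1.2
          set A := Ω ∩ ball (ce i) η with hA
          have hAm : MeasurableSet A := ho.measurableSet.inter measurableSet_ball
          have hcone : ∀ w ∈ A, ∀ t ∈ Ioc 0 T, t * s ≤ infDist (w + t • ω) Ωᶜ := by
            intro w hw t ht
            refine hω.le_infDist hΩ (subset_closure hw.1) ?_ (hTIoo t ht)
            have h1 := mem_ball.1 hw.2
            have h2 := mem_ball.1 hx.2
            linarith [dist_triangle_right w x (ce i)]
          have hto : ∀ w ∈ A, w + T • ω ∈ Ωc := fun w hw => hcone w hw T ⟨hT0, le_rfl⟩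
          have hHd := hardy_cone ho hΩ hAm inter_subset_left hs hs1 hT0 hω.1 hcone hv
          have h2 : ContinuousOn (fun w => v (w + T • ω) - c0) A :=
            (hv.continuousOn.comp (by fun_prop) fun w hw => hΩcΩ (hto w hw)).sub continuousOn_const
          have h3 : ContinuousOn (fun x => v x - c0) A :=
            (hv.continuousOn.mono inter_subset_left).sub continuousOn_const
          have h4 := setLIntegral_sq_le_sub (f := fun x => v x - c0) hAm h2
          simp only [sub_sub_sub_cancel_right] at h4
          have h5 := setLIntegral_comp_add_right_le A Ωc hAm hΩcm (fun x => ‖v x - c0‖ₑ ^ 2)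
            (T • ω) hto
          calc (∫⁻ x in (Ω \ Ωc) ∩ ball (ce i) η, ‖v x - c0‖ₑ ^ 2)
              ≤ ∫⁻ x in A, ‖v x - c0‖ₑ ^ 2 :=
                lintegral_mono_set (inter_subset_inter_left _ sdiff_subset)
            _ ≤ _ := h4
            _ ≤ 2 * (hardyConst s * D) + 2 * (K3 * D) := by
              gcongr
              · refine le_trans (le_of_eq ?_) hHd
                refine lintegral_congr fun w => ?_
                rw [← enorm_neg, neg_sub]
              · exact h5.trans hM1
            _ = _ := by ring
      _ = _ := by rw [Finset.sum_const, Finset.card_univ, Fintype.card_fin, nsmul_eq_mul,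
            mul_assoc]
  calc (∫⁻ x in Ω, ‖v x - c0‖ₑ ^ 2) ≤ ∫⁻ x in Ωc ∪ (Ω \ Ωc), ‖v x - c0‖ₑ ^ 2 :=
        lintegral_mono_set (by rw [union_sdiff_self]; exact subset_union_right)
    _ ≤ _ := lintegral_union_le _ _ _
    _ ≤ _ := add_le_add hM1 hM2
    _ = _ := by ring

end WeightedPoincare

section MaxPrinciple

variable {N : ℕ}

theorem deriv_deriv_line {Ω : Set (Euc N)} (ho : IsOpen Ω) {u : Euc N → ℝ}
    (hu : ContDiffOn ℝ 2 u Ω) {x : Euc N} (hx : x ∈ Ω) (i : Fin N) :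
    (∀ᶠ t in nhds (0:ℝ), HasDerivAt (fun t : ℝ => u (x + t • EuclideanSpace.single i (1:ℝ)))
      (fderiv ℝ u (x + t • EuclideanSpace.single i (1:ℝ)) (EuclideanSpace.single i (1:ℝ))) t) ∧
    HasDerivAt (fun t : ℝ => fderiv ℝ u (x + t • EuclideanSpace.single i (1:ℝ))
      (EuclideanSpace.single i (1:ℝ))) (hessEntry u x i i) 0 := by
  set e : Euc N := EuclideanSpace.single i (1:ℝ) with he
  have hline : ∀ t : ℝ, HasDerivAt (fun t : ℝ => x + t • e) e t := fun t => by
    simpa using ((hasDerivAt_id t).smul_const e).const_add x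
  have hev : ∀ᶠ t in nhds (0:ℝ), x + t • e ∈ Ω := by
    have hc : ContinuousAt (fun t : ℝ => x + t • e) 0 := by fun_prop
    refine hc.eventually_mem (ho.mem_nhds ?_)
    simpa using hx
  constructor
  · filter_upwards [hev] with t ht
    exact ((hu.contDiffAt
      (ho.mem_nhds ht)).differentiableAt two_ne_zero).hasFDerivAt.comp_hasDerivAt
      t (hline t)
  · have h1 : DifferentiableAt ℝ (fun y => fderiv ℝ u y e) x := by
      have h2 : ContDiffAt ℝ 1 (fderiv ℝ u) x :=
        (hu.contDiffAt (ho.mem_nhds hx)).fderiv_right (by norm_num)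
      exact (h2.differentiableAt one_ne_zero).clm_apply (differentiableAt_const _)
    have h3 := h1.hasFDerivAt
    have h4 : HasFDerivAt (fun y => fderiv ℝ u y e) (fderiv ℝ (fun y => fderiv ℝ u y e) x)
        (x + (0:ℝ) • e) := by simpa using h3
    exact h4.comp_hasDerivAt 0 (hline 0)

theorem second_deriv_nonpos_of_isLocalMax {f f' : ℝ → ℝ} {b : ℝ}
    (hf : ∀ᶠ t in nhds (0:ℝ), HasDerivAt f (f' t) t) (hf' : HasDerivAt f' b 0)
    (hmax : IsLocalMax f 0) : b ≤ 0 := by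
  by_contra! hb
  have hd : deriv f =ᶠ[nhds 0] f' := hf.mono fun t ht => ht.deriv
  have hdd : deriv (deriv f) 0 = b := by rw [hd.deriv_eq, hf'.deriv]
  have h0 : deriv f 0 = 0 := hmax.deriv_eq_zero
  have hmin : IsLocalMin f 0 := isLocalMin_of_deriv_deriv_pos (by rw [hdd]; exact hb) h0
    hf.self_of_nhds.continuousAt
  have hconst : f =ᶠ[nhds 0] fun _ => f 0 := by
    filter_upwards [hmax, hmin] with t h1 h2
    exact le_antisymm h1 h2
  have : deriv (deriv f) 0 = 0 := by
    rw [Filter.EventuallyEq.deriv_eq hconst.deriv]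
    simp
  linarith

theorem IsTorsion.le_neg_dist_sq {Ω : Set (Euc N)} (hN : 0 < N) (ho : IsOpen Ω)
    (hb : Bornology.IsBounded Ω) {u : Euc N → ℝ} (hu : IsTorsion Ω u) {y : Euc N} (hy : y ∈ Ω) :
    u y ≤ -(infDist y Ωᶜ ^ 2 / 2) := by
  obtain ⟨hc, hd, hl, h0⟩ := hu
  set δ := infDist y Ωᶜ with hδ
  have key : ∀ r ∈ Ioo (0:ℝ) 1, u y ≤ -(r * (δ ^ 2 / 2)) := by
    intro r hr
    set w : Euc N → ℝ := fun x => u x - r * ((‖x - y‖ ^ 2 - δ ^ 2) / 2) with hw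
    have hwc : ContinuousOn w (closure Ω) := hc.sub (by fun_prop)
    obtain ⟨x, hx, hmax⟩ := hb.isCompact_closure.exists_isMaxOn ⟨y, subset_closure hy⟩ hwc
    have hxf : x ∈ frontier Ω := by
      refine ⟨hx, ?_⟩
      rw [ho.interior_eq]
      intro hxΩ
      have hle : ∀ i, hessEntry u x i i - r ≤ 0 := by
        intro i
        obtain ⟨h1, h2⟩ := deriv_deriv_line ho hd hxΩ i
        set e : Euc N := EuclideanSpace.single i (1:ℝ) with he
        have hen : ‖e‖ = 1 := by simp [he]
        have hq : ∀ t : ℝ, HasDerivAt (fun t : ℝ => r * ((‖x + t • e - y‖ ^ 2 - δ ^ 2) / 2))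
            (r * (⟪x - y, e⟫ + t)) t := by
          intro t
          have hfun : (fun t : ℝ => r * ((‖x + t • e - y‖ ^ 2 - δ ^ 2) / 2)) =
              fun t : ℝ => r * ((‖x - y‖ ^ 2 + 2 * (t * ⟪x - y, e⟫) + t ^ 2 - δ ^ 2) / 2) := by
            funext t
            rw [show x + t • e - y = (x - y) + t • e by abel, norm_add_sq_real, inner_smul_right,
              norm_smul, hen, mul_one, Real.norm_eq_abs, sq_abs]
          rw [hfun]
          have := ((((((hasDerivAt_id t).mul_const ⟪x - y, e⟫).const_mul 2).const_add
            (‖x - y‖ ^ 2)).add (hasDerivAt_pow 2 t)).sub_const (δ ^ 2)).div_const 2 |>.const_mul r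
          refine this.congr_deriv ?_
          simp only [one_mul]
          push_cast
          ring
        refine second_deriv_nonpos_of_isLocalMax (f := fun t => w (x + t • e))
          (f' := fun t => fderiv ℝ u (x + t • e) e - r * (⟪x - y, e⟫ + t)) ?_ ?_ ?_
        · filter_upwards [h1] with t ht
          exact ht.sub (hq t)
        · refine (h2.sub (((hasDerivAt_id (0:ℝ)).const_add ⟪x - y, e⟫).const_mul r)).congr_deriv ?_
          ring
        · have hc0 : ContinuousAt (fun t : ℝ => x + t • e) 0 := by fun_prop
          have hev : ∀ᶠ t in nhds (0:ℝ), x + t • e ∈ Ω :=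
            hc0.eventually_mem (ho.mem_nhds (by simpa using hxΩ))
          filter_upwards [hev] with t ht
          have := hmax (subset_closure ht)
          simpa using this
      have hsum : ∑ i, (hessEntry u x i i - r) ≤ 0 := Finset.sum_nonpos fun i _ => hle i
      rw [Finset.sum_sub_distrib] at hsum
      have hl' : ∑ i, hessEntry u x i i = N := hl x hxΩ
      rw [hl', Finset.sum_const, Finset.card_univ, Fintype.card_fin, nsmul_eq_mul] at hsum
      have : (0:ℝ) < N := by exact_mod_cast hN
      nlinarith [hr.2]
    have hwx : w x ≤ 0 := by
      have hδx : δ ≤ ‖x - y‖ := by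
        rw [← dist_eq_norm, dist_comm]
        refine infDist_le_dist_of_mem ?_
        have := hxf.2
        rwa [ho.interior_eq] at this
      have : δ ^ 2 ≤ ‖x - y‖ ^ 2 := pow_le_pow_left₀ infDist_nonneg hδx 2
      simp only [hw, h0 x hxf]
      nlinarith [hr.1]
    have hwy : w y ≤ w x := hmax (subset_closure hy)
    have : w y = u y + r * (δ ^ 2 / 2) := by
      simp only [hw, sub_self, norm_zero]
      ring
    linarith
  have hlim : Filter.Tendsto (fun r : ℝ => -(r * (δ ^ 2 / 2))) (nhdsWithin 1 (Iio 1))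
      (nhds (-(δ ^ 2 / 2))) := by
    have : ContinuousAt (fun r : ℝ => -(r * (δ ^ 2 / 2))) 1 := by fun_prop
    simpa using this.tendsto.mono_left nhdsWithin_le_nhds
  refine ge_of_tendsto hlim ?_
  filter_upwards [Ioo_mem_nhdsLT (show (0:ℝ) < 1 by norm_num)] with r hr
  exact key r hr

end MaxPrinciple

section Indicator

variable {E : Type*} [NormedAddCommGroup E] [InnerProductSpace ℝ E] {Ω K : Set E}

theorem contDiff_indicator {f : E → ℝ} (ho : IsOpen Ω) (hK : IsCompact K) (hKΩ : K ⊆ Ω)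
    (hf : ContDiffOn ℝ 1 f Ω) (h0 : ∀ x ∈ Ω, x ∉ K → f x = 0) :
    ContDiff ℝ 1 (Ω.indicator f) ∧ HasCompactSupport (Ω.indicator f) := by
  have hz : ∀ x, x ∉ K → Ω.indicator f x = 0 := fun x hx => by
    by_cases h : x ∈ Ω
    · rw [indicator_of_mem h, h0 x h hx]
    · exact indicator_of_notMem h f
  refine ⟨contDiff_iff_contDiffAt.2 fun x => ?_, HasCompactSupport.intro hK fun x hx => hz x hx⟩
  by_cases hx : x ∈ Ω
  · refine (hf.contDiffAt (ho.mem_nhds hx)).congr_of_eventuallyEq ?_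
    filter_upwards [ho.mem_nhds hx] with y hy using indicator_of_mem hy f
  · refine (contDiffAt_const (c := (0:ℝ))).congr_of_eventuallyEq ?_
    filter_upwards [hK.isClosed.isOpen_compl.mem_nhds (fun h => hx (hKΩ h))] with y hy
    exact hz y hy

theorem fderiv_indicator_of_mem {f : E → ℝ} (ho : IsOpen Ω) {x : E} (hx : x ∈ Ω) :
    fderiv ℝ (Ω.indicator f) x = fderiv ℝ f x := by
  refine Filter.EventuallyEq.fderiv_eq ?_
  filter_upwards [ho.mem_nhds hx] with y hy using indicator_of_mem hy f

theorem fderiv_indicator_of_notMem {f : E → ℝ} (hK : IsCompact K) (hKΩ : K ⊆ Ω)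
    (h0 : ∀ x ∈ Ω, x ∉ K → f x = 0) {x : E} (hx : x ∉ Ω) :
    fderiv ℝ (Ω.indicator f) x = 0 := by
  have : Ω.indicator f =ᶠ[nhds x] fun _ => 0 := by
    filter_upwards [hK.isClosed.isOpen_compl.mem_nhds (fun h => hx (hKΩ h))] with y hy
    by_cases h : y ∈ Ω
    · rw [indicator_of_mem h, h0 y h hy]
    · exact indicator_of_notMem h f
  rw [this.fderiv_eq]
  simp

end Indicator

section CompactlySupported

variable {E : Type*} [NormedAddCommGroup E] [InnerProductSpace ℝ E] [FiniteDimensional ℝ E]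
  [MeasurableSpace E] [BorelSpace E]

theorem integral_fderiv_eq_zero_of_hasCompactSupport {f : E → ℝ} (hf : ContDiff ℝ 1 f)
    (hs : HasCompactSupport f) (e : E) : ∫ x, fderiv ℝ f x e = 0 := by
  have hc : Continuous (fun x => fderiv ℝ f x e) :=
    (hf.continuous_fderiv one_ne_zero).clm_apply continuous_const
  have hcs : HasCompactSupport (fun x => fderiv ℝ f x e) := hs.fderiv_apply ℝ e
  have := integral_mul_fderiv_eq_neg_fderiv_mul_of_integrable (μ := (volume : Measure E))
    (f := fun _ : E => (1:ℝ)) (g := f) (v := e)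
    (by simp) (by simpa using hc.integrable_of_hasCompactSupport hcs)
    (by simpa using hf.continuous.integrable_of_hasCompactSupport hs)
    (fun x _ => differentiableAt_const _) (fun x _ => hf.differentiable one_ne_zero x)
  simpa using this

theorem integral_fderiv_mul_fderiv_comm {f g : E → ℝ} (hf : ContDiff ℝ 1 f)
    (hfs : HasCompactSupport f) (hg : ContDiff ℝ 1 g) (hgs : HasCompactSupport g) (a b : E) :
    ∫ x, fderiv ℝ f x a * fderiv ℝ g x b = ∫ x, fderiv ℝ f x b * fderiv ℝ g x a := by
  have cdf : ∀ {k : E → ℝ}, ContDiff ℝ 1 k → ∀ e, Continuous (fun x => fderiv ℝ k x e) :=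
    fun hk e => (hk.continuous_fderiv one_ne_zero).clm_apply continuous_const
  have idf : ∀ {k : E → ℝ}, ContDiff ℝ 1 k → HasCompactSupport k → ∀ e,
      Integrable (fun x => fderiv ℝ k x e) (volume : Measure E) :=
    fun hk hks e => (cdf hk e).integrable_of_hasCompactSupport (hks.fderiv_apply ℝ e)
  obtain ⟨Cf, hCf⟩ := hf.lipschitzWith_of_hasCompactSupport hfs one_ne_zero
  obtain ⟨Cg, hCg⟩ := hg.lipschitzWith_of_hasCompactSupport hgs one_ne_zero
  have l1 := hCf.integral_inv_smul_sub_mul_tendsto_integral_lineDeriv_mul (μ := volume)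
    (idf hg hgs b) a
  have l2 := hCg.integral_inv_smul_sub_mul_tendsto_integral_lineDeriv_mul (μ := volume)
    (idf hf hfs b) (-a)
  have e1 : ∀ x, lineDeriv ℝ f x a = fderiv ℝ f x a := fun x =>
    (hf.differentiable one_ne_zero x).lineDeriv_eq_fderiv
  have e2 : ∀ x, lineDeriv ℝ g x (-a) = -fderiv ℝ g x a := fun x => by
    rw [(hg.differentiable one_ne_zero x).lineDeriv_eq_fderiv, map_neg]
  simp only [e1] at l1
  simp only [e2, neg_mul, integral_neg] at l2
  have l3 := l2.neg
  rw [neg_neg] at l3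
  simp only [mul_comm (fderiv ℝ g _ a)] at l3
  have key : ∀ t : ℝ, ∫ x, t⁻¹ • (f (x + t • a) - f x) * fderiv ℝ g x b =
      -∫ x, t⁻¹ • (g (x + t • -a) - g x) * fderiv ℝ f x b := by
    intro t
    set F : E → ℝ := fun x => t⁻¹ • (f (x + t • a) - f x) with hF
    have hsh : ContDiff ℝ 1 (fun x => f (x + t • a)) := hf.comp (by fun_prop)
    have hshs : HasCompactSupport (fun x => f (x + t • a)) :=
      hfs.comp_homeomorph (Homeomorph.addRight (t • a))
    have hFd : ∀ x, fderiv ℝ F x b = t⁻¹ * (fderiv ℝ f (x + t • a) b - fderiv ℝ f x b) := by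
      intro x
      rw [hF, fderiv_fun_const_smul ((hsh.differentiable one_ne_zero x).fun_sub
        (hf.differentiable one_ne_zero x)), fderiv_fun_sub (hsh.differentiable one_ne_zero x)
        (hf.differentiable one_ne_zero x), fderiv_comp_add_right]
      simp
    have hFC : ContDiff ℝ 1 F := (hsh.sub hf).const_smul t⁻¹
    have hFs : HasCompactSupport F := (hshs.sub hfs).smul_left (f := fun _ => t⁻¹)
    have m1 : ∀ {k l : E → ℝ}, Continuous k → Continuous l → HasCompactSupport l →
        Integrable (fun x => k x * l x) (volume : Measure E) := fun hk hl hls =>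
      (hk.mul hl).integrable_of_hasCompactSupport hls.mul_left
    have ibp := integral_mul_fderiv_eq_neg_fderiv_mul_of_integrable (μ := (volume : Measure E))
      (f := F) (g := g) (v := b) (m1 (cdf hFC b) hg.continuous hgs)
      (m1 hFC.continuous (cdf hg b) (hgs.fderiv_apply ℝ b))
      (m1 hFC.continuous hg.continuous hgs) (fun x _ => hFC.differentiable one_ne_zero x)
      (fun x _ => hg.differentiable one_ne_zero x)
    rw [ibp]
    congr 1
    have s1 : ∫ x, fderiv ℝ f (x + t • a) b * g x = ∫ x, fderiv ℝ f x b * g (x + t • -a) := by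
      rw [← integral_add_right_eq_self (fun x => fderiv ℝ f x b * g (x + t • -a)) (t • a)]
      refine integral_congr_ae (Filter.Eventually.of_forall fun x => ?_)
      simp
    have hga : Continuous fun x => g (x + t • -a) := hg.continuous.comp (by fun_prop)
    have hfa : Continuous fun x => fderiv ℝ f (x + t • a) b := (cdf hf b).comp (by fun_prop)
    have m2 : Integrable (fun x => fderiv ℝ f x b * g (x + t • -a)) (volume : Measure E) :=
      ((cdf hf b).mul hga).integrable_of_hasCompactSupport (hfs.fderiv_apply ℝ b).mul_right
    calc ∫ x, fderiv ℝ F x b * g x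
        = ∫ x, t⁻¹ * (fderiv ℝ f (x + t • a) b * g x - fderiv ℝ f x b * g x) := by
          refine integral_congr_ae (Filter.Eventually.of_forall fun x => ?_)
          simp only [hFd]; ring
      _ = t⁻¹ * ((∫ x, fderiv ℝ f x b * g (x + t • -a)) - ∫ x, fderiv ℝ f x b * g x) := by
          rw [integral_const_mul, integral_sub (m1 hfa hg.continuous hgs)
            (m1 (cdf hf b) hg.continuous hgs), s1]
      _ = _ := by
          rw [← integral_sub m2 (m1 (cdf hf b) hg.continuous hgs), ← integral_const_mul]
          refine integral_congr_ae (Filter.Eventually.of_forall fun x => ?_)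
          simp only [smul_eq_mul]; ring
  simp only [key] at l1
  exact tendsto_nhds_unique l1 l3

variable {Ω K : Set E}

theorem setIntegral_fderiv_eq_zero {f : E → ℝ} (ho : IsOpen Ω) (hK : IsCompact K) (hKΩ : K ⊆ Ω)
    (hf : ContDiffOn ℝ 1 f Ω) (h0 : ∀ x ∈ Ω, x ∉ K → f x = 0) (e : E) :
    ∫ x in Ω, fderiv ℝ f x e = 0 := by
  obtain ⟨h1, h2⟩ := contDiff_indicator ho hK hKΩ hf h0
  rw [← integral_fderiv_eq_zero_of_hasCompactSupport h1 h2 e, ← integral_indicator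
    ho.measurableSet]
  refine integral_congr_ae (Filter.Eventually.of_forall fun x => ?_)
  by_cases hx : x ∈ Ω
  · simp only [indicator_of_mem hx, fderiv_indicator_of_mem ho hx]
  · simp only [indicator_of_notMem hx, fderiv_indicator_of_notMem hK hKΩ h0 hx,
      zero_apply]

theorem setIntegral_fderiv_mul_fderiv_comm {f g : E → ℝ} (ho : IsOpen Ω) (hK : IsCompact K)
    (hKΩ : K ⊆ Ω) (hf : ContDiffOn ℝ 1 f Ω) (hf0 : ∀ x ∈ Ω, x ∉ K → f x = 0)
    (hg : ContDiffOn ℝ 1 g Ω) (hg0 : ∀ x ∈ Ω, x ∉ K → g x = 0) (a b : E) :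
    ∫ x in Ω, fderiv ℝ f x a * fderiv ℝ g x b = ∫ x in Ω, fderiv ℝ f x b * fderiv ℝ g x a := by
  obtain ⟨h1, h2⟩ := contDiff_indicator ho hK hKΩ hf hf0
  obtain ⟨h3, h4⟩ := contDiff_indicator ho hK hKΩ hg hg0
  have key : ∀ a b : E, ∫ x in Ω, fderiv ℝ f x a * fderiv ℝ g x b =
      ∫ x, fderiv ℝ (Ω.indicator f) x a * fderiv ℝ (Ω.indicator g) x b := by
    intro a b
    rw [← integral_indicator ho.measurableSet]
    refine integral_congr_ae (Filter.Eventually.of_forall fun x => ?_)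
    by_cases hx : x ∈ Ω
    · simp only [indicator_of_mem hx, fderiv_indicator_of_mem ho hx]
    · simp only [indicator_of_notMem hx, fderiv_indicator_of_notMem hK hKΩ hf0 hx,
        zero_apply, zero_mul]
  rw [key, key, integral_fderiv_mul_fderiv_comm h1 h2 h3 h4]

theorem integrableOn_of_continuousOn_of_eq_zero {f : E → ℝ} (ho : IsOpen Ω) (hK : IsCompact K)
    (hKΩ : K ⊆ Ω) (hf : ContinuousOn f Ω) (h0 : ∀ x ∈ Ω, x ∉ K → f x = 0) :
    IntegrableOn f Ω volume := by
  have h1 : IntegrableOn f K volume := (hf.mono hKΩ).integrableOn_compact hK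
  exact h1.of_forall_sdiff_eq_zero ho.measurableSet fun x hx => h0 x hx.1 hx.2

end CompactlySupported

section TorsionIdentities

/-- `φ` is a primitive of the continuous function `κ`, and both vanish on `(-∞, η]`. -/
structure IsCutoff (η : ℝ) (κ φ : ℝ → ℝ) : Prop where
  continuous : Continuous κ
  hasDerivAt : ∀ s, HasDerivAt φ (κ s) s
  eq_zero : ∀ s ≤ η, κ s = 0 ∧ φ s = 0

variable {N : ℕ} {Ω : Set (Euc N)} {u : Euc N → ℝ}

/-- The closed superlevel set `{-u ≥ η}`. -/
def superLevel (Ω : Set (Euc N)) (u : Euc N → ℝ) (η : ℝ) : Set (Euc N) :=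
  closure Ω ∩ u ⁻¹' Iic (-η)

/-- The `i`-th partial derivative of `u`. -/
def partialD (u : Euc N → ℝ) (i : Fin N) (x : Euc N) : ℝ :=
  fderiv ℝ u x (EuclideanSpace.single i (1:ℝ))

/-- The `i`-th component of `x - z - ∇u x`. -/
def devi (z : Euc N) (u : Euc N → ℝ) (i : Fin N) (x : Euc N) : ℝ := x i - z i - partialD u i x

/-- The `(i, j)` entry of `I - D²u`. -/
def devHess (u : Euc N → ℝ) (i j : Fin N) (x : Euc N) : ℝ :=
  (if i = j then 1 else 0) - hessEntry u x i j

theorem IsTorsion.isCompact_superLevel (hb : Bornology.IsBounded Ω) (hu : IsTorsion Ω u) (η : ℝ) :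
    IsCompact (superLevel Ω u η) :=
  hb.isCompact_closure.of_isClosed_subset
    (hu.1.preimage_isClosed_of_isClosed isClosed_closure isClosed_Iic) inter_subset_left

theorem IsTorsion.superLevel_subset (ho : IsOpen Ω) (hu : IsTorsion Ω u) {η : ℝ} (hη : 0 < η) :
    superLevel Ω u η ⊆ Ω := by
  rintro x ⟨hx, hx'⟩
  by_contra h
  have : u x = 0 := hu.2.2.2 x ⟨hx, by rwa [ho.interior_eq]⟩
  rw [mem_preimage, mem_Iic, this] at hx'
  linarith

theorem lt_of_notMem_superLevel {η : ℝ} {x : Euc N} (hx : x ∈ Ω) (h : x ∉ superLevel Ω u η) :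
    -u x < η := by
  by_contra! h'
  exact h ⟨subset_closure hx, by rw [mem_preimage, mem_Iic]; linarith⟩

theorem IsCutoff.contDiff {η : ℝ} {κ φ : ℝ → ℝ} (h : IsCutoff η κ φ) : ContDiff ℝ 1 φ :=
  contDiff_one_iff_deriv.2 ⟨fun s => (h.hasDerivAt s).differentiableAt, by
    rw [show deriv φ = κ from funext fun s => (h.hasDerivAt s).deriv]
    exact h.continuous⟩

theorem IsTorsion.hasFDerivAt (ho : IsOpen Ω) (hu : IsTorsion Ω u) {x : Euc N} (hx : x ∈ Ω) :
    HasFDerivAt u (fderiv ℝ u x) x :=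
  ((hu.2.1.contDiffAt (ho.mem_nhds hx)).differentiableAt two_ne_zero).hasFDerivAt

theorem IsTorsion.contDiffOn_partialD (ho : IsOpen Ω) (hu : IsTorsion Ω u) (i : Fin N) :
    ContDiffOn ℝ 1 (partialD u i) Ω := fun x hx => by
  have h2 : ContDiffAt ℝ 1 (fderiv ℝ u) x :=
    (hu.2.1.contDiffAt (ho.mem_nhds hx)).fderiv_right (by norm_num)
  exact (h2.clm_apply contDiffAt_const).contDiffWithinAt

theorem IsTorsion.contDiffOn_devi (ho : IsOpen Ω) (hu : IsTorsion Ω u) (z : Euc N) (i : Fin N) :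
    ContDiffOn ℝ 1 (devi z u i) Ω := by
  have : ContDiff ℝ 1 fun x : Euc N => x i - z i :=
    (contDiff_piLp_apply (p := 2) (i := i)).sub contDiff_const
  exact this.contDiffOn.sub (hu.contDiffOn_partialD ho i)

theorem hasFDerivAt_of_contDiffOn {F : Euc N → ℝ} (ho : IsOpen Ω) (hF : ContDiffOn ℝ 1 F Ω)
    {x : Euc N} (hx : x ∈ Ω) : HasFDerivAt F (fderiv ℝ F x) x :=
  ((hF.contDiffAt (ho.mem_nhds hx)).differentiableAt one_ne_zero).hasFDerivAt

theorem fderiv_devi (ho : IsOpen Ω) (hu : IsTorsion Ω u) (z : Euc N) {x : Euc N} (hx : x ∈ Ω)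
    (i j : Fin N) : fderiv ℝ (devi z u j) x (EuclideanSpace.single i (1:ℝ)) = devHess u i j x := by
  have h1 : HasFDerivAt (fun x : Euc N => x j - z j) (EuclideanSpace.proj j : Euc N →L[ℝ] ℝ) x :=
    (EuclideanSpace.proj j : Euc N →L[ℝ] ℝ).hasFDerivAt.sub_const (z j)
  have h2 := h1.sub (hasFDerivAt_of_contDiffOn ho (hu.contDiffOn_partialD ho j) hx)
  have h3 : HasFDerivAt (devi z u j) _ x := h2
  rw [h3.fderiv]
  simp only [_root_.sub_apply, PiLp.proj_apply, devHess, hessEntry]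
  congr 1
  simp [eq_comm]

theorem devHess_symm (ho : IsOpen Ω) (hu : IsTorsion Ω u) {x : Euc N} (hx : x ∈ Ω) (i j : Fin N) :
    devHess u i j x = devHess u j i x := by
  have hc := hu.2.1.contDiffAt (ho.mem_nhds hx)
  have hs : IsSymmSndFDerivAt ℝ u x := hc.isSymmSndFDerivAt (by simp)
  have h2 : DifferentiableAt ℝ (fderiv ℝ u) x :=
    (hc.fderiv_right (m := 1) (by norm_num)).differentiableAt one_ne_zero
  have h3 : ∀ i j, hessEntry u x i j = fderiv ℝ (fderiv ℝ u) x (EuclideanSpace.single i (1:ℝ))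
      (EuclideanSpace.single j (1:ℝ)) := fun i j => by
    rw [hessEntry, fderiv_clm_apply h2 (differentiableAt_const _)]
    simp
  simp only [devHess, h3, eq_comm (a := i)]
  rw [hs.eq]

theorem sum_devHess_self (hu : IsTorsion Ω u) {x : Euc N} (hx : x ∈ Ω) :
    ∑ i, devHess u i i x = 0 := by
  have := hu.2.2.1 x hx
  rw [lap] at this
  simp [devHess, Finset.sum_sub_distrib, this]

theorem sum_devHess_sq (hu : IsTorsion Ω u) {x : Euc N} (hx : x ∈ Ω) :
    ∑ i, ∑ j, devHess u i j x ^ 2 = hessNormSq u x - N := by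
  have h := hu.2.2.1 x hx
  rw [lap] at h
  have h1 : ∀ i j : Fin N, devHess u i j x ^ 2 =
      (if i = j then 1 - 2 * hessEntry u x i j else 0) + hessEntry u x i j ^ 2 := by
    intro i j
    rw [devHess]
    split_ifs <;> ring
  simp only [h1, Finset.sum_add_distrib, Finset.sum_ite_eq, Finset.mem_univ, if_true, hessNormSq]
  rw [Finset.sum_sub_distrib, ← Finset.mul_sum, h]
  simp
  ring

variable {η : ℝ} {κ φ Φ : ℝ → ℝ}

theorem IsCutoff.fderiv_mul (hκ : IsCutoff η κ φ) (ho : IsOpen Ω) (hu : IsTorsion Ω u)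
    {F : Euc N → ℝ} (hF : ContDiffOn ℝ 1 F Ω) {x : Euc N} (hx : x ∈ Ω) (e : Euc N) :
    fderiv ℝ (fun x => φ (-u x) * F x) x e =
      φ (-u x) * fderiv ℝ F x e - κ (-u x) * (fderiv ℝ u x e * F x) := by
  have h1 : HasFDerivAt (fun x => φ (-u x)) (κ (-u x) • -fderiv ℝ u x) x :=
    (hκ.hasDerivAt (-u x)).comp_hasFDerivAt x (hu.hasFDerivAt ho hx).neg
  rw [(h1.fun_mul (hasFDerivAt_of_contDiffOn ho hF hx)).fderiv]
  simp only [_root_.add_apply, _root_.smul_apply,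
    _root_.neg_apply, smul_eq_mul]
  ring

theorem IsCutoff.contDiffOn_mul (hκ : IsCutoff η κ φ) (hu : IsTorsion Ω u)
    {F : Euc N → ℝ} (hF : ContDiffOn ℝ 1 F Ω) : ContDiffOn ℝ 1 (fun x => φ (-u x) * F x) Ω :=
  (hκ.contDiff.comp_contDiffOn (hu.2.1.of_le (by norm_num)).neg).mul hF

theorem IsCutoff.integrableOn (hκ : IsCutoff η κ φ) (hη : 0 < η) (ho : IsOpen Ω)
    (hb : Bornology.IsBounded Ω) (hu : IsTorsion Ω u) {F : Euc N → ℝ} (hF : ContinuousOn F Ω) :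
    IntegrableOn (fun x => κ (-u x) * F x) Ω volume := by
  refine integrableOn_of_continuousOn_of_eq_zero ho (hu.isCompact_superLevel hb η)
    (hu.superLevel_subset ho hη)
    ((hκ.continuous.comp_continuousOn (hu.1.mono subset_closure).neg).mul hF) fun x hx hxK => ?_
  rw [(hκ.eq_zero _ (lt_of_notMem_superLevel hx hxK).le).1, zero_mul]

theorem IsCutoff.integrableOn' (hκ : IsCutoff η κ φ) (hη : 0 < η) (ho : IsOpen Ω)
    (hb : Bornology.IsBounded Ω) (hu : IsTorsion Ω u) {F : Euc N → ℝ} (hF : ContinuousOn F Ω) :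
    IntegrableOn (fun x => φ (-u x) * F x) Ω volume := by
  refine integrableOn_of_continuousOn_of_eq_zero ho (hu.isCompact_superLevel hb η)
    (hu.superLevel_subset ho hη)
    ((hκ.contDiff.continuous.comp_continuousOn (hu.1.mono subset_closure).neg).mul hF)
    fun x hx hxK => ?_
  rw [(hκ.eq_zero _ (lt_of_notMem_superLevel hx hxK).le).2, zero_mul]

theorem continuousOn_fderiv_apply {F : Euc N → ℝ} (ho : IsOpen Ω) (hF : ContDiffOn ℝ 1 F Ω)
    (e : Euc N) : ContinuousOn (fun x => fderiv ℝ F x e) Ω :=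
  (hF.continuousOn_fderiv_of_isOpen ho le_rfl).clm_apply continuousOn_const

theorem IsCutoff.setIntegral_mul_fderiv (hκ : IsCutoff η κ φ) (hη : 0 < η) (ho : IsOpen Ω)
    (hb : Bornology.IsBounded Ω) (hu : IsTorsion Ω u) {F : Euc N → ℝ} (hF : ContDiffOn ℝ 1 F Ω)
    (i : Fin N) :
    ∫ x in Ω, φ (-u x) * fderiv ℝ F x (EuclideanSpace.single i (1:ℝ)) =
      ∫ x in Ω, κ (-u x) * (partialD u i x * F x) := by
  have h := setIntegral_fderiv_eq_zero ho (hu.isCompact_superLevel hb η)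
    (hu.superLevel_subset ho hη) (hκ.contDiffOn_mul hu hF) (fun x hx hxK => by
      rw [(hκ.eq_zero _ (lt_of_notMem_superLevel hx hxK).le).2, zero_mul])
    (EuclideanSpace.single i (1:ℝ))
  rw [setIntegral_congr_fun ho.measurableSet fun x hx => hκ.fderiv_mul ho hu hF hx _,
    integral_sub (hκ.integrableOn' hη ho hb hu (continuousOn_fderiv_apply ho hF _))
      (hκ.integrableOn hη ho hb hu
        ((continuousOn_fderiv_apply ho (hu.2.1.of_le (by norm_num)) _).fun_mul
          hF.continuousOn))] at h
  exact sub_eq_zero.1 h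

theorem continuousOn_devHess (ho : IsOpen Ω) (hu : IsTorsion Ω u) (i j : Fin N) :
    ContinuousOn (devHess u i j) Ω :=
  continuousOn_const.sub (continuousOn_fderiv_apply ho (hu.contDiffOn_partialD ho j) _)

theorem fderiv_partialD (u : Euc N → ℝ) (x : Euc N) (i j : Fin N) :
    fderiv ℝ (partialD u j) x (EuclideanSpace.single i (1:ℝ)) = hessEntry u x i j := rfl

theorem IsCutoff.integral_partialD_sq (hκ : IsCutoff η κ φ) (hη : 0 < η) (ho : IsOpen Ω)
    (hb : Bornology.IsBounded Ω) (hu : IsTorsion Ω u) :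
    N * ∫ x in Ω, φ (-u x) = ∫ x in Ω, κ (-u x) * ∑ i, partialD u i x ^ 2 := by
  have hc : ∀ i : Fin N, ContinuousOn (partialD u i) Ω :=
    fun i => (hu.contDiffOn_partialD ho i).continuousOn
  have h := Finset.sum_congr rfl fun (i : Fin N) (_ : i ∈ Finset.univ) =>
    hκ.setIntegral_mul_fderiv hη ho hb hu (hu.contDiffOn_partialD ho i) i
  rw [← integral_finsetSum _ fun i _ => hκ.integrableOn' hη ho hb hu
      (continuousOn_fderiv_apply ho (hu.contDiffOn_partialD ho i) _),
    ← integral_finsetSum _ fun i _ => hκ.integrableOn hη ho hb hu ((hc i).fun_mul (hc i))] at h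
  rw [← integral_const_mul]
  convert h using 1
  · refine setIntegral_congr_fun ho.measurableSet fun x hx => ?_
    simp only [← Finset.mul_sum, fderiv_partialD]
    have := hu.2.2.1 x hx
    rw [lap] at this
    rw [this, mul_comm]
  · simp only [← Finset.mul_sum, pow_two]

theorem IsCutoff.integral_devi_sq (hκ : IsCutoff η κ φ) (hη : 0 < η) (ho : IsOpen Ω)
    (hb : Bornology.IsBounded Ω) (hu : IsTorsion Ω u) (z : Euc N) :
    N * (∫ x in Ω, φ (-u x) * ∑ j, devi z u j x ^ 2) +
      2 * ∫ x in Ω, φ (-u x) * ∑ i, ∑ j, partialD u i x * devi z u j x * devHess u i j x =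
      ∫ x in Ω, κ (-u x) * ((∑ i, partialD u i x ^ 2) * ∑ j, devi z u j x ^ 2) := by
  have hp := fun i => hu.contDiffOn_partialD ho i
  have hv := fun i => hu.contDiffOn_devi ho z i
  have hd := fun i j => continuousOn_devHess ho hu i j
  have hF : ∀ i : Fin N, ContDiffOn ℝ 1 (fun x => partialD u i x * ∑ j, devi z u j x ^ 2) Ω :=
    fun i => (hp i).mul (ContDiffOn.sum fun j _ => (hv j).pow 2)
  have h := Finset.sum_congr rfl fun (i : Fin N) (_ : i ∈ Finset.univ) =>
    hκ.setIntegral_mul_fderiv hη ho hb hu (hF i) i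
  rw [← integral_finsetSum _ fun i _ => hκ.integrableOn' hη ho hb hu
      (continuousOn_fderiv_apply ho (hF i) _),
    ← integral_finsetSum _ fun i _ => hκ.integrableOn hη ho hb hu
      ((hp i).continuousOn.fun_mul (hF i).continuousOn)] at h
  have hq : ContinuousOn (fun x => ∑ j, devi z u j x ^ 2) Ω :=
    (ContDiffOn.sum fun j _ => (hv j).pow 2).continuousOn
  have hr : ContinuousOn
      (fun x => ∑ i, ∑ j, partialD u i x * devi z u j x * devHess u i j x) Ω :=
    continuousOn_finsetSum _ fun i _ => continuousOn_finsetSum _ fun j _ =>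
      ((hp i).continuousOn.mul (hv j).continuousOn).mul (hd i j)
  rw [← integral_const_mul, ← integral_const_mul, ← integral_add
    ((hκ.integrableOn' hη ho hb hu hq).const_mul _) ((hκ.integrableOn' hη ho hb hu hr).const_mul _)]
  convert h using 1
  · refine setIntegral_congr_fun ho.measurableSet fun x hx => ?_
    have hf : ∀ i, fderiv ℝ (fun x => partialD u i x * ∑ j, devi z u j x ^ 2) x
        (EuclideanSpace.single i (1:ℝ)) = hessEntry u x i i * ∑ j, devi z u j x ^ 2 +
          2 * ∑ j, partialD u i x * devi z u j x * devHess u i j x := by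
      intro i
      have h2 : HasFDerivAt (fun x => ∑ j, devi z u j x ^ 2)
          (∑ j, (2 * devi z u j x ^ (2 - 1)) • fderiv ℝ (devi z u j) x) x :=
        HasFDerivAt.fun_sum fun j _ => by
          simpa using (hasFDerivAt_of_contDiffOn ho (hv j) hx).pow 2
      rw [((hasFDerivAt_of_contDiffOn ho (hp i) hx).fun_mul h2).fderiv]
      simp only [_root_.add_apply, _root_.smul_apply,
        _root_.sum_apply, smul_eq_mul, fderiv_devi ho hu z hx, fderiv_partialD,
        Finset.mul_sum]
      rw [add_comm]
      congr 1
      · rw [Finset.sum_mul]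
        exact Finset.sum_congr rfl fun j _ => mul_comm _ _
      · refine Finset.sum_congr rfl fun j _ => ?_
        norm_num
        ring
    simp only [hf, ← Finset.mul_sum, Finset.sum_add_distrib, ← Finset.sum_mul]
    have := hu.2.2.1 x hx
    rw [lap] at this
    rw [this]
    ring
  · simp only [← Finset.mul_sum, Finset.sum_mul]
    refine integral_congr_ae (Filter.Eventually.of_forall fun x => ?_)
    simp only
    congr 1
    refine Finset.sum_congr rfl fun i _ => ?_
    ring

theorem IsCutoff.integral_devHess_sq (hκ : IsCutoff η κ φ) (hφ : IsCutoff η φ Φ) (hη : 0 < η)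
    (ho : IsOpen Ω) (hb : Bornology.IsBounded Ω) (hu : IsTorsion Ω u) (z : Euc N) :
    ∫ x in Ω, Φ (-u x) * ∑ i, ∑ j, devHess u i j x ^ 2 =
      ∫ x in Ω, φ (-u x) * ∑ i, ∑ j, partialD u i x * devi z u j x * devHess u i j x := by
  have hp := fun i => hu.contDiffOn_partialD ho i
  have hv := fun i => hu.contDiffOn_devi ho z i
  have hd := fun i j => continuousOn_devHess ho hu i j
  set χ : ℝ → ℝ := fun s => Real.smoothTransition ((s - η / 2) / (η / 2)) with hχ
  have hχ1 : ∀ s, η ≤ s → χ s = 1 := fun s hs =>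
    Real.smoothTransition.one_of_one_le (by rw [le_div_iff₀ (by positivity)]; linarith)
  have hχ0 : ∀ s, s ≤ η / 2 → χ s = 0 := fun s hs =>
    Real.smoothTransition.zero_of_nonpos (div_nonpos_of_nonpos_of_nonneg (by linarith)
      (by positivity))
  have hχc : ContDiff ℝ 1 χ := Real.smoothTransition.contDiff.comp (by fun_prop)
  have hbC : ∀ i, ContDiffOn ℝ 1 (fun x => χ (-u x) * devi z u i x) Ω := fun i =>
    (hχc.comp_contDiffOn (hu.2.1.of_le (by norm_num)).neg).mul (hv i)
  have hprod : ∀ i j a b, ∀ x ∈ Ω,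
      fderiv ℝ (fun x => Φ (-u x) * devi z u j x) x (EuclideanSpace.single a (1:ℝ)) *
        fderiv ℝ (fun x => χ (-u x) * devi z u i x) x (EuclideanSpace.single b (1:ℝ)) =
      (Φ (-u x) * devHess u a j x - φ (-u x) * (partialD u a x * devi z u j x)) *
        devHess u b i x := by
    intro i j a b x hx
    rw [hφ.fderiv_mul ho hu (hv j) hx, fderiv_devi ho hu z hx]
    rcases le_or_gt (-u x) η with h | h
    · rw [(hφ.eq_zero _ h).1, (hφ.eq_zero _ h).2]
      simp
    · have hev : (fun x => χ (-u x) * devi z u i x) =ᶠ[nhds x] devi z u i := by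
        have hc : ContinuousAt (fun x => -u x) x :=
          (hu.2.1.continuousOn.continuousAt (ho.mem_nhds hx)).neg
        filter_upwards [hc.eventually (lt_mem_nhds h)] with y hy
        rw [hχ1 _ hy.le, one_mul]
      rw [hev.fderiv_eq, fderiv_devi ho hu z hx]
      rfl
  have hi1 : ∀ i j, IntegrableOn (fun x => (Φ (-u x) * devHess u i j x -
      φ (-u x) * (partialD u i x * devi z u j x)) * devHess u j i x) Ω volume := fun i j => by
    have h1 := (hκ.integrableOn' hη ho hb hu
      (((hp i).continuousOn.mul (hv j).continuousOn).mul (hd j i)))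
    have h2 := (hφ.integrableOn' hη ho hb hu ((hd i j).mul (hd j i)))
    refine (h2.sub h1).congr (Filter.Eventually.of_forall fun x => ?_)
    simp only [Pi.sub_apply, Pi.mul_apply]
    ring
  have hi2 : ∀ i j, IntegrableOn (fun x => (Φ (-u x) * devHess u j j x -
      φ (-u x) * (partialD u j x * devi z u j x)) * devHess u i i x) Ω volume := fun i j => by
    have h1 := (hκ.integrableOn' hη ho hb hu
      (((hp j).continuousOn.mul (hv j).continuousOn).mul (hd i i)))
    have h2 := (hφ.integrableOn' hη ho hb hu ((hd j j).mul (hd i i)))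
    refine (h2.sub h1).congr (Filter.Eventually.of_forall fun x => ?_)
    simp only [Pi.sub_apply, Pi.mul_apply]
    ring
  have key : ∀ i j, ∫ x in Ω, (Φ (-u x) * devHess u i j x -
      φ (-u x) * (partialD u i x * devi z u j x)) * devHess u j i x =
      ∫ x in Ω, (Φ (-u x) * devHess u j j x -
      φ (-u x) * (partialD u j x * devi z u j x)) * devHess u i i x := by
    intro i j
    have := setIntegral_fderiv_mul_fderiv_comm ho (hu.isCompact_superLevel hb (η / 2))
      (hu.superLevel_subset ho (half_pos hη)) (hφ.contDiffOn_mul hu (hv j))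
      (fun x hx hxK => by
        rw [(hφ.eq_zero _ ((lt_of_notMem_superLevel hx hxK).le.trans (by linarith))).2, zero_mul])
      (hbC i) (fun x hx hxK => by
        rw [hχ0 _ (lt_of_notMem_superLevel hx hxK).le, zero_mul])
      (EuclideanSpace.single i (1:ℝ)) (EuclideanSpace.single j (1:ℝ))
    rwa [setIntegral_congr_fun ho.measurableSet fun x hx => hprod i j i j x hx,
      setIntegral_congr_fun ho.measurableSet fun x hx => hprod i j j i x hx] at this
  have hsum := Finset.sum_congr rfl fun (i : Fin N) (_ : i ∈ Finset.univ) =>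
    Finset.sum_congr rfl fun (j : Fin N) (_ : j ∈ Finset.univ) => key i j
  simp only [← integral_finsetSum _ fun j _ => hi1 _ j,
    ← integral_finsetSum _ fun j _ => hi2 _ j] at hsum
  rw [← integral_finsetSum _ fun i _ => integrable_finsetSum _ fun j _ => hi1 i j,
    ← integral_finsetSum _ fun i _ => integrable_finsetSum _ fun j _ => hi2 i j] at hsum
  have hr : ∀ x ∈ Ω, ∑ i, ∑ j, (Φ (-u x) * devHess u j j x -
      φ (-u x) * (partialD u j x * devi z u j x)) * devHess u i i x = 0 := fun x hx => by
    rw [Finset.sum_comm]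
    simp only [← Finset.mul_sum, sum_devHess_self hu hx, mul_zero, Finset.sum_const_zero]
  rw [setIntegral_congr_fun ho.measurableSet hr, integral_zero,
    setIntegral_congr_fun (g := fun x => Φ (-u x) * (∑ i, ∑ j, devHess u i j x ^ 2) -
      φ (-u x) * ∑ i, ∑ j, partialD u i x * devi z u j x * devHess u i j x) ho.measurableSet
      fun x hx => ?_, integral_sub] at hsum
  · exact sub_eq_zero.1 hsum
  · exact hφ.integrableOn' hη ho hb hu (continuousOn_finsetSum _ fun i _ =>
      continuousOn_finsetSum _ fun j _ => (hd i j).pow 2)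
  · exact hκ.integrableOn' hη ho hb hu (continuousOn_finsetSum _ fun i _ =>
      continuousOn_finsetSum _ fun j _ =>
        ((hp i).continuousOn.mul (hv j).continuousOn).mul (hd i j))
  · simp only [Finset.mul_sum, ← Finset.sum_sub_distrib]
    refine Finset.sum_congr rfl fun i _ => Finset.sum_congr rfl fun j _ => ?_
    rw [devHess_symm ho hu hx j i]
    ring

theorem IsCutoff.integral_devHess_sq_eq (hκ : IsCutoff η κ φ) (hη : 0 < η)
    (ho : IsOpen Ω) (hb : Bornology.IsBounded Ω) (hu : IsTorsion Ω u) (z : Euc N) (t : ℝ) :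
    ∫ x in Ω, φ (-u x) * ∑ i, ∑ j, partialD u i x * devi z u j x * devHess u i j x =
      ∫ x in Ω, κ (-u x) * ((u x + (t - ∑ i, partialD u i x ^ 2) / 2) *
        ∑ j, partialD u j x * devi z u j x) := by
  have hp := fun i => hu.contDiffOn_partialD ho i
  have hv := fun i => hu.contDiffOn_devi ho z i
  have hd := fun i j => continuousOn_devHess ho hu i j
  set q : Euc N → ℝ := fun x => u x + (t - ∑ i, partialD u i x ^ 2) / 2 with hq
  have hqC : ContDiffOn ℝ 1 q Ω := (hu.2.1.of_le (by norm_num)).add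
    ((contDiffOn_const.sub (ContDiffOn.sum fun i _ => (hp i).pow 2)).div_const 2)
  have hF : ∀ j : Fin N, ContDiffOn ℝ 1 (fun x => devi z u j x * q x) Ω := fun j => (hv j).mul hqC
  have h := Finset.sum_congr rfl fun (i : Fin N) (_ : i ∈ Finset.univ) =>
    hκ.setIntegral_mul_fderiv hη ho hb hu (hF i) i
  rw [← integral_finsetSum _ fun i _ => hκ.integrableOn' hη ho hb hu
      (continuousOn_fderiv_apply ho (hF i) _),
    ← integral_finsetSum _ fun i _ => hκ.integrableOn hη ho hb hu
      ((hp i).continuousOn.fun_mul (hF i).continuousOn)] at h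
  convert h using 1
  · refine setIntegral_congr_fun ho.measurableSet fun x hx => ?_
    have hdq : ∀ j, fderiv ℝ q x (EuclideanSpace.single j (1:ℝ)) =
        ∑ i, partialD u i x * devHess u j i x := by
      intro j
      have h2 : HasFDerivAt q (fderiv ℝ u x + (2:ℝ)⁻¹ • (-∑ i, (2 * partialD u i x ^ (2 - 1)) •
          fderiv ℝ (partialD u i) x)) x := by
        have h3 : HasFDerivAt (fun x => ∑ i, partialD u i x ^ 2)
            (∑ i, (2 * partialD u i x ^ (2 - 1)) • fderiv ℝ (partialD u i) x) x :=
          HasFDerivAt.fun_sum fun j _ => by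
            simpa using (hasFDerivAt_of_contDiffOn ho (hp j) hx).pow 2
        have h4 := (hu.hasFDerivAt ho hx).add ((h3.const_sub t).const_smul (2:ℝ)⁻¹)
        refine h4.congr_of_eventuallyEq (Filter.Eventually.of_forall fun y => ?_)
        simp only [hq, Pi.add_apply, Pi.smul_apply, smul_eq_mul]
        ring
      rw [h2.fderiv]
      simp only [_root_.add_apply, _root_.smul_apply, _root_.neg_apply,
        _root_.sum_apply, smul_eq_mul, fderiv_partialD, devHess, mul_sub,
        Finset.sum_sub_distrib, mul_ite, mul_one, mul_zero, Finset.sum_ite_eq, Finset.mem_univ,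
        if_true, ← Finset.sum_neg_distrib, Finset.mul_sum]
      rw [sub_eq_add_neg, ← Finset.sum_neg_distrib]
      congr 1
      refine Finset.sum_congr rfl fun i _ => ?_
      norm_num
      ring
    have hf : ∀ j, fderiv ℝ (fun x => devi z u j x * q x) x (EuclideanSpace.single j (1:ℝ)) =
        devHess u j j x * q x + ∑ i, partialD u i x * devi z u j x * devHess u i j x := by
      intro j
      rw [((hasFDerivAt_of_contDiffOn ho (hv j) hx).fun_mul
        (hasFDerivAt_of_contDiffOn ho hqC hx)).fderiv]
      simp only [_root_.add_apply, _root_.smul_apply, smul_eq_mul, hdq, fderiv_devi ho hu z hx]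
      rw [add_comm, Finset.mul_sum]
      congr 1
      · ring
      · refine Finset.sum_congr rfl fun i _ => ?_
        rw [devHess_symm ho hu hx i j]
        ring
    simp only [hf, ← Finset.mul_sum, Finset.sum_add_distrib, ← Finset.sum_mul,
      sum_devHess_self hu hx, zero_mul, zero_add]
    rw [Finset.sum_comm]
  · simp only [← Finset.mul_sum]
    refine integral_congr_ae (Filter.Eventually.of_forall fun x => ?_)
    simp only
    rw [Finset.mul_sum]
    congr 1
    refine Finset.sum_congr rfl fun i _ => ?_
    ring

end TorsionIdentities

section Tent

theorem hasDerivAt_max_zero_pow (n : ℕ) (y : ℝ) :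
    HasDerivAt (fun y : ℝ => max 0 y ^ (n + 2)) ((n + 2 : ℝ) * max 0 y ^ (n + 1)) y := by
  have hp : HasDerivAt (fun y : ℝ => y ^ (n + 2)) ((n + 2 : ℝ) * y ^ (n + 1)) y := by
    simpa using hasDerivAt_pow (n + 2) y
  rcases lt_trichotomy y 0 with h | h | h
  · rw [max_eq_left h.le, zero_pow (by omega), mul_zero]
    refine (hasDerivAt_const y (0:ℝ)).congr_of_eventuallyEq ?_
    filter_upwards [gt_mem_nhds h] with z hz
    rw [max_eq_left hz.le, zero_pow (by omega)]
  · subst h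
    rw [max_self, zero_pow (by omega), mul_zero]
    have h0 : HasDerivAt (fun y : ℝ => y ^ (n + 2)) 0 0 := by
      simpa using hasDerivAt_pow (n + 2) (0:ℝ)
    rw [hasDerivAt_iff_isLittleO] at h0 ⊢
    refine Asymptotics.IsBigO.trans_isLittleO ?_ h0
    refine Asymptotics.isBigO_of_le _ fun z => ?_
    simp only [max_self, smul_zero, sub_zero]
    rw [zero_pow (by omega), sub_zero, sub_zero, norm_pow, norm_pow]
    refine pow_le_pow_left₀ (norm_nonneg _) ?_ _
    rw [Real.norm_eq_abs, Real.norm_eq_abs, abs_of_nonneg (le_max_left _ _)]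
    exact max_le (abs_nonneg _) (le_abs_self _)
  · rw [max_eq_right h.le]
    refine hp.congr_of_eventuallyEq ?_
    filter_upwards [lt_mem_nhds h] with z hz
    rw [max_eq_right hz.le]

/-- Piecewise linear bump supported on `[ε, 3ε]`, of integral one. -/
def tent (ε s : ℝ) : ℝ :=
  ε⁻¹ * (max 0 (s / ε - 1) - 2 * max 0 (s / ε - 2) + max 0 (s / ε - 3))

/-- First primitive of `tent`. -/
def tentPrim (ε s : ℝ) : ℝ :=
  (max 0 (s / ε - 1) ^ 2 - 2 * max 0 (s / ε - 2) ^ 2 + max 0 (s / ε - 3) ^ 2) / 2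

/-- Second primitive of `tent`. -/
def tentPrim₂ (ε s : ℝ) : ℝ :=
  ε * ((max 0 (s / ε - 1) ^ 3 - 2 * max 0 (s / ε - 2) ^ 3 + max 0 (s / ε - 3) ^ 3) / 6)

variable {ε : ℝ}

theorem continuous_tent (ε : ℝ) : Continuous (tent ε) := by
  unfold tent; fun_prop

theorem continuous_tentPrim (ε : ℝ) : Continuous (tentPrim ε) := by
  unfold tentPrim; fun_prop

theorem hasDerivAt_tent_aux (n : ℕ) (ε c s : ℝ) :
    HasDerivAt (fun s : ℝ => max 0 (s / ε - c) ^ (n + 2))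
      ((n + 2 : ℝ) * max 0 (s / ε - c) ^ (n + 1) * ε⁻¹) s := by
  have h1 : HasDerivAt (fun s : ℝ => s / ε - c) ε⁻¹ s := by
    simpa using ((hasDerivAt_id s).div_const ε).sub_const c
  exact (hasDerivAt_max_zero_pow n (s / ε - c)).comp s h1

theorem hasDerivAt_tentPrim (ε s : ℝ) : HasDerivAt (tentPrim ε) (tent ε s) s := by
  have := (((hasDerivAt_tent_aux 0 ε 1 s).sub ((hasDerivAt_tent_aux 0 ε 2 s).const_mul 2)).add
    (hasDerivAt_tent_aux 0 ε 3 s)).div_const 2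
  refine this.congr_deriv ?_
  simp only [tent]
  push_cast
  ring

theorem hasDerivAt_tentPrim₂ (hε : 0 < ε) (s : ℝ) :
    HasDerivAt (tentPrim₂ ε) (tentPrim ε s) s := by
  have := ((((hasDerivAt_tent_aux 1 ε 1 s).sub ((hasDerivAt_tent_aux 1 ε 2 s).const_mul 2)).add
    (hasDerivAt_tent_aux 1 ε 3 s)).div_const 6).const_mul ε
  refine this.congr_deriv ?_
  simp only [tentPrim]
  push_cast
  field_simp
  ring

theorem tent_eq_zero_left (hε : 0 < ε) {s : ℝ} (hs : s ≤ ε) :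
    tent ε s = 0 ∧ tentPrim ε s = 0 ∧ tentPrim₂ ε s = 0 := by
  have h1 : s / ε ≤ 1 := (div_le_one hε).2 hs
  have e1 : max 0 (s / ε - 1) = 0 := max_eq_left (by linarith)
  have e2 : max 0 (s / ε - 2) = 0 := max_eq_left (by linarith)
  have e3 : max 0 (s / ε - 3) = 0 := max_eq_left (by linarith)
  simp [tent, tentPrim, tentPrim₂, e1, e2, e3]

theorem tent_right (hε : 0 < ε) {s : ℝ} (hs : 3 * ε ≤ s) :
    tent ε s = 0 ∧ tentPrim ε s = 1 ∧ tentPrim₂ ε s = s - 2 * ε := by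
  have h1 : 3 ≤ s / ε := by rwa [le_div_iff₀ hε]
  have e1 : max 0 (s / ε - 1) = s / ε - 1 := max_eq_right (by linarith)
  have e2 : max 0 (s / ε - 2) = s / ε - 2 := max_eq_right (by linarith)
  have e3 : max 0 (s / ε - 3) = s / ε - 3 := max_eq_right (by linarith)
  simp only [tent, tentPrim, tentPrim₂, e1, e2, e3]
  refine ⟨by ring, by ring, ?_⟩
  field_simp
  ring

theorem isCutoff_tent (hε : 0 < ε) : IsCutoff ε (tent ε) (tentPrim ε) :=
  ⟨continuous_tent ε, hasDerivAt_tentPrim ε, fun _ hs =>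
    ⟨(tent_eq_zero_left hε hs).1, (tent_eq_zero_left hε hs).2.1⟩⟩

theorem isCutoff_tentPrim (hε : 0 < ε) : IsCutoff ε (tentPrim ε) (tentPrim₂ ε) :=
  ⟨continuous_tentPrim ε, hasDerivAt_tentPrim₂ hε, fun _ hs =>
    ⟨(tent_eq_zero_left hε hs).2.1, (tent_eq_zero_left hε hs).2.2⟩⟩

theorem tent_nonneg (hε : 0 < ε) (s : ℝ) : 0 ≤ tent ε s := by
  refine mul_nonneg (inv_nonneg.2 hε.le) ?_
  rcases max_cases 0 (s / ε - 1) with ⟨h1, h1'⟩ | ⟨h1, h1'⟩ <;>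
  rcases max_cases 0 (s / ε - 2) with ⟨h2, h2'⟩ | ⟨h2, h2'⟩ <;>
  rcases max_cases 0 (s / ε - 3) with ⟨h3, h3'⟩ | ⟨h3, h3'⟩ <;> rw [h1, h2, h3] <;> linarith

theorem tent_le (hε : 0 < ε) (s : ℝ) : tent ε s ≤ ε⁻¹ := by
  refine mul_le_of_le_one_right (inv_nonneg.2 hε.le) ?_
  rcases max_cases 0 (s / ε - 1) with ⟨h1, h1'⟩ | ⟨h1, h1'⟩ <;>
  rcases max_cases 0 (s / ε - 2) with ⟨h2, h2'⟩ | ⟨h2, h2'⟩ <;>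
  rcases max_cases 0 (s / ε - 3) with ⟨h3, h3'⟩ | ⟨h3, h3'⟩ <;> rw [h1, h2, h3] <;> linarith

theorem le_tent (hε : 0 < ε) {s : ℝ} (h1 : 3 / 2 * ε ≤ s) (h2 : s ≤ 5 / 2 * ε) :
    (2 * ε)⁻¹ ≤ tent ε s := by
  have h1 : 3 / 2 ≤ s / ε := by rwa [le_div_iff₀ hε]
  have h2 : s / ε ≤ 5 / 2 := by rwa [div_le_iff₀ hε]
  rw [mul_inv, mul_comm, tent]
  refine mul_le_mul_of_nonneg_left ?_ (inv_nonneg.2 hε.le)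
  rcases max_cases 0 (s / ε - 1) with ⟨h1, h1'⟩ | ⟨h1, h1'⟩ <;>
  rcases max_cases 0 (s / ε - 2) with ⟨h2, h2'⟩ | ⟨h2, h2'⟩ <;>
  rcases max_cases 0 (s / ε - 3) with ⟨h3, h3'⟩ | ⟨h3, h3'⟩ <;> rw [h1, h2, h3] <;> linarith

theorem monotone_tentPrim (hε : 0 < ε) : Monotone (tentPrim ε) :=
  monotone_of_hasDerivAt_nonneg (hasDerivAt_tentPrim ε) fun s => tent_nonneg hε s

theorem tentPrim_mem (hε : 0 < ε) (s : ℝ) : tentPrim ε s ∈ Icc (0:ℝ) 1 := by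
  constructor
  · rw [← (tent_eq_zero_left hε (min_le_right s ε)).2.1]
    exact monotone_tentPrim hε (min_le_left _ _)
  · rw [← (tent_right hε (le_max_right s (3 * ε))).2.1]
    exact monotone_tentPrim hε (le_max_left _ _)

theorem tentPrim₂_mem (hε : 0 < ε) {s : ℝ} (hs : 0 ≤ s) : tentPrim₂ ε s ∈ Icc 0 s := by
  have h0 : tentPrim₂ ε 0 = 0 := (tent_eq_zero_left hε hε.le).2.2
  constructor
  · rw [← h0]
    exact monotone_of_hasDerivAt_nonneg (hasDerivAt_tentPrim₂ hε)
      (fun s => (tentPrim_mem hε s).1) hs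
  · have := monotone_of_hasDerivAt_nonneg
      (fun s => (hasDerivAt_id s).sub (hasDerivAt_tentPrim₂ hε s))
      (fun s => sub_nonneg.2 (tentPrim_mem hε s).2) hs
    simp only [Pi.sub_apply, id, h0] at this
    linarith

theorem tent_mul_le (hε : 0 < ε) {s : ℝ} (hs : 0 ≤ s) : tent ε s * s ≤ 3 := by
  rcases le_or_gt (3 * ε) s with h | h
  · rw [(tent_right hε h).1]; simp
  · calc tent ε s * s ≤ ε⁻¹ * (3 * ε) :=
        mul_le_mul (tent_le hε s) h.le hs (inv_nonneg.2 hε.le)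
      _ = 3 := by field_simp

theorem eventually_three_mul_le {s : ℝ} (hs : 0 < s) :
    ∀ᶠ ε in nhdsWithin (0:ℝ) (Ioi 0), 0 < ε ∧ 3 * ε ≤ s := by
  filter_upwards [Ioo_mem_nhdsGT (show (0:ℝ) < s / 3 by positivity)] with ε hε
  exact ⟨hε.1, by linarith [hε.2]⟩

theorem tendsto_tentPrim {s : ℝ} (hs : 0 < s) :
    Filter.Tendsto (fun ε => tentPrim ε s) (nhdsWithin 0 (Ioi 0)) (nhds 1) := by
  refine tendsto_const_nhds.congr' ?_
  filter_upwards [eventually_three_mul_le hs] with ε hε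
  exact ((tent_right hε.1 hε.2).2.1).symm

theorem tendsto_tent {s : ℝ} (hs : 0 < s) :
    Filter.Tendsto (fun ε => tent ε s) (nhdsWithin 0 (Ioi 0)) (nhds 0) := by
  refine tendsto_const_nhds.congr' ?_
  filter_upwards [eventually_three_mul_le hs] with ε hε
  exact ((tent_right hε.1 hε.2).1).symm

theorem tendsto_tentPrim₂ {s : ℝ} (hs : 0 < s) :
    Filter.Tendsto (fun ε => tentPrim₂ ε s) (nhdsWithin 0 (Ioi 0)) (nhds s) := by
  have h : Filter.Tendsto (fun ε : ℝ => s - 2 * ε) (nhdsWithin 0 (Ioi 0)) (nhds s) := by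
    have : ContinuousAt (fun ε : ℝ => s - 2 * ε) 0 := by fun_prop
    simpa using this.tendsto.mono_left nhdsWithin_le_nhds
  refine h.congr' ?_
  filter_upwards [eventually_three_mul_le hs] with ε hε
  exact ((tent_right hε.1 hε.2).2.2).symm

end Tent

section TorsionLimits

variable {N : ℕ} {Ω : Set (Euc N)} {u : Euc N → ℝ} {g : Euc N → Euc N}

/-- A negative torsion function `u` on a bounded open set `Ω`, with square integrable Hessian,
together with a continuous extension `g` of its gradient to the whole space. -/
structure TorsionSetup (Ω : Set (Euc N)) (u : Euc N → ℝ) (g : Euc N → Euc N) : Prop where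
  isOpen : IsOpen Ω
  isBounded : Bornology.IsBounded Ω
  isTorsion : IsTorsion Ω u
  neg_of_mem : ∀ x ∈ Ω, u x < 0
  continuous : Continuous g
  eq_gradient : ∀ x ∈ Ω, g x = gradient u x
  integrableOn_hess : IntegrableOn (fun x => hessNormSq u x) Ω volume

/-- The weighted Hessian energy `∫ (-u) |I - D²u|²`. -/
def hessEnergy (Ω : Set (Euc N)) (u : Euc N → ℝ) : ℝ :=
  ∫ x in Ω, -u x * ∑ i, ∑ j, devHess u i j x ^ 2

namespace TorsionSetup

theorem partialD_eq (h : TorsionSetup Ω u g) {x : Euc N} (hx : x ∈ Ω) (i : Fin N) :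
    partialD u i x = g x i := by
  rw [h.eq_gradient x hx, partialD, ← toDual_gradient, InnerProductSpace.toDual_apply_apply,
    EuclideanSpace.inner_single_right]
  simp

theorem sum_partialD_sq (h : TorsionSetup Ω u g) {x : Euc N} (hx : x ∈ Ω) :
    ∑ i, partialD u i x ^ 2 = ‖g x‖ ^ 2 := by
  rw [EuclideanSpace.real_norm_sq_eq]
  exact Finset.sum_congr rfl fun i _ => by rw [h.partialD_eq hx]

theorem devi_eq (h : TorsionSetup Ω u g) (z : Euc N) {x : Euc N} (hx : x ∈ Ω) (i : Fin N) :
    devi z u i x = (x - z - g x) i := by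
  simp [devi, h.partialD_eq hx]

theorem sum_devi_sq (h : TorsionSetup Ω u g) (z : Euc N) {x : Euc N} (hx : x ∈ Ω) :
    ∑ i, devi z u i x ^ 2 = ‖x - z - g x‖ ^ 2 := by
  rw [EuclideanSpace.real_norm_sq_eq]
  exact Finset.sum_congr rfl fun i _ => by rw [h.devi_eq z hx]

theorem sum_partialD_mul_devi (h : TorsionSetup Ω u g) (z : Euc N) {x : Euc N} (hx : x ∈ Ω) :
    ∑ i, partialD u i x * devi z u i x = ⟪g x, x - z - g x⟫ := by
  rw [PiLp.inner_apply]
  refine Finset.sum_congr rfl fun i _ => ?_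
  rw [h.devi_eq z hx, h.partialD_eq hx]
  simp [mul_comm]

theorem integrableOn_of_continuous {F : Type*} [NormedAddCommGroup F] (h : TorsionSetup Ω u g)
    {f : Euc N → F} (hf : Continuous f) : IntegrableOn f Ω volume :=
  (hf.continuousOn.integrableOn_compact h.isBounded.isCompact_closure).mono_set subset_closure

theorem measurable_neg (h : TorsionSetup Ω u g) :
    AEMeasurable (fun x => -u x) (volume.restrict Ω) :=
  ((h.isTorsion.1.mono subset_closure).neg).aemeasurable h.isOpen.measurableSet

theorem exists_neg_le (h : TorsionSetup Ω u g) : ∃ M : ℝ, ∀ x ∈ Ω, -u x ≤ M := by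
  obtain ⟨M, hM⟩ := h.isBounded.isCompact_closure.bddAbove_image h.isTorsion.1.neg
  exact ⟨M, fun x hx => hM ⟨x, subset_closure hx, rfl⟩⟩

theorem integrableOn_devHess_sq (h : TorsionSetup Ω u g) :
    IntegrableOn (fun x => ∑ i, ∑ j, devHess u i j x ^ 2) Ω volume := by
  have : IntegrableOn (fun x => hessNormSq u x - (N:ℝ)) Ω volume :=
    h.integrableOn_hess.sub (h.integrableOn_of_continuous continuous_const)
  exact this.congr_fun (fun x hx => (sum_devHess_sq h.isTorsion hx).symm) h.isOpen.measurableSet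

theorem integrableOn_neg_mul_devHess_sq (h : TorsionSetup Ω u g) :
    IntegrableOn (fun x => -u x * ∑ i, ∑ j, devHess u i j x ^ 2) Ω volume := by
  obtain ⟨M, hM⟩ := h.exists_neg_le
  refine Integrable.bdd_mul h.integrableOn_devHess_sq
    h.measurable_neg.aestronglyMeasurable (c := M) ?_
  filter_upwards [ae_restrict_mem h.isOpen.measurableSet] with x hx
  rw [Real.norm_eq_abs, abs_of_nonneg (by linarith [h.neg_of_mem x hx])]
  exact hM x hx

theorem tendsto_tentPrim_mul (h : TorsionSetup Ω u g) {F : Euc N → ℝ}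
    (hF : IntegrableOn F Ω volume) :
    Filter.Tendsto (fun ε => ∫ x in Ω, tentPrim ε (-u x) * F x) (nhdsWithin 0 (Ioi 0))
      (nhds (∫ x in Ω, F x)) := by
  refine tendsto_integral_filter_of_dominated_convergence (fun x => ‖F x‖) ?_ ?_ hF.norm ?_
  · exact Filter.Eventually.of_forall fun ε =>
      (((continuous_tentPrim ε).measurable.comp_aemeasurable
        h.measurable_neg).aestronglyMeasurable).mul hF.aestronglyMeasurable
  · filter_upwards [self_mem_nhdsWithin] with ε hε
    refine Filter.Eventually.of_forall fun x => ?_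
    rw [norm_mul, Real.norm_eq_abs, abs_of_nonneg (tentPrim_mem hε _).1]
    exact mul_le_of_le_one_left (norm_nonneg _) (tentPrim_mem hε _).2
  · filter_upwards [ae_restrict_mem h.isOpen.measurableSet] with x hx
    simpa using (tendsto_tentPrim (neg_pos.2 (h.neg_of_mem x hx))).mul_const (F x)

theorem tendsto_tentPrim₂_mul (h : TorsionSetup Ω u g) :
    Filter.Tendsto (fun ε => ∫ x in Ω, tentPrim₂ ε (-u x) * ∑ i, ∑ j, devHess u i j x ^ 2)
      (nhdsWithin 0 (Ioi 0)) (nhds (hessEnergy Ω u)) := by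
  have hc : ∀ᶠ ε in nhdsWithin (0:ℝ) (Ioi 0), Continuous (tentPrim₂ ε) := by
    filter_upwards [self_mem_nhdsWithin] with ε hε
    exact (isCutoff_tentPrim hε).contDiff.continuous
  refine tendsto_integral_filter_of_dominated_convergence
    (fun x => ‖-u x * ∑ i, ∑ j, devHess u i j x ^ 2‖) ?_ ?_
    h.integrableOn_neg_mul_devHess_sq.norm ?_
  · filter_upwards [hc] with ε hε
    exact ((hε.measurable.comp_aemeasurable h.measurable_neg).aestronglyMeasurable).mul
        h.integrableOn_devHess_sq.aestronglyMeasurable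
  · filter_upwards [self_mem_nhdsWithin] with ε hε
    filter_upwards [ae_restrict_mem h.isOpen.measurableSet] with x hx
    have hx0 : 0 ≤ -u x := by linarith [h.neg_of_mem x hx]
    have := tentPrim₂_mem hε hx0
    rw [norm_mul, norm_mul, Real.norm_eq_abs, abs_of_nonneg this.1, Real.norm_eq_abs (-u x),
      abs_of_nonneg hx0]
    exact mul_le_mul_of_nonneg_right this.2 (norm_nonneg _)
  · filter_upwards [ae_restrict_mem h.isOpen.measurableSet] with x hx
    exact (tendsto_tentPrim₂ (neg_pos.2 (h.neg_of_mem x hx))).mul_const _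

theorem tendsto_tent_mul_self (h : TorsionSetup Ω u g) {F : Euc N → ℝ}
    (hF : IntegrableOn F Ω volume) :
    Filter.Tendsto (fun ε => ∫ x in Ω, tent ε (-u x) * (u x * F x)) (nhdsWithin 0 (Ioi 0))
      (nhds 0) := by
  have := tendsto_integral_filter_of_dominated_convergence (μ := volume.restrict Ω)
    (F := fun ε x => tent ε (-u x) * (u x * F x)) (f := fun _ => (0:ℝ))
    (l := nhdsWithin (0:ℝ) (Ioi 0))
    (fun x => 3 * ‖F x‖) ?_ ?_ (hF.norm.const_mul 3) ?_
  · simpa using this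
  · refine Filter.Eventually.of_forall fun ε =>
      (((continuous_tent ε).measurable.comp_aemeasurable
        h.measurable_neg).aestronglyMeasurable).mul
        (AEStronglyMeasurable.mul ?_ hF.aestronglyMeasurable)
    exact ((h.isTorsion.1.mono subset_closure).aemeasurable
      h.isOpen.measurableSet).aestronglyMeasurable
  · filter_upwards [self_mem_nhdsWithin] with ε hε
    filter_upwards [ae_restrict_mem h.isOpen.measurableSet] with x hx
    have hx0 : 0 ≤ -u x := by linarith [h.neg_of_mem x hx]
    rw [← mul_assoc, norm_mul, norm_mul, Real.norm_eq_abs, abs_of_nonneg (tent_nonneg hε _),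
      Real.norm_eq_abs (u x), ← abs_neg, abs_of_nonneg hx0]
    exact mul_le_mul_of_nonneg_right (tent_mul_le hε hx0) (norm_nonneg _)
  · filter_upwards [ae_restrict_mem h.isOpen.measurableSet] with x hx
    simpa using (tendsto_tent (neg_pos.2 (h.neg_of_mem x hx))).mul_const (u x * F x)

theorem integral_tent_mul_norm_sq (h : TorsionSetup Ω u g) {ε : ℝ} (hε : 0 < ε) :
    ∫ x in Ω, tent ε (-u x) * ‖g x‖ ^ 2 ≤ N * (volume Ω).toReal := by
  have := (isCutoff_tent hε).integral_partialD_sq hε h.isOpen h.isBounded h.isTorsion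
  rw [setIntegral_congr_fun (f := fun x => tent ε (-u x) * ∑ i, partialD u i x ^ 2)
    (g := fun x => tent ε (-u x) * ‖g x‖ ^ 2) h.isOpen.measurableSet
    fun x hx => by simp only [h.sum_partialD_sq hx]] at this
  rw [← this]
  refine mul_le_mul_of_nonneg_left ?_ (Nat.cast_nonneg N)
  have h1 : ∫ x in Ω, tentPrim ε (-u x) ≤ ∫ x in Ω, (1:ℝ) := by
    have hc : ContinuousOn (fun x => (1:ℝ)) Ω := continuousOn_const
    have := (isCutoff_tent hε).integrableOn' hε h.isOpen h.isBounded h.isTorsion hc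
    simp only [mul_one] at this
    exact setIntegral_mono this (h.integrableOn_of_continuous continuous_const)
      fun x => (tentPrim_mem hε _).2
  simpa [Measure.real] using h1

theorem tendsto_tent_mul_sq (h : TorsionSetup Ω u g) (z : Euc N) :
    Filter.Tendsto (fun ε => ∫ x in Ω, tent ε (-u x) * (‖g x‖ ^ 2 * ‖x - z - g x‖ ^ 2))
      (nhdsWithin 0 (Ioi 0)) (nhds (N * (∫ x in Ω, ‖x - z - g x‖ ^ 2) + 2 * hessEnergy Ω u)) := by
  have hg := h.continuous
  have hi : IntegrableOn (fun x => ‖x - z - g x‖ ^ 2) Ω volume :=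
    h.integrableOn_of_continuous (by fun_prop)
  refine (((h.tendsto_tentPrim_mul hi).const_mul (N:ℝ)).add
    (h.tendsto_tentPrim₂_mul.const_mul 2)).congr' ?_
  filter_upwards [self_mem_nhdsWithin] with ε hε
  rw [(isCutoff_tent hε).integral_devHess_sq (isCutoff_tentPrim hε) hε h.isOpen h.isBounded
    h.isTorsion z, setIntegral_congr_fun (f := fun x => tentPrim ε (-u x) * ‖x - z - g x‖ ^ 2)
    (g := fun x => tentPrim ε (-u x) * ∑ i, devi z u i x ^ 2) h.isOpen.measurableSet
    fun x hx => by simp only [← h.sum_devi_sq z hx],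
    (isCutoff_tent hε).integral_devi_sq hε h.isOpen h.isBounded h.isTorsion z]
  refine setIntegral_congr_fun h.isOpen.measurableSet fun x hx => ?_
  simp only [h.sum_devi_sq z hx, h.sum_partialD_sq hx]

theorem tendsto_tent_mul_inner (h : TorsionSetup Ω u g) (z : Euc N) (t : ℝ) :
    Filter.Tendsto (fun ε => ∫ x in Ω, tent ε (-u x) *
      ((t - ‖g x‖ ^ 2) / 2 * ⟪g x, x - z - g x⟫))
      (nhdsWithin 0 (Ioi 0)) (nhds (hessEnergy Ω u)) := by
  have hg := h.continuous
  have hF : Continuous fun x => ⟪g x, x - z - g x⟫ := by fun_prop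
  have l := h.tendsto_tentPrim₂_mul.sub
    (h.tendsto_tent_mul_self (h.integrableOn_of_continuous hF))
  rw [sub_zero] at l
  refine l.congr' ?_
  filter_upwards [self_mem_nhdsWithin] with ε hε
  rw [(isCutoff_tent hε).integral_devHess_sq (isCutoff_tentPrim hε) hε h.isOpen h.isBounded
    h.isTorsion z, (isCutoff_tent hε).integral_devHess_sq_eq hε h.isOpen h.isBounded
    h.isTorsion z t, sub_eq_iff_eq_add, ← integral_add]
  · refine setIntegral_congr_fun h.isOpen.measurableSet fun x hx => ?_
    simp only [h.sum_partialD_mul_devi z hx, h.sum_partialD_sq hx]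
    ring
  · exact (isCutoff_tent hε).integrableOn hε h.isOpen h.isBounded h.isTorsion
      (Continuous.continuousOn (by fun_prop))
  · exact (isCutoff_tent hε).integrableOn hε h.isOpen h.isBounded h.isTorsion
      ((h.isTorsion.1.mono subset_closure).mul hF.continuousOn)

theorem integral_gradient_eq_zero (h : TorsionSetup Ω u g) : ∫ x in Ω, g x = 0 := by
  have hi := h.integrableOn_of_continuous h.continuous
  ext i
  have hgi : Continuous fun x => g x i := by
    have := h.continuous
    fun_prop
  have e : (∫ x in Ω, g x) i = ∫ x in Ω, g x i :=
    ((EuclideanSpace.proj i : Euc N →L[ℝ] ℝ).integral_comp_comm hi).symm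
  rw [e]
  refine tendsto_nhds_unique (h.tendsto_tentPrim_mul (h.integrableOn_of_continuous hgi))
    (tendsto_const_nhds.congr' ?_)
  filter_upwards [self_mem_nhdsWithin] with ε hε
  have := (isCutoff_tentPrim hε).setIntegral_mul_fderiv hε h.isOpen h.isBounded h.isTorsion
    (F := fun _ => (1:ℝ)) contDiffOn_const i
  simp only [fderiv_fun_const, Pi.zero_apply, _root_.zero_apply, mul_zero, integral_zero,
    mul_one] at this
  rw [PiLp.zero_apply, this]
  exact setIntegral_congr_fun h.isOpen.measurableSet fun x hx => by simp only [h.partialD_eq hx]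

theorem integral_sub_eq_zero (h : TorsionSetup Ω u g) (hΩ : Ω.Nonempty) {z : Euc N}
    (hz : z = ⨍ x in Ω, x) : ∫ x in Ω, (x - z - g x) = 0 := by
  have hi := h.integrableOn_of_continuous h.continuous
  have h1 : IntegrableOn (fun x : Euc N => x) Ω volume :=
    h.integrableOn_of_continuous continuous_id
  have h2 : IntegrableOn (fun _ : Euc N => z) Ω volume :=
    h.integrableOn_of_continuous continuous_const
  have h12 : IntegrableOn (fun x : Euc N => x - z) Ω volume := h1.sub h2
  have hpos : (volume Ω).toReal ≠ 0 :=
    (ENNReal.toReal_pos (h.isOpen.measure_pos volume hΩ).ne' h.isBounded.measure_lt_top.ne).ne'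
  rw [integral_sub h12 hi, h.integral_gradient_eq_zero, sub_zero, integral_sub h1 h2,
    setIntegral_const, hz, setAverage_eq, smul_smul, Measure.real, mul_inv_cancel₀ hpos, one_smul,
    sub_self]

end TorsionSetup

end TorsionLimits

section BoundaryLayer

variable {N : ℕ} {Ω : Set (Euc N)} {u : Euc N → ℝ} {g : Euc N → Euc N}

/-- Near the boundary point `x` the domain contains fat cones in the direction `ω`, and the gradient
`g` is comparable with `-P ω`. -/
structure BdryNbhd (Ω : Set (Euc N)) (g : Euc N → Euc N) (s P r : ℝ) (x ω : Euc N) : Prop where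
  mem_frontier : x ∈ frontier Ω
  cone : FatCone s r r Ω x ω
  pos : 0 < P
  le_neg_inner : ∀ y ∈ Ω ∩ ball x r, s / 4 * P ≤ -⟪g y, ω⟫
  norm_le : ∀ y ∈ Ω ∩ ball x r, ‖g y‖ ≤ 5 / 4 * P

theorem TorsionSetup.hasDerivAt_line (h : TorsionSetup Ω u g) (w e : Euc N) {t : ℝ}
    (ht : w + t • e ∈ Ω) : HasDerivAt (fun t : ℝ => u (w + t • e)) ⟪g (w + t • e), e⟫ t := by
  have h1 : HasDerivAt (fun t : ℝ => w + t • e) e t := by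
    simpa using ((hasDerivAt_id t).smul_const e).const_add w
  have h2 := (h.isTorsion.hasFDerivAt h.isOpen ht).comp_hasDerivAt t h1
  rwa [← toDual_gradient, InnerProductSpace.toDual_apply_apply, ← h.eq_gradient _ ht] at h2

namespace BdryNbhd

variable {s P r : ℝ} {x ω : Euc N}

theorem line_bounds (hB : BdryNbhd Ω g s P r x ω) (h : TorsionSetup Ω u g) {w : Euc N} {t : ℝ}
    (ht : 0 ≤ t) (hw : ∀ τ ∈ Icc 0 t, w + τ • ω ∈ Ω ∩ ball x r) :
    s / 4 * P * t ≤ u w - u (w + t • ω) ∧ u w - u (w + t • ω) ≤ 5 / 4 * P * t := by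
  rcases ht.eq_or_lt with rfl | ht
  · simp
  obtain ⟨c, hc, hc'⟩ := exists_hasDerivAt_eq_slope (fun t : ℝ => u (w + t • ω))
    (fun t => ⟪g (w + t • ω), ω⟫) ht
    (fun τ hτ => (h.hasDerivAt_line w ω (hw τ hτ).1).continuousAt.continuousWithinAt)
    (fun τ hτ => h.hasDerivAt_line w ω (hw τ ⟨hτ.1.le, hτ.2.le⟩).1)
  have hcm := hw c ⟨hc.1.le, hc.2.le⟩
  have h1 := hB.le_neg_inner _ hcm
  have h2 : -⟪g (w + c • ω), ω⟫ ≤ 5 / 4 * P := by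
    rw [← inner_neg_right]
    refine (real_inner_le_norm _ _).trans ?_
    rw [norm_neg, hB.cone.1, mul_one]
    exact hB.norm_le _ hcm
  simp only [zero_smul, add_zero, sub_zero] at hc'
  rw [eq_div_iff ht.ne'] at hc'
  constructor <;> nlinarith

theorem add_smul_mem (hB : BdryNbhd Ω g s P r x ω) (hs : 0 < s) {w : Euc N}
    (hw : w ∈ Ω ∩ ball x r) {t : ℝ} (ht : 0 ≤ t) (htr : t < r) : w + t • ω ∈ Ω := by
  rcases ht.eq_or_lt with rfl | ht
  · simpa using hw.1
  · exact hB.cone.2 w ⟨hw.2, subset_closure hw.1⟩ t ⟨ht, htr⟩ (mem_ball_self (by positivity))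

theorem measurableSet_layer (h : TorsionSetup Ω u g) (x : Euc N) (r a b : ℝ) :
    MeasurableSet (Ω ∩ ball x r ∩ {y | -u y ∈ Icc a b}) := by
  have hc : ContinuousOn (fun y => -u y) (closure Ω) := h.isTorsion.1.neg
  have : IsClosed (closure Ω ∩ (fun y => -u y) ⁻¹' Icc a b) :=
    hc.preimage_isClosed_of_isClosed isClosed_closure isClosed_Icc
  have e : Ω ∩ ball x r ∩ {y | -u y ∈ Icc a b} =
      Ω ∩ ball x r ∩ (closure Ω ∩ (fun y => -u y) ⁻¹' Icc a b) := by
    ext y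
    simp only [mem_inter_iff, mem_ofPred_eq, mem_preimage]
    exact ⟨fun hy => ⟨hy.1, subset_closure hy.1.1, hy.2⟩, fun hy => ⟨hy.1, hy.2.2⟩⟩
  rw [e]
  exact (h.isOpen.measurableSet.inter measurableSet_ball).inter this.measurableSet

theorem volume_layer_le (hB : BdryNbhd Ω g s P r x ω) (h : TorsionSetup Ω u g) (hs : 0 < s)
    (hr : 0 < r) {ε : ℝ} (hε : 0 < ε) :
    ENNReal.ofReal (s * P * r / (24 * ε)) *
      volume (Ω ∩ ball x (r / 2) ∩ {y | -u y ∈ Icc ε (3 * ε)}) ≤ volume (ball x r) := by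
  set Z := Ω ∩ ball x (r / 2) ∩ {y | -u y ∈ Icc ε (3 * ε)} with hZ
  have hZm : MeasurableSet Z := measurableSet_layer h x _ _ _
  have hP := hB.pos
  set η := 12 * ε / (s * P) with hη
  have hη0 : 0 < η := by positivity
  set n := ⌊r / 2 / η⌋₊ with hn
  have hnr : ∀ k ∈ Finset.range (n + 1), k * η ≤ r / 2 := by
    intro k hk
    have h1 : (k : ℝ) ≤ n := by exact_mod_cast Nat.lt_succ_iff.1 (Finset.mem_range.1 hk)
    have h2 : (n : ℝ) ≤ r / 2 / η := Nat.floor_le (by positivity)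
    exact (le_div_iff₀ hη0).1 (h1.trans h2)
  have hstep : ∀ y ∈ Z, ∀ t, 0 ≤ t → t ≤ r / 2 → ∀ τ ∈ Icc 0 t, y + τ • ω ∈ Ω ∩ ball x r := by
    intro y hy t ht htr τ hτ
    have hyr : y ∈ ball x r := ball_subset_ball (by linarith) hy.1.2
    refine ⟨hB.add_smul_mem hs ⟨hy.1.1, hyr⟩ hτ.1 (by linarith [hτ.2]), ?_⟩
    rw [mem_ball, dist_eq_norm]
    have h1 : ‖y - x‖ < r / 2 := by rw [← dist_eq_norm]; exact hy.1.2
    calc ‖y + τ • ω - x‖ = ‖(y - x) + τ • ω‖ := by congr 1; abel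
      _ ≤ ‖y - x‖ + ‖τ • ω‖ := norm_add_le _ _
      _ < r / 2 + r / 2 := by
        rw [norm_smul, hB.cone.1, mul_one, Real.norm_eq_abs, abs_of_nonneg hτ.1]
        linarith [hτ.2]
      _ = r := by ring
  set T : ℕ → Set (Euc N) := fun k => (fun y => y - (k * η) • ω) ⁻¹' Z with hT
  have hTm : ∀ k, MeasurableSet (T k) := fun k => (measurable_sub_const _) hZm
  have hTv : ∀ k, volume (T k) = volume Z := fun k => by
    simp only [hT, sub_eq_add_neg]
    exact measure_preimage_add_right volume _ _
  have hdisj : ∀ k ∈ Finset.range (n + 1), ∀ l ∈ Finset.range (n + 1), k < l →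
      Disjoint (T k) (T l) := by
    intro k hk l hl hkl
    rw [Set.disjoint_left]
    intro y hyk hyl
    set w := y - (l * η) • ω with hw
    have hkl' : (k : ℝ) + 1 ≤ l := by exact_mod_cast hkl
    have ht0 : 0 ≤ ((l : ℝ) - k) * η := mul_nonneg (by linarith) hη0.le
    have ht1 : ((l : ℝ) - k) * η ≤ r / 2 := by
      have := hnr l hl
      have : 0 ≤ (k : ℝ) * η := by positivity
      linarith
    have hb := (hB.line_bounds h ht0 (hstep w hyl _ ht0 ht1)).1
    have e : w + (((l : ℝ) - k) * η) • ω = y - (k * η) • ω := by rw [hw]; module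
    rw [e] at hb
    have h1 : ε ≤ -u w := hyl.2.1
    have h2 : -u (y - (k * η) • ω) ≤ 3 * ε := hyk.2.2
    have h3 : s / 4 * P * η = 3 * ε := by rw [hη]; field_simp; norm_num
    have h4 : s / 4 * P * η ≤ s / 4 * P * (((l : ℝ) - k) * η) := by
      refine mul_le_mul_of_nonneg_left ?_ (by positivity)
      nlinarith
    linarith
  have hsub : (⋃ k ∈ Finset.range (n + 1), T k) ⊆ ball x r := by
    refine iUnion₂_subset fun k hk y hy => ?_
    have := hstep _ hy (k * η) (by positivity) (hnr k hk) (k * η) ⟨by positivity, le_rfl⟩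
    simpa using this.2
  calc ENNReal.ofReal (s * P * r / (24 * ε)) * volume Z
      ≤ ((n + 1 : ℕ) : ENNReal) * volume Z := by
        gcongr
        rw [← ENNReal.ofReal_natCast]
        refine ENNReal.ofReal_le_ofReal ?_
        have : s * P * r / (24 * ε) = r / 2 / η := by rw [hη]; field_simp; norm_num
        rw [this]
        push_cast
        exact (Nat.lt_floor_add_one _).le
    _ = ∑ k ∈ Finset.range (n + 1), volume (T k) := by
        simp [hTv]
    _ = volume (⋃ k ∈ Finset.range (n + 1), T k) := by
        rw [measure_biUnion_finset _ fun k _ => hTm k]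
        intro k hk l hl hkl
        rcases lt_or_gt_of_ne hkl with h' | h'
        · exact hdisj k hk l hl h'
        · exact (hdisj l hl k hk h').symm
    _ ≤ volume (ball x r) := measure_mono hsub

theorem le_volume_layer (hN : 0 < N) (hΩ : (Ωᶜ).Nonempty) (hB : BdryNbhd Ω g s P r x ω)
    (h : TorsionSetup Ω u g) (hs : 0 < s) (hs1 : s ≤ 1) (hr : 0 < r) {ρ ε : ℝ}
    (hρ : ρ = s * r / 16) (hε : 0 < ε) (hε1 : 2 * ε ≤ (ρ * s / 2) ^ 2 / 2)
    (hε2 : 2 * ε / (5 * P) ≤ 8 * ρ / s) :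
    volume (ball (x + ρ • ω) (ρ * s / 2)) ≤ ENNReal.ofReal (40 * ρ * P / (s * ε)) *
      volume (Ω ∩ ball x r ∩ {y | -u y ∈ Icc (3 / 2 * ε) (5 / 2 * ε)}) := by
  set Z := Ω ∩ ball x r ∩ {y | -u y ∈ Icc (3 / 2 * ε) (5 / 2 * ε)} with hZ
  have hP := hB.pos
  have hρ0 : 0 < ρ := by rw [hρ]; positivity
  have hρr : 16 * ρ / s = r := by rw [hρ]; field_simp
  have hρr' : 16 * ρ ≤ r := by rw [hρ]; nlinarith
  have hx0 : u x = 0 := h.isTorsion.2.2.2 x hB.mem_frontier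
  have hxc : x ∈ closure Ω := hB.mem_frontier.1
  set t₁ := 8 * ρ / s with ht₁
  have ht₁r : t₁ = r / 2 := by rw [← hρr, ht₁]; ring
  set τ := 2 * ε / (5 * P) with hτ
  have hτ0 : 0 < τ := by positivity
  have ht₁0 : 0 < t₁ := by positivity
  set n := ⌊t₁ / τ⌋₊ with hn
  set T : ℕ → Set (Euc N) := fun k => (fun y => y - (k * τ) • ω) ⁻¹' Z with hT
  have hTv : ∀ k, volume (T k) = volume Z := fun k => by
    simp only [hT, sub_eq_add_neg]
    exact measure_preimage_add_right volume _ _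
  have hsub : ball (x + ρ • ω) (ρ * s / 2) ⊆ ⋃ k ∈ Finset.range (n + 1), T k := by
    intro y hy
    have hcone : ∀ t ∈ Ioo 0 r, ball (x + t • ω) (t * s) ⊆ Ω :=
      hB.cone.2 x ⟨mem_ball_self hr, hxc⟩
    have hyn : ‖y - (x + ρ • ω)‖ < ρ * s / 2 := by rw [← dist_eq_norm]; exact hy
    have hρs : ρ * s ≤ ρ := mul_le_of_le_one_right hρ0.le hs1
    have hyx : ‖y - x‖ ≤ 3 / 2 * ρ := by
      calc ‖y - x‖ = ‖(y - (x + ρ • ω)) + ρ • ω‖ := by congr 1; abel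
        _ ≤ ‖y - (x + ρ • ω)‖ + ‖ρ • ω‖ := norm_add_le _ _
        _ ≤ 3 / 2 * ρ := by
          rw [norm_smul, hB.cone.1, mul_one, Real.norm_eq_abs, abs_of_nonneg hρ0.le]
          linarith
    have hbally : ball y (ρ * s / 2) ⊆ Ω := by
      refine Subset.trans (ball_subset_ball' ?_) (hcone ρ ⟨hρ0, by linarith⟩)
      rw [dist_eq_norm]; linarith
    have hyΩ : y ∈ Ω := hbally (mem_ball_self (by positivity))
    have hlow : 2 * ε ≤ -u y := by
      have h1 := h.isTorsion.le_neg_dist_sq hN h.isOpen h.isBounded hyΩ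
      have h2 : ρ * s / 2 ≤ infDist y Ωᶜ := le_infDist_compl_of_ball_subset hΩ hbally
      have h3 : (ρ * s / 2) ^ 2 ≤ infDist y Ωᶜ ^ 2 := pow_le_pow_left₀ (by positivity) h2 2
      linarith
    have hup : -u y ≤ 15 / 8 * P * ρ := by
      have hseg : ∀ l ∈ Ioc (0:ℝ) 1, x + l • (y - x) ∈ Ω ∩ ball x r := by
        intro l hl
        constructor
        · refine hcone (l * ρ) ⟨mul_pos hl.1 hρ0, by nlinarith [hl.2]⟩ ?_
          rw [mem_ball, dist_eq_norm,
            show x + l • (y - x) - (x + (l * ρ) • ω) = l • (y - (x + ρ • ω)) by module,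
            norm_smul, Real.norm_eq_abs, abs_of_pos hl.1, mul_assoc]
          exact mul_lt_mul_of_pos_left (by nlinarith) hl.1
        · rw [mem_ball, dist_eq_norm, add_sub_cancel_left, norm_smul, Real.norm_eq_abs,
            abs_of_pos hl.1]
          nlinarith [hl.2, hl.1, norm_nonneg (y - x)]
      have hcont : ContinuousOn (fun l : ℝ => u (x + l • (y - x))) (Icc 0 1) := by
        refine h.isTorsion.1.comp (by fun_prop) fun l hl => ?_
        rcases hl.1.eq_or_lt with rfl | h0
        · simpa using hxc
        · exact subset_closure (hseg l ⟨h0, hl.2⟩).1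
      obtain ⟨c, hc, hc'⟩ := exists_hasDerivAt_eq_slope (fun l : ℝ => u (x + l • (y - x)))
        (fun l => ⟪g (x + l • (y - x)), y - x⟫) one_pos hcont
        (fun l hl => h.hasDerivAt_line x (y - x) (hseg l ⟨hl.1, hl.2.le⟩).1)
      have h1 := (abs_le.1 (abs_real_inner_le_norm (g (x + c • (y - x))) (y - x))).1
      have h2 := hB.norm_le _ (hseg c ⟨hc.1, hc.2.le⟩)
      have h3 : ‖g (x + c • (y - x))‖ * ‖y - x‖ ≤ 5 / 4 * P * (3 / 2 * ρ) :=
        mul_le_mul h2 hyx (norm_nonneg _) (by positivity)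
      rw [hc'] at h1
      simp only [one_smul, zero_smul, add_zero, hx0, add_sub_cancel, sub_zero, div_one] at h1
      linarith
    have hback : ∀ t ∈ Icc 0 t₁, y - t • ω ∈ ball x r := by
      intro t ht
      rw [mem_ball, dist_eq_norm]
      calc ‖y - t • ω - x‖ = ‖(y - x) - t • ω‖ := by congr 1; abel
        _ ≤ ‖y - x‖ + ‖t • ω‖ := norm_sub_le _ _
        _ < r := by
          rw [norm_smul, hB.cone.1, mul_one, Real.norm_eq_abs, abs_of_nonneg ht.1]
          linarith [ht.2]
    have hex : ∃ t ∈ Icc 0 t₁, y - t • ω ∉ Ω := by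
      by_contra! hcon
      have hl := (hB.line_bounds h (w := y - t₁ • ω) ht₁0.le fun t ht => by
        have := hcon (t₁ - t) ⟨by linarith [ht.2], by linarith [ht.1]⟩
        have h' := hback (t₁ - t) ⟨by linarith [ht.2], by linarith [ht.1]⟩
        rw [show y - t₁ • ω + t • ω = y - (t₁ - t) • ω by module]
        exact ⟨this, h'⟩).1
      rw [sub_add_cancel] at hl
      have h1 := h.neg_of_mem _ (hcon t₁ ⟨ht₁0.le, le_rfl⟩)
      have h2 : s / 4 * P * t₁ = 2 * P * ρ := by rw [ht₁]; field_simp; norm_num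
      nlinarith [mul_pos hP hρ0]
    have hcl : IsCompact (Icc 0 t₁ ∩ (fun t : ℝ => y - t • ω) ⁻¹' Ωᶜ) :=
      isCompact_Icc.inter_right (h.isOpen.isClosed_compl.preimage (by fun_prop))
    obtain ⟨t₂, ⟨ht₂, ht₂'⟩, hmin⟩ := hcl.exists_isLeast
      (by obtain ⟨t, ht, ht'⟩ := hex; exact ⟨t, ht, ht'⟩)
    have hin : ∀ t, 0 ≤ t → t < t₂ → y - t • ω ∈ Ω := by
      intro t h0 h1
      by_contra h2
      exact absurd (hmin ⟨⟨h0, h1.le.trans ht₂.2⟩, h2⟩) (not_le.2 h1)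
    have ht₂0 : 0 < t₂ := by
      refine ht₂.1.lt_of_ne fun h0 => ?_
      rw [← h0] at ht₂'
      exact ht₂' (by simpa using hyΩ)
    have hcl2 : y - t₂ • ω ∈ closure Ω := by
      have hc : ContinuousWithinAt (fun t : ℝ => y - t • ω) (Ico 0 t₂) t₂ := by fun_prop
      refine hc.mem_closure ?_ fun t ht => hin t ht.1 ht.2
      rw [closure_Ico ht₂0.ne]
      exact ⟨ht₂0.le, le_rfl⟩
    have hu2 : u (y - t₂ • ω) = 0 :=
      h.isTorsion.2.2.2 _ ⟨hcl2, by rw [h.isOpen.interior_eq]; exact ht₂'⟩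
    have hcont : ContinuousOn (fun t : ℝ => -u (y - t • ω)) (Icc 0 t₂) := by
      refine (h.isTorsion.1.comp (by fun_prop) fun t ht => ?_).neg
      rcases ht.2.eq_or_lt with rfl | h0
      · exact hcl2
      · exact subset_closure (hin t ht.1 h0)
    obtain ⟨t, ht, ht'⟩ := intermediate_value_Icc' ht₂0.le hcont
      (show 2 * ε ∈ Icc _ _ from ⟨by simp only [hu2]; linarith, by simpa using hlow⟩)
    simp only at ht'
    have htlt : t < t₂ := by
      refine ht.2.lt_of_ne fun h0 => ?_
      rw [h0, hu2] at ht'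
      linarith
    set k := ⌊t / τ⌋₊ with hk
    have hk1 : k * τ ≤ t := (le_div_iff₀ hτ0).1 (Nat.floor_le (div_nonneg ht.1 hτ0.le))
    have hk2 : t ≤ (k + 1) * τ := (div_le_iff₀ hτ0).1 (Nat.lt_floor_add_one _).le
    have hkn : k ≤ n := Nat.floor_le_floor (by gcongr; exact htlt.le.trans ht₂.2)
    refine mem_iUnion₂.2 ⟨k, Finset.mem_range.2 (Nat.lt_succ_of_le hkn), ?_⟩
    have hkt : 0 ≤ (k:ℝ) * τ := by positivity
    have hb := hB.line_bounds h (w := y - t • ω) (t := t - k * τ) (by linarith) fun τ' hτ' => by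
      rw [show y - t • ω + τ' • ω = y - (t - τ') • ω by module]
      exact ⟨hin _ (by linarith [hτ'.2]) (by linarith [hτ'.1]),
        hback _ ⟨by linarith [hτ'.2], by linarith [hτ'.1, ht₂.2]⟩⟩
    rw [show y - t • ω + (t - k * τ) • ω = y - (k * τ) • ω by module] at hb
    have h5 : 5 / 4 * P * τ = ε / 2 := by rw [hτ]; field_simp; norm_num
    have h6 : 5 / 4 * P * (t - k * τ) ≤ 5 / 4 * P * τ :=
      mul_le_mul_of_nonneg_left (by linarith) (by positivity)
    have h7 : 0 ≤ s / 4 * P * (t - k * τ) := mul_nonneg (by positivity) (by linarith)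
    refine ⟨⟨hin _ hkt (by linarith), hback _ ⟨hkt, by linarith [ht₂.2]⟩⟩, ?_⟩
    show -u (y - (k * τ) • ω) ∈ Icc _ _
    constructor <;> linarith [hb.1, hb.2]
  calc volume (ball (x + ρ • ω) (ρ * s / 2))
      ≤ volume (⋃ k ∈ Finset.range (n + 1), T k) := measure_mono hsub
    _ ≤ ∑ k ∈ Finset.range (n + 1), volume (T k) := measure_biUnion_finset_le _ _
    _ = ((n + 1 : ℕ) : ENNReal) * volume Z := by simp [hTv]
    _ ≤ ENNReal.ofReal (40 * ρ * P / (s * ε)) * volume Z := by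
        gcongr
        rw [← ENNReal.ofReal_natCast]
        refine ENNReal.ofReal_le_ofReal ?_
        push_cast
        have h1 : (n : ℝ) ≤ t₁ / τ := Nat.floor_le (by positivity)
        have h2 : 1 ≤ t₁ / τ := (one_le_div hτ0).2 hε2
        have h3 : 40 * ρ * P / (s * ε) = 2 * (t₁ / τ) := by
          rw [ht₁, hτ]; field_simp; norm_num
        linarith

end BdryNbhd

end BoundaryLayer

section BoundaryGradient

variable {N : ℕ} {Ω : Set (Euc N)} {u : Euc N → ℝ} {g : Euc N → Euc N}

theorem TorsionSetup.inner_le (h : TorsionSetup Ω u g) {s τ r : ℝ} {x ω : Euc N} (hs : 0 < s)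
    (hτ : 0 < τ) (hr : 0 < r) (hx : x ∈ frontier Ω) (hc : FatCone s τ r Ω x ω) :
    ⟪g x, ω⟫ ≤ -(s / 2 * ‖g x‖) := by
  rcases eq_or_ne (g x) 0 with hp | hp
  · simp [hp]
  have hp' : 0 < ‖g x‖ := norm_pos_iff.2 hp
  set ξ : Euc N := ω + (s / 2 / ‖g x‖) • g x with hξ
  have hmem : ∀ t ∈ Ioo 0 τ, x + t • ξ ∈ Ω := fun t ht => by
    refine hc.2 x ⟨mem_ball_self hr, frontier_subset_closure hx⟩ t ht ?_
    have e : x + t • ξ - (x + t • ω) = (t * (s / 2 / ‖g x‖)) • g x := by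
      rw [hξ, smul_add, mul_smul]; abel
    rw [mem_ball, dist_eq_norm, e, norm_smul, Real.norm_eq_abs,
      abs_of_nonneg (by have := ht.1; positivity)]
    have : t * (s / 2 / ‖g x‖) * ‖g x‖ = t * s / 2 := by field_simp
    have := mul_pos ht.1 hs
    linarith
  have hin : ⟪g x, ξ⟫ = ⟪g x, ω⟫ + s / 2 * ‖g x‖ := by
    rw [hξ, inner_add_right, inner_smul_right, real_inner_self_eq_norm_sq]
    field_simp
  by_contra! hcon
  have hpos : 0 < ⟪g x, ξ⟫ := by linarith
  have hcont : Continuous fun t : ℝ => ⟪g (x + t • ξ), ξ⟫ :=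
    (h.continuous.comp (by fun_prop)).inner continuous_const
  have hev : ∀ᶠ t in nhds (0 : ℝ), 0 < ⟪g (x + t • ξ), ξ⟫ :=
    hcont.continuousAt.eventually (lt_mem_nhds (by simpa using hpos))
  obtain ⟨δ, hδ, hball⟩ := Metric.eventually_nhds_iff.1 hev
  set t : ℝ := min δ τ / 2 with ht
  have hm : 0 < min δ τ := lt_min hδ hτ
  have htp : 0 < t := by positivity
  have htδ : t < δ := by have := min_le_left δ τ; rw [ht]; linarith
  have htτ : t < τ := by have := min_le_right δ τ; rw [ht]; linarith
  have hmaps : MapsTo (fun t : ℝ => x + t • ξ) (Icc 0 t) (closure Ω) := fun τ' hτ' => by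
    rcases hτ'.1.eq_or_lt with h0 | h0
    · simpa [← h0] using frontier_subset_closure hx
    · exact subset_closure (hmem _ ⟨h0, hτ'.2.trans_lt htτ⟩)
  obtain ⟨c, hc, hc'⟩ := exists_hasDerivAt_eq_slope (fun t : ℝ => u (x + t • ξ))
    (fun t => ⟪g (x + t • ξ), ξ⟫) htp
    (h.isTorsion.1.comp (by fun_prop) hmaps)
    (fun τ' hτ' => h.hasDerivAt_line x ξ (hmem _ ⟨hτ'.1, hτ'.2.trans htτ⟩))
  have h1 : 0 < ⟪g (x + c • ξ), ξ⟫ := hball (by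
    rw [Real.dist_eq, sub_zero, abs_of_pos hc.1]; exact hc.2.trans htδ)
  have h2 := h.neg_of_mem _ (hmem t ⟨htp, htτ⟩)
  simp only [zero_smul, add_zero, sub_zero, h.isTorsion.2.2.2 x hx] at hc'
  rw [hc'] at h1
  exact absurd h1 (not_lt.2 (div_nonpos_of_nonpos_of_nonneg h2.le htp.le))

theorem TorsionSetup.exists_bdryNbhd (h : TorsionSetup Ω u g) {s a m : ℝ} (hs : 0 < s)
    (hs1 : s ≤ 1) (ha : 0 < a) (hm : 0 < m) (hg : ∀ x ∈ frontier Ω, m ≤ ‖g x‖)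
    (hc : ∀ x ∈ frontier Ω, ∃ ω, FatCone s (a / 2) a Ω x ω) :
    ∃ r₁ > 0, ∀ x ∈ frontier Ω, ∃ ω, ∀ r, r ≤ r₁ → BdryNbhd Ω g s ‖g x‖ r x ω := by
  have hK : IsCompact (closure Ω) := h.isBounded.isCompact_closure
  obtain ⟨δ, hδ, hu⟩ := Metric.uniformContinuousOn_iff.1
    (hK.uniformContinuousOn_of_continuous h.continuous.continuousOn) (s / 4 * m) (by positivity)
  refine ⟨min δ (a / 2), by positivity, fun x hx => ?_⟩
  obtain ⟨ω, hω⟩ := hc x hx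
  have hin := h.inner_le hs (half_pos ha) ha hx hω
  have hmx := hg x hx
  have hP : 0 < ‖g x‖ := hm.trans_le hmx
  refine ⟨ω, fun r hr => ?_⟩
  have hclose : ∀ y ∈ Ω ∩ ball x r, ‖g y - g x‖ ≤ s / 4 * m := fun y hy => by
    rw [← dist_eq_norm]
    exact (hu y (subset_closure hy.1) x (frontier_subset_closure hx)
      ((mem_ball.1 hy.2).trans_le (hr.trans (min_le_left _ _)))).le
  have hra : r ≤ a / 2 := hr.trans (min_le_right _ _)
  have hsm : s / 4 * m ≤ s / 4 * ‖g x‖ := by gcongr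
  refine ⟨hx, ⟨hω.1, fun w hw t ht => hω.2 w ⟨?_, hw.2⟩ t ⟨ht.1, ht.2.trans_le hra⟩⟩, hP,
    fun y hy => ?_, fun y hy => ?_⟩
  · exact ball_subset_ball (by linarith) hw.1
  · have h1 : ⟪g y - g x, ω⟫ ≤ s / 4 * m := by
      refine (real_inner_le_norm _ _).trans ?_
      rw [hω.1, mul_one]
      exact hclose y hy
    rw [inner_sub_left] at h1
    linarith
  · have h1 := norm_le_norm_add_norm_sub' (g y) (g x)
    have h2 := hclose y hy
    nlinarith

end BoundaryGradient

section LayerMeasure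

variable {N : ℕ} {Ω : Set (Euc N)} {u : Euc N → ℝ} {g : Euc N → Euc N}

/-- The measure `tent ε (-u) dx` on `Ω`, concentrated on `{ε ≤ -u ≤ 3ε}`. -/
def layerMeasure (Ω : Set (Euc N)) (u : Euc N → ℝ) (ε : ℝ) : Measure (Euc N) :=
  (volume.restrict Ω).withDensity fun x => ENNReal.ofReal (tent ε (-u x))

namespace TorsionSetup

theorem aemeasurable_tent (h : TorsionSetup Ω u g) (ε : ℝ) :
    AEMeasurable (fun x => tent ε (-u x)) (volume.restrict Ω) :=
  (continuous_tent ε).measurable.comp_aemeasurable h.measurable_neg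

theorem integrableOn_tent_mul (h : TorsionSetup Ω u g) (ε : ℝ) {F : Euc N → ℝ}
    (hF : Continuous F) : IntegrableOn (fun x => tent ε (-u x) * F x) Ω volume :=
  ((((continuous_tent ε).comp_continuousOn h.isTorsion.1.neg).mul
    hF.continuousOn).integrableOn_compact h.isBounded.isCompact_closure).mono_set subset_closure

theorem integrableOn_tent (h : TorsionSetup Ω u g) (ε : ℝ) :
    IntegrableOn (fun x => tent ε (-u x)) Ω volume := by
  simpa using h.integrableOn_tent_mul ε (continuous_const (y := (1:ℝ)))

theorem isFiniteMeasure_layerMeasure (h : TorsionSetup Ω u g) (ε : ℝ) :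
    IsFiniteMeasure (layerMeasure Ω u ε) :=
  isFiniteMeasure_withDensity_ofReal (h.integrableOn_tent ε).2

theorem integral_layerMeasure (h : TorsionSetup Ω u g) {ε : ℝ} (hε : 0 < ε) (F : Euc N → ℝ) :
    ∫ x, F x ∂(layerMeasure Ω u ε) = ∫ x in Ω, tent ε (-u x) * F x := by
  rw [layerMeasure, integral_withDensity_eq_integral_toReal_smul₀
    (h.aemeasurable_tent ε).ennreal_ofReal (by simp)]
  simp only [ENNReal.toReal_ofReal (tent_nonneg hε _), smul_eq_mul]

theorem layerMeasure_apply (u : Euc N → ℝ) (ε : ℝ) {s : Set (Euc N)} (hs : MeasurableSet s) :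
    layerMeasure Ω u ε s = ∫⁻ x in s ∩ Ω, ENNReal.ofReal (tent ε (-u x)) := by
  rw [layerMeasure, withDensity_apply _ hs, Measure.restrict_restrict hs]

theorem layerMeasure_compl_closure (u : Euc N → ℝ) (ε : ℝ) :
    layerMeasure Ω u ε (closure Ω)ᶜ = 0 := by
  rw [layerMeasure_apply u ε isClosed_closure.measurableSet.compl]
  have : (closure Ω)ᶜ ∩ Ω = ∅ := by
    ext x; simp only [mem_inter_iff, mem_compl_iff, mem_empty_iff_false, iff_false, not_and]
    exact fun hx hx' => hx (subset_closure hx')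
  simp [this]

theorem exists_le_neg (h : TorsionSetup Ω u g) {K : Set (Euc N)} (hK : IsCompact K)
    (hKΩ : K ⊆ Ω) : ∃ c > 0, ∀ x ∈ K, c ≤ -u x :=
  hK.exists_forall_le' ((h.isTorsion.1.mono (hKΩ.trans subset_closure)).neg)
    fun x hx => neg_pos.2 (h.neg_of_mem x (hKΩ hx))

theorem eventually_layerMeasure_eq_zero (h : TorsionSetup Ω u g) {K : Set (Euc N)}
    (hK : IsCompact K) (hKΩ : K ⊆ Ω) :
    ∀ᶠ ε in nhdsWithin (0:ℝ) (Ioi 0), layerMeasure Ω u ε K = 0 := by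
  obtain ⟨c, hc, hcK⟩ := h.exists_le_neg hK hKΩ
  filter_upwards [eventually_three_mul_le hc] with ε hε
  rw [layerMeasure_apply u ε hK.measurableSet, inter_eq_left.2 hKΩ,
    setLIntegral_congr_fun (g := fun _ => 0) hK.measurableSet fun x hx => ?_]
  · simp
  · simp [(tent_right hε.1 (hε.2.trans (hcK x hx))).1]

theorem eventually_layerMeasure_univ_le (h : TorsionSetup Ω u g) {m : ℝ} (hm : 0 < m)
    (hg : ∀ x ∈ frontier Ω, m ≤ ‖g x‖) :
    ∃ C : NNReal, ∀ᶠ ε in nhdsWithin (0:ℝ) (Ioi 0), layerMeasure Ω u ε univ ≤ C := by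
  set K := closure Ω ∩ g ⁻¹' closedBall 0 (m / 2) with hKdef
  have hK : IsCompact K := h.isBounded.isCompact_closure.inter_right
    (isClosed_closedBall.preimage h.continuous)
  have hKΩ : K ⊆ Ω := fun x hx => by
    by_contra hxΩ
    have h1 := hg x ⟨hx.1, by rwa [h.isOpen.interior_eq]⟩
    have h2 : ‖g x‖ ≤ m / 2 := by simpa using hx.2
    linarith
  obtain ⟨c, hc, hcK⟩ := h.exists_le_neg hK hKΩ
  refine ⟨Real.toNNReal (4 / m ^ 2 * (N * (volume Ω).toReal)), ?_⟩
  filter_upwards [eventually_three_mul_le hc] with ε hε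
  have hle : ∀ x ∈ Ω, tent ε (-u x) ≤ 4 / m ^ 2 * (tent ε (-u x) * ‖g x‖ ^ 2) := fun x hx => by
    by_cases hxK : x ∈ K
    · simp [(tent_right hε.1 (hε.2.trans (hcK x hxK))).1]
    · have hgx : m / 2 < ‖g x‖ := by
        by_contra! hcon
        exact hxK ⟨subset_closure hx, by simpa using hcon⟩
      have h0 := tent_nonneg hε.1 (-u x)
      have h1 : 1 ≤ 4 / m ^ 2 * ‖g x‖ ^ 2 := by
        rw [div_mul_eq_mul_div, le_div_iff₀ (by positivity)]
        nlinarith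
      nlinarith
  rw [layerMeasure_apply u ε MeasurableSet.univ, univ_inter,
    ← ofReal_integral_eq_lintegral_ofReal (h.integrableOn_tent ε)
      (Filter.Eventually.of_forall fun x => tent_nonneg hε.1 _)]
  refine ENNReal.ofReal_le_ofReal ?_
  calc ∫ x in Ω, tent ε (-u x) ≤ ∫ x in Ω, 4 / m ^ 2 * (tent ε (-u x) * ‖g x‖ ^ 2) :=
        setIntegral_mono_on (h.integrableOn_tent ε)
          ((h.integrableOn_tent_mul ε (F := fun x => ‖g x‖ ^ 2)
            (by have := h.continuous; fun_prop)).const_mul _)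
          h.isOpen.measurableSet hle
    _ ≤ _ := by
        rw [integral_const_mul]
        exact mul_le_mul_of_nonneg_left (h.integral_tent_mul_norm_sq hε.1) (by positivity)

end TorsionSetup

namespace BdryNbhd

variable {s P r : ℝ} {x ω : Euc N}

theorem layerMeasure_ball_le (hB : BdryNbhd Ω g s P r x ω) (h : TorsionSetup Ω u g) (hs : 0 < s)
    (hr : 0 < r) {ε : ℝ} (hε : 0 < ε) :
    layerMeasure Ω u ε (ball x (r / 2)) ≤
      ENNReal.ofReal (24 / (s * P * r)) * volume (ball x r) := by
  have hP := hB.pos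
  set Z := Ω ∩ ball x (r / 2) ∩ {y | -u y ∈ Icc ε (3 * ε)} with hZ
  have hZm : MeasurableSet Z := measurableSet_layer h x (r / 2) ε (3 * ε)
  have h1 : layerMeasure Ω u ε (ball x (r / 2)) ≤ ENNReal.ofReal ε⁻¹ * volume Z := by
    rw [TorsionSetup.layerMeasure_apply u ε measurableSet_ball, ← setLIntegral_const,
      ← lintegral_indicator (measurableSet_ball.inter h.isOpen.measurableSet),
      ← lintegral_indicator hZm]
    refine lintegral_mono fun y => ?_
    by_cases hy : y ∈ ball x (r / 2) ∩ Ω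
    · rw [indicator_of_mem hy]
      by_cases hyZ : y ∈ Z
      · rw [indicator_of_mem hyZ]
        exact ENNReal.ofReal_le_ofReal (tent_le hε _)
      · have : tent ε (-u y) = 0 := by
          by_contra hne
          refine hyZ ⟨hy.symm, ?_, ?_⟩
          · by_contra! hlt
            exact hne (tent_eq_zero_left hε hlt.le).1
          · by_contra! hlt
            exact hne (tent_right hε hlt.le).1
        simp [this]
    · simp [indicator_of_notMem hy]
  refine h1.trans ?_
  refine le_trans ?_ (mul_le_mul_right (hB.volume_layer_le h hs hr hε) _)
  rw [← mul_assoc, ← ENNReal.ofReal_mul (by positivity)]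
  refine le_of_eq ?_
  congr 2
  field_simp

theorem eventually_le_layerMeasure_ball (hN : 0 < N) (hΩ : (Ωᶜ).Nonempty)
    (hB : BdryNbhd Ω g s P r x ω) (h : TorsionSetup Ω u g) (hs : 0 < s) (hs1 : s ≤ 1)
    (hr : 0 < r) :
    ∀ᶠ ε in nhdsWithin (0:ℝ) (Ioi 0), volume (ball (x + (s * r / 16) • ω) (s * r / 16 * s / 2)) ≤
      ENNReal.ofReal (5 * r * P) * layerMeasure Ω u ε (ball x r) := by
  have hP := hB.pos
  have e1 : ∀ᶠ ε in nhdsWithin (0:ℝ) (Ioi 0), 2 * ε ≤ (s * r / 16 * s / 2) ^ 2 / 2 := by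
    filter_upwards [Ioo_mem_nhdsGT (show 0 < (s * r / 16 * s / 2) ^ 2 / 4 by positivity)] with ε hε
    linarith [hε.2]
  have e2 : ∀ᶠ ε in nhdsWithin (0:ℝ) (Ioi 0), 2 * ε / (5 * P) ≤ 8 * (s * r / 16) / s := by
    filter_upwards [Ioo_mem_nhdsGT
      (show 0 < 8 * (s * r / 16) / s * (5 * P) / 2 by positivity)] with ε hε
    rw [div_le_iff₀ (by positivity)]
    linarith [hε.2]
  filter_upwards [self_mem_nhdsWithin, e1, e2] with ε hε h1 h2
  have hε : 0 < ε := hε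
  set Z := Ω ∩ ball x r ∩ {y | -u y ∈ Icc (3 / 2 * ε) (5 / 2 * ε)} with hZ
  have hZm : MeasurableSet Z := measurableSet_layer h x r (3 / 2 * ε) (5 / 2 * ε)
  have hZle : ENNReal.ofReal (2 * ε)⁻¹ * volume Z ≤ layerMeasure Ω u ε (ball x r) := by
    rw [TorsionSetup.layerMeasure_apply u ε measurableSet_ball, ← setLIntegral_const]
    refine (setLIntegral_mono' hZm fun y hy =>
      ENNReal.ofReal_le_ofReal (le_tent hε hy.2.1 hy.2.2)).trans ?_
    exact lintegral_mono_set fun y hy => hy.1.symm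
  refine (hB.le_volume_layer hN hΩ h hs hs1 hr rfl hε h1 h2).trans ?_
  refine le_trans ?_ (mul_le_mul_right hZle _)
  rw [← mul_assoc, ← ENNReal.ofReal_mul (by positivity)]
  refine le_of_eq ?_
  congr 2
  field_simp
  norm_num

end BdryNbhd

end LayerMeasure

section LayerLimit

theorem FiniteMeasure.measure_le_of_eventually_le {X ι : Type*} [MeasurableSpace X]
    [TopologicalSpace X] [HasOuterApproxClosed X] [OpensMeasurableSpace X] {l : Filter ι} [l.NeBot]
    {μ : FiniteMeasure X} {μs : ι → FiniteMeasure X} (hμ : Filter.Tendsto μs l (nhds μ))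
    {U : Set X} (hU : IsOpen U) {B : ENNReal} (hB : ∀ᶠ i in l, (μs i : Measure X) U ≤ B) :
    (μ : Measure X) U ≤ B := by
  have hmass : Filter.Tendsto (fun i => (μs i : Measure X) univ) l
      (nhds ((μ : Measure X) univ)) := by
    have := ENNReal.tendsto_coe.2 ((FiniteMeasure.continuous_mass.tendsto μ).comp hμ)
    simpa [Function.comp_def, FiniteMeasure.ennreal_mass] using this
  have h1 : (μ : Measure X) univ ≤ B + (μ : Measure X) Uᶜ := by
    rw [← hmass.limsup_eq]
    calc Filter.limsup (fun i => (μs i : Measure X) univ) l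
        ≤ Filter.limsup (fun i => B + (μs i : Measure X) Uᶜ) l := by
          refine Filter.limsup_le_limsup ?_
          filter_upwards [hB] with i hi
          rw [← measure_add_measure_compl hU.measurableSet]
          gcongr
      _ = B + Filter.limsup (fun i => (μs i : Measure X) Uᶜ) l :=
          limsup_const_add l _ B (by isBoundedDefault) (by isBoundedDefault)
      _ ≤ _ := by
          gcongr
          exact FiniteMeasure.limsup_measure_closed_le_of_tendsto hμ hU.isClosed_compl
  rw [← measure_add_measure_compl hU.measurableSet] at h1
  exact (ENNReal.add_le_add_iff_right (measure_ne_top _ _)).1 h1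

variable {N : ℕ} {Ω : Set (Euc N)} {u : Euc N → ℝ} {g : Euc N → Euc N}

/-- `σ` is a weak limit along `l` of the layer measures; it is concentrated on the boundary. -/
structure IsLayerLimit (Ω : Set (Euc N)) (u : Euc N → ℝ) (l : Filter ℝ)
    (σ : Measure (Euc N)) : Prop where
  neBot : l.NeBot
  le : l ≤ nhdsWithin 0 (Ioi 0)
  isFinite : IsFiniteMeasure σ
  frontier_compl : σ (frontier Ω)ᶜ = 0
  tendsto : ∀ F : Euc N → ℝ, Continuous F →
    Filter.Tendsto (fun ε => ∫ x in Ω, tent ε (-u x) * F x) l (nhds (∫ x, F x ∂σ))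
  measure_le : ∀ U : Set (Euc N), IsOpen U → ∀ B, (∀ᶠ ε in l, layerMeasure Ω u ε U ≤ B) → σ U ≤ B
  le_measure : ∀ K : Set (Euc N), IsClosed K → ∀ B, (∀ᶠ ε in l, B ≤ layerMeasure Ω u ε K) → B ≤ σ K

theorem TorsionSetup.exists_isLayerLimit (h : TorsionSetup Ω u g) {m : ℝ} (hm : 0 < m)
    (hg : ∀ x ∈ frontier Ω, m ≤ ‖g x‖) : ∃ l σ, IsLayerLimit Ω u l σ := by
  obtain ⟨C, hC⟩ := h.eventually_layerMeasure_univ_le hm hg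
  set μ : ℝ → FiniteMeasure (Euc N) := fun ε =>
    ⟨layerMeasure Ω u ε, h.isFiniteMeasure_layerMeasure ε⟩ with hμ
  have hμc : ∀ ε, (μ ε : Measure (Euc N)) = layerMeasure Ω u ε := fun ε => rfl
  set l : Ultrafilter ℝ := Ultrafilter.of (nhdsWithin (0:ℝ) (Ioi 0)) with hl
  have hle : (l : Filter ℝ) ≤ nhdsWithin 0 (Ioi 0) := Ultrafilter.of_le _
  have hK := isCompact_setOfPred_finiteMeasure_le_of_isCompact C h.isBounded.isCompact_closure
  obtain ⟨σ, hσ, hlim⟩ := hK.ultrafilter_le_nhds' (l.map μ) (by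
    rw [Ultrafilter.mem_map]
    filter_upwards [hle hC] with ε hε
    refine ⟨?_, ?_⟩
    · rw [← ENNReal.coe_le_coe, FiniteMeasure.ennreal_mass]
      exact hε
    · rw [FiniteMeasure.null_iff_toMeasure_null]
      exact layerMeasure_compl_closure u ε)
  have hlim : Filter.Tendsto μ l (nhds σ) := hlim
  have hopen : ∀ U : Set (Euc N), IsOpen U → ∀ B,
      (∀ᶠ ε in (l : Filter ℝ), layerMeasure Ω u ε U ≤ B) →
      (σ : Measure (Euc N)) U ≤ B := fun U hU B hB =>
    FiniteMeasure.measure_le_of_eventually_le hlim hU hB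
  have hcl : (σ : Measure (Euc N)) (closure Ω)ᶜ = 0 :=
    (FiniteMeasure.null_iff_toMeasure_null _ _).1 hσ.2
  have hint : (σ : Measure (Euc N)) Ω = 0 := by
    refine measure_null_of_locally_null _ fun x hx => ?_
    obtain ⟨r, hr, hrΩ⟩ := nhds_basis_closedBall.mem_iff.1 (h.isOpen.mem_nhds hx)
    refine ⟨ball x r, mem_nhdsWithin_of_mem_nhds (ball_mem_nhds x hr), ?_⟩
    refine le_zero_iff.1 (hopen _ isOpen_ball 0 ?_)
    filter_upwards [hle (h.eventually_layerMeasure_eq_zero (isCompact_closedBall x r) hrΩ)]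
      with ε hε
    rw [← hε]
    exact measure_mono ball_subset_closedBall
  refine ⟨l, σ, inferInstance, hle, inferInstance, ?_, ?_, hopen, ?_⟩
  · refine measure_mono_null (t := (closure Ω)ᶜ ∪ Ω) (fun x hx => ?_) (measure_union_null hcl hint)
    by_contra hcon
    rw [mem_union, not_or, notMem_compl_iff] at hcon
    exact hx ⟨hcon.1, by rw [h.isOpen.interior_eq]; exact hcon.2⟩
  · intro F hF
    obtain ⟨M, hM⟩ := h.isBounded.isCompact_closure.exists_bound_of_continuousOn hF.continuousOn
    set F' : BoundedContinuousFunction (Euc N) ℝ := BoundedContinuousFunction.ofNormedAddCommGroup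
      (fun x => max (-|M|) (min |M| (F x))) (by fun_prop) |M| (fun x => by
        rw [Real.norm_eq_abs, abs_le]
        exact ⟨le_max_left _ _, max_le (by have := abs_nonneg M; linarith) (min_le_left _ _)⟩)
    have hFF : ∀ x ∈ closure Ω, F' x = F x := fun x hx => by
      have h1 := abs_le.1 ((hM x hx).trans (le_abs_self M))
      change max (-|M|) (min |M| (F x)) = F x
      rw [min_eq_right h1.2, max_eq_right h1.1]
    have h1 := FiniteMeasure.tendsto_iff_forall_integral_tendsto.1 hlim F'
    have h2 : ∫ x, F' x ∂(σ : Measure (Euc N)) = ∫ x, F x ∂(σ : Measure (Euc N)) := by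
      refine integral_congr_ae ?_
      filter_upwards [measure_eq_zero_iff_ae_notMem.1 hcl] with x hx
      exact hFF x (notMem_compl_iff.1 hx)
    rw [h2] at h1
    refine h1.congr' ?_
    filter_upwards [hle self_mem_nhdsWithin] with ε hε
    rw [hμc, h.integral_layerMeasure hε]
    exact setIntegral_congr_fun h.isOpen.measurableSet fun x hx => by
      simp only [hFF x (subset_closure hx)]
  · intro K hK' B hB
    refine le_trans ?_ (FiniteMeasure.limsup_measure_closed_le_of_tendsto hlim hK')
    exact Filter.le_limsup_of_frequently_le hB.frequently

end LayerLimit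

section HausdorffComparison

variable {X : Type*} [MetricSpace X] [MeasurableSpace X] [BorelSpace X]

theorem exists_finite_disjoint_closedBall_cover {ν : Measure X} [IsFiniteMeasure ν] {K : Set X}
    {r : ℝ} (hr : 0 ≤ r) {c : ENNReal} (hc : 0 < c) (h : ∀ x ∈ K, c ≤ ν (closedBall x r)) :
    ∃ F ⊆ K, F.Finite ∧ (F.PairwiseDisjoint fun x => closedBall x r) ∧
      K ⊆ ⋃ x ∈ F, closedBall x (5 * r) := by
  obtain ⟨F, hFK, hdisj, hcov⟩ := Vitali.exists_disjoint_subfamily_covering_enlargement_closedBall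
    K id (fun _ => r) r (fun _ _ => le_rfl) 5 (by norm_num)
  refine ⟨F, hFK, ?_, hdisj, fun x hx => ?_⟩
  · have := Measure.finite_const_le_meas_of_disjoint_iUnion ν hc
      (As := fun i : F => closedBall (i : X) r) (fun i => measurableSet_closedBall)
      (fun i j hij => hdisj i.2 j.2 (Subtype.coe_injective.ne hij)) (measure_ne_top _ _)
    rw [show {i : F | c ≤ ν (closedBall (i : X) r)} = univ from
      eq_univ_of_forall fun i => h i (hFK i.2), finite_univ_iff] at this
    exact toFinite F
  · obtain ⟨b, hb, hsub⟩ := hcov x hx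
    exact mem_iUnion₂.2 ⟨b, hb, hsub (mem_closedBall_self hr)⟩

theorem hausdorffMeasure_compact_le {ν : Measure X} [IsFiniteMeasure ν] {q κ r₀ : ℝ} (hq : 0 ≤ q)
    (hκ : 0 < κ) (hr₀ : 0 < r₀) {K : Set X} (hK : IsCompact K)
    (h : ∀ x ∈ K, ∀ r ∈ Ioc 0 r₀, ENNReal.ofReal (κ * r ^ q) ≤ ν (closedBall x r)) :
    μH[q] K ≤ ENNReal.ofReal (10 ^ q / κ) * ν K := by
  have key : ∀ U, IsOpen U → K ⊆ U → μH[q] K ≤ ENNReal.ofReal (10 ^ q / κ) * ν U := by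
    intro U hU hKU
    obtain ⟨δ, hδ, hδU⟩ := hK.exists_cthickening_subset_open hU hKU
    set ρ : ℕ → ℝ := fun n => min δ r₀ / ((n : ℝ) + 1) with hρ
    have hρ0 : ∀ n, 0 < ρ n := fun n => by have := lt_min hδ hr₀; positivity
    have hρle : ∀ n, ρ n ≤ min δ r₀ := fun n =>
      div_le_self (lt_min hδ hr₀).le (by have : (0:ℝ) ≤ n := n.cast_nonneg; linarith)
    have hρt : Filter.Tendsto (fun n => ENNReal.ofReal (10 * ρ n)) Filter.atTop (nhds 0) := by
      have := (tendsto_one_div_add_atTop_nhds_zero_nat (𝕜 := ℝ)).const_mul (10 * min δ r₀)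
      rw [mul_zero] at this
      rw [← ENNReal.ofReal_zero]
      refine ENNReal.tendsto_ofReal (this.congr fun n => ?_)
      rw [hρ]; ring
    have hpos : ∀ n, 0 < κ * ρ n ^ q := fun n => mul_pos hκ (rpow_pos_of_pos (hρ0 n) q)
    have hlow : ∀ n, ∀ x ∈ K, ENNReal.ofReal (κ * ρ n ^ q) ≤ ν (closedBall x (ρ n)) := fun n x hx =>
      h x hx _ ⟨hρ0 n, (hρle n).trans (min_le_right _ _)⟩
    choose F hFK hfin hdisj hcov using fun n => exists_finite_disjoint_closedBall_cover (hρ0 n).le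
      (ENNReal.ofReal_pos.2 (hpos n)) (hlow n)
    have hcount : ∀ n, Countable (F n) := fun n => (hfin n).countable.to_subtype
    have hdiam : ∀ n, ∀ x : X, ediam (closedBall x (5 * ρ n)) ≤ ENNReal.ofReal (10 * ρ n) := by
      intro n x
      rw [← closedEBall_ofReal (by have := hρ0 n; positivity)]
      refine ediam_closedEBall_le.trans_eq ?_
      rw [show (2:ENNReal) = ENNReal.ofReal 2 by simp, ← ENNReal.ofReal_mul (by norm_num)]
      congr 1; ring
    refine (Measure.hausdorffMeasure_le_liminf_tsum q K (fun n => ENNReal.ofReal (10 * ρ n)) hρt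
      (fun n (x : F n) => closedBall (x : X) (5 * ρ n))
      (Filter.Eventually.of_forall fun n x => hdiam n x)
      (Filter.Eventually.of_forall fun n => by
        rw [iUnion_subtype]; exact hcov n)).trans ?_
    refine Filter.liminf_le_of_frequently_le' (Filter.Frequently.of_forall fun n => ?_)
    calc ∑' x : F n, ediam (closedBall (x : X) (5 * ρ n)) ^ q
        ≤ ∑' x : F n, ENNReal.ofReal (10 ^ q / κ) * ν (closedBall (x : X) (ρ n)) := by
          refine ENNReal.tsum_le_tsum fun x => ?_
          refine (ENNReal.rpow_le_rpow (hdiam n x) hq).trans ?_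
          rw [ENNReal.ofReal_rpow_of_nonneg (by have := hρ0 n; positivity) hq]
          refine le_trans (le_of_eq ?_) (mul_le_mul_right (hlow n x (hFK n x.2)) _)
          rw [← ENNReal.ofReal_mul (by positivity), mul_rpow (by norm_num) (hρ0 n).le]
          congr 1
          field_simp
      _ = ENNReal.ofReal (10 ^ q / κ) * ν (⋃ x : F n, closedBall (x : X) (ρ n)) := by
          have := hcount n
          rw [ENNReal.tsum_mul_left, measure_iUnion (f := fun x : F n => closedBall (x : X) (ρ n))
            (fun i j hij => hdisj n i.2 j.2 (Subtype.coe_injective.ne hij))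
            fun i => measurableSet_closedBall]
      _ ≤ _ := by
          gcongr
          refine iUnion_subset fun x => ?_
          refine (closedBall_subset_cthickening (hFK n x.2) _).trans ?_
          exact (cthickening_mono ((hρle n).trans (min_le_left _ _)) K).trans hδU
  have hc : ENNReal.ofReal (10 ^ q / κ) ≠ 0 := by
    rw [ne_eq, ENNReal.ofReal_eq_zero, not_le]
    exact div_pos (rpow_pos_of_pos (by norm_num) q) hκ
  rw [← ENNReal.div_le_iff' hc ENNReal.ofReal_ne_top, K.measure_eq_iInf_isOpen ν]
  refine le_iInf fun U => le_iInf fun hKU => le_iInf fun hU => ?_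
  rw [ENNReal.div_le_iff' hc ENNReal.ofReal_ne_top]
  exact key U hU hKU

theorem hausdorffMeasure_restrict_le {ν : Measure X} [IsFiniteMeasure ν] {q κ r₀ : ℝ} (hq : 0 ≤ q)
    (hκ : 0 < κ) (hr₀ : 0 < r₀) {S : Set X} (hS : IsCompact S)
    (h : ∀ x ∈ S, ∀ r ∈ Ioc 0 r₀, ENNReal.ofReal (κ * r ^ q) ≤ ν (closedBall x r)) :
    (μH[q] : Measure X).restrict S ≤ ENNReal.ofReal (10 ^ q / κ) • ν := by
  have hfin : IsFiniteMeasure ((μH[q] : Measure X).restrict S) := ⟨by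
    rw [Measure.restrict_apply_univ]
    exact (hausdorffMeasure_compact_le hq hκ hr₀ hS h).trans_lt
      (ENNReal.mul_lt_top ENNReal.ofReal_lt_top (measure_lt_top _ _))⟩
  refine Measure.le_iff.2 fun A hA => ?_
  rw [hA.measure_eq_iSup_isClosed_of_ne_top (measure_ne_top _ _)]
  refine iSup_le fun K => iSup_le fun hKA => iSup_le fun hK => ?_
  rw [Measure.restrict_apply hK.measurableSet, Measure.smul_apply, smul_eq_mul]
  refine (hausdorffMeasure_compact_le hq hκ hr₀ (hS.inter_left hK)
    fun x hx => h x hx.2).trans ?_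
  gcongr
  exact inter_subset_left.trans hKA

theorem measure_le_hausdorffMeasure {σ : Measure X} {q B r₀ : ℝ} (hq : 0 < q) (hB : 0 < B)
    (hr₀ : 0 < r₀) {S : Set X} (hS : σ Sᶜ = 0)
    (h : ∀ x ∈ S, ∀ r ∈ Ioc 0 r₀, σ (ball x r) ≤ ENNReal.ofReal (B * r ^ q)) :
    σ ≤ ENNReal.ofReal B • (μH[q] : Measure X) := by
  have hB0 : ENNReal.ofReal B ≠ 0 := by simpa using hB
  have key : (ENNReal.ofReal B)⁻¹ • σ ≤ μH[q] := by
    refine Measure.le_hausdorffMeasure q _ (ENNReal.ofReal (r₀ / 2))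
      (ENNReal.ofReal_pos.2 (half_pos hr₀)) fun t ht => ?_
    rw [Measure.smul_apply, smul_eq_mul, mul_comm, ← div_eq_mul_inv,
      ENNReal.div_le_iff' hB0 ENNReal.ofReal_ne_top]
    rcases (t ∩ S).eq_empty_or_nonempty with he | ⟨x, hxt, hxS⟩
    · have : t ⊆ Sᶜ := fun y hy hyS => by
        have : y ∈ t ∩ S := ⟨hy, hyS⟩
        simp [he] at this
      simp [measure_mono_null this hS]
    have htop : ediam t ≠ ⊤ := ne_top_of_le_ne_top ENNReal.ofReal_ne_top ht
    set δ := (ediam t).toReal with hδ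
    have hδr : δ ≤ r₀ / 2 := ENNReal.toReal_le_of_le_ofReal (half_pos hr₀).le ht
    have hδ0 : 0 ≤ δ := ENNReal.toReal_nonneg
    have hd : ediam t = ENNReal.ofReal δ := (ENNReal.ofReal_toReal htop).symm
    rw [hd, ENNReal.ofReal_rpow_of_nonneg hδ0 hq.le, ← ENNReal.ofReal_mul hB.le]
    have hlim : Filter.Tendsto (fun r : ℝ => ENNReal.ofReal (B * r ^ q)) (nhdsWithin δ (Ioi δ))
        (nhds (ENNReal.ofReal (B * δ ^ q))) := by
      refine ENNReal.tendsto_ofReal (Filter.Tendsto.const_mul B ?_)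
      exact ((continuous_rpow_const hq.le).tendsto δ).mono_left nhdsWithin_le_nhds
    refine ge_of_tendsto hlim ?_
    filter_upwards [Ioc_mem_nhdsGT (show δ < r₀ by linarith)] with r hr
    refine le_trans (measure_mono fun y hy => ?_) (h x hxS r ⟨hδ0.trans_lt hr.1, hr.2⟩)
    have h1 : edist y x ≤ ENNReal.ofReal δ := hd ▸ edist_le_ediam_of_mem hy hxt
    rw [mem_ball]
    refine lt_of_le_of_lt ?_ hr.1
    rw [edist_dist] at h1
    exact (ENNReal.ofReal_le_ofReal_iff hδ0).1 h1
  refine Measure.le_iff.2 fun A _ => ?_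
  have := key A
  rw [Measure.smul_apply, smul_eq_mul, mul_comm, ← div_eq_mul_inv,
    ENNReal.div_le_iff' hB0 ENNReal.ofReal_ne_top] at this
  simpa using this

end HausdorffComparison

section BoundaryComparison

theorem Continuous.integrable_of_compl_null {X F : Type*} [TopologicalSpace X] [T2Space X]
    [MeasurableSpace X] [BorelSpace X] [NormedAddCommGroup F] {μ : Measure X} [IsFiniteMeasure μ]
    {K : Set X} (hK : IsCompact K) (hμ : μ Kᶜ = 0) {f : X → F} (hf : Continuous f) :
    Integrable f μ := by
  have h1 : IntegrableOn f K μ := hf.continuousOn.integrableOn_compact hK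
  rwa [IntegrableOn, Measure.restrict_eq_self_of_ae_mem] at h1
  filter_upwards [measure_eq_zero_iff_ae_notMem.1 hμ] with x hx
  exact notMem_compl_iff.1 hx

variable {N : ℕ} {Ω : Set (Euc N)} {u : Euc N → ℝ} {g : Euc N → Euc N}

theorem ofReal_volume_ball (x : Euc N) {r : ℝ} (hr : 0 < r) :
    volume (ball x r) = ENNReal.ofReal (r ^ N * (volume (ball (0 : Euc N) 1)).toReal) := by
  rw [Measure.addHaar_ball_of_pos _ _ hr, finrank_euclideanSpace_fin,
    ENNReal.ofReal_mul (by positivity), ENNReal.ofReal_toReal measure_ball_lt_top.ne]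

theorem toReal_volume_ball_pos (N : ℕ) : 0 < (volume (ball (0 : Euc N) 1)).toReal :=
  ENNReal.toReal_pos (measure_ball_pos _ _ one_pos).ne' measure_ball_lt_top.ne

namespace IsLayerLimit

variable {l : Filter ℝ} {σ : Measure (Euc N)} {s P r m : ℝ} {x ω : Euc N}

theorem measure_ball_le (hσ : IsLayerLimit Ω u l σ) (h : TorsionSetup Ω u g) (hs : 0 < s)
    (hm : 0 < m) (hmP : m ≤ P) (hr : 0 < r) (hB : BdryNbhd Ω g s P (2 * r) x ω) :
    σ (ball x r) ≤ ENNReal.ofReal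
      (12 * 2 ^ N * (volume (ball (0 : Euc N) 1)).toReal / (s * m) * r ^ ((N:ℝ) - 1)) := by
  have hV := toReal_volume_ball_pos N
  refine hσ.measure_le _ isOpen_ball _ ?_
  filter_upwards [hσ.le self_mem_nhdsWithin] with ε hε
  have h1 := hB.layerMeasure_ball_le h hs (by positivity) hε
  rw [mul_div_cancel_left₀ r two_ne_zero, ofReal_volume_ball _ (by positivity),
    ← ENNReal.ofReal_mul (by have := hB.pos; positivity)] at h1
  refine h1.trans (ENNReal.ofReal_le_ofReal ?_)
  rw [rpow_sub_one hr.ne', rpow_natCast]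
  calc 24 / (s * P * (2 * r)) * ((2 * r) ^ N * (volume (ball (0 : Euc N) 1)).toReal)
      = (12 * 2 ^ N * (volume (ball (0 : Euc N) 1)).toReal * (r ^ N / r) / s) / P := by
        have := hB.pos
        field_simp
        ring
    _ ≤ (12 * 2 ^ N * (volume (ball (0 : Euc N) 1)).toReal * (r ^ N / r) / s) / m := by
        gcongr
    _ = _ := by field_simp

theorem le_measure_closedBall (hσ : IsLayerLimit Ω u l σ) (hN : 0 < N) (hΩ : (Ωᶜ).Nonempty)
    (h : TorsionSetup Ω u g) (hs : 0 < s) (hs1 : s ≤ 1) (hr : 0 < r)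
    (hB : BdryNbhd Ω g s P r x ω) :
    (s ^ 2 / 32) ^ N * (volume (ball (0 : Euc N) 1)).toReal * r ^ ((N:ℝ) - 1) ≤
      5 * P * (σ (closedBall x r)).toReal := by
  have hP := hB.pos
  have hf := hσ.isFinite
  have h1 : volume (ball (x + (s * r / 16) • ω) (s * r / 16 * s / 2)) ≤
      ENNReal.ofReal (5 * r * P) * σ (closedBall x r) := by
    have h0 : ENNReal.ofReal (5 * r * P) ≠ 0 := by
      rw [ne_eq, ENNReal.ofReal_eq_zero, not_le]; positivity
    rw [← ENNReal.div_le_iff' h0 ENNReal.ofReal_ne_top]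
    refine hσ.le_measure _ isClosed_closedBall _ ?_
    filter_upwards [hσ.le (hB.eventually_le_layerMeasure_ball hN hΩ h hs hs1 hr)] with ε hε
    rw [ENNReal.div_le_iff' h0 ENNReal.ofReal_ne_top]
    refine hε.trans ?_
    gcongr
    exact ball_subset_closedBall
  rw [ofReal_volume_ball _ (by positivity), ← ENNReal.ofReal_toReal (measure_ne_top σ _),
    ← ENNReal.ofReal_mul (by positivity), ENNReal.ofReal_le_ofReal_iff (by positivity)] at h1
  rw [rpow_sub_one hr.ne', rpow_natCast, ← mul_div_assoc, div_le_iff₀ hr]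
  calc (s ^ 2 / 32) ^ N * (volume (ball (0 : Euc N) 1)).toReal * r ^ N
      = (s * r / 16 * s / 2) ^ N * (volume (ball (0 : Euc N) 1)).toReal := by
        rw [show s * r / 16 * s / 2 = s ^ 2 / 32 * r by ring, mul_pow]; ring
    _ ≤ _ := h1
    _ = _ := by ring

theorem integrable {F : Type*} [NormedAddCommGroup F] (hσ : IsLayerLimit Ω u l σ)
    (h : TorsionSetup Ω u g) {f : Euc N → F} (hf : Continuous f) : Integrable f σ :=
  have := hσ.isFinite
  hf.integrable_of_compl_null (h.isBounded.isCompact_closure.of_isClosed_subset isClosed_frontier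
    frontier_subset_closure) hσ.frontier_compl

end IsLayerLimit

theorem exists_boundary_comparison {N : ℕ} (hN : 2 ≤ N) {s m : ℝ} (hs : 0 < s) (hs1 : s ≤ 1)
    (hm : 0 < m) : ∃ B₁ > 0, ∃ B₂ > 0, ∀ (Ω : Set (Euc N)) (u : Euc N → ℝ) (g : Euc N → Euc N)
      (a : ℝ) (l : Filter ℝ) (σ : Measure (Euc N)), TorsionSetup Ω u g → (Ωᶜ).Nonempty → 0 < a →
      (∀ x ∈ frontier Ω, ∃ ω, FatCone s (a / 2) a Ω x ω) → (∀ x ∈ frontier Ω, m ≤ ‖g x‖) →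
      IsLayerLimit Ω u l σ → ∀ F : Euc N → ℝ, Continuous F → (∀ x, 0 ≤ F x) →
      ∫ x, F x ∂σ ≤ B₁ * ∫ x in frontier Ω, F x ∂(μH[(N:ℝ) - 1]) ∧
      ∫ x in frontier Ω, F x ∂(μH[(N:ℝ) - 1]) ≤ B₂ * ∫ x, ‖g x‖ ^ 2 * F x ∂σ := by
  have hV := toReal_volume_ball_pos N
  set V := (volume (ball (0 : Euc N) 1)).toReal with hVdef
  have hq : 0 < (N:ℝ) - 1 := by
    have : (2:ℝ) ≤ N := by exact_mod_cast hN
    linarith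
  set κ : ℝ := (s ^ 2 / 32) ^ N * V * m / 20 with hκdef
  have hκ : 0 < κ := by positivity
  refine ⟨12 * 2 ^ N * V / (s * m), by positivity, 10 ^ ((N:ℝ) - 1) / κ,
    by positivity, fun Ω u g a l σ h hΩ ha hcone hg hσ F hF hF0 => ?_⟩
  have hfin := hσ.isFinite
  have hK : IsCompact (frontier Ω) :=
    h.isBounded.isCompact_closure.of_isClosed_subset isClosed_frontier frontier_subset_closure
  obtain ⟨r₁, hr₁, hB⟩ := h.exists_bdryNbhd hs hs1 ha hm hg hcone
  choose! ω hB using hB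
  obtain ⟨r₂, hr₂, hu⟩ := Metric.uniformContinuousOn_iff.1
    (hK.uniformContinuousOn_of_continuous h.continuous.continuousOn) (m / 2) (half_pos hm)
  set ν : Measure (Euc N) := σ.withDensity fun x => ENNReal.ofReal (‖g x‖ ^ 2) with hν
  have hgc := h.continuous
  have hg2 : Continuous fun x => ‖g x‖ ^ 2 := by fun_prop
  have hνfin : IsFiniteMeasure ν := isFiniteMeasure_withDensity_ofReal (hσ.integrable h hg2).2
  have hν0 : ν (frontier Ω)ᶜ = 0 := withDensity_absolutelyContinuous _ _ hσ.frontier_compl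
  have hFν : ∫ x, F x ∂ν = ∫ x, ‖g x‖ ^ 2 * F x ∂σ := by
    rw [hν, integral_withDensity_eq_integral_toReal_smul (by fun_prop) (by simp)]
    simp only [ENNReal.toReal_ofReal (sq_nonneg _), smul_eq_mul]
  have hlow : (μH[(N:ℝ) - 1] : Measure (Euc N)).restrict (frontier Ω) ≤
      ENNReal.ofReal (10 ^ ((N:ℝ) - 1) / κ) • ν := by
    refine hausdorffMeasure_restrict_le hq.le hκ (r₀ := min r₁ (r₂ / 2)) (by positivity) hK
      fun x hx r hr => ?_
    have hP := hg x hx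
    have hr0 : 0 < r := hr.1
    have h1 := hσ.le_measure_closedBall (by omega) hΩ h hs hs1 hr0
      (hB x hx r (hr.2.trans (min_le_left _ _)))
    have h2 : ENNReal.ofReal (‖g x‖ ^ 2 / 4) * σ (closedBall x r) ≤ ν (closedBall x r) := by
      rw [hν, withDensity_apply _ measurableSet_closedBall, ← setLIntegral_const]
      refine lintegral_mono_ae ?_
      filter_upwards [ae_restrict_mem measurableSet_closedBall,
        ae_restrict_of_ae (measure_eq_zero_iff_ae_notMem.1 hσ.frontier_compl)] with y hy hy'
      refine ENNReal.ofReal_le_ofReal ?_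
      have hd := hu y (notMem_compl_iff.1 hy') x hx (by
        have := hr.2.trans (min_le_right _ _)
        have := mem_closedBall.1 hy
        linarith)
      rw [dist_eq_norm] at hd
      have h3 := norm_le_norm_add_norm_sub' (g x) (g y)
      rw [norm_sub_rev] at h3
      have h4 : ‖g x‖ / 2 ≤ ‖g y‖ := by linarith
      have : 0 ≤ ‖g x‖ := norm_nonneg _
      nlinarith
    refine le_trans ?_ h2
    rw [← ENNReal.ofReal_toReal (measure_ne_top σ (closedBall x r)),
      ← ENNReal.ofReal_mul (by positivity)]
    refine ENNReal.ofReal_le_ofReal ?_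
    have hX : 0 ≤ (s ^ 2 / 32) ^ N * V * r ^ ((N:ℝ) - 1) := by positivity
    calc κ * r ^ ((N:ℝ) - 1) = (s ^ 2 / 32) ^ N * V * r ^ ((N:ℝ) - 1) * (m / 20) := by
          rw [hκdef]; ring
      _ ≤ (s ^ 2 / 32) ^ N * V * r ^ ((N:ℝ) - 1) * (‖g x‖ / 20) := by gcongr
      _ ≤ 5 * ‖g x‖ * (σ (closedBall x r)).toReal * (‖g x‖ / 20) := by gcongr
      _ = _ := by ring
  have hHfin : IsFiniteMeasure ((μH[(N:ℝ) - 1] : Measure (Euc N)).restrict (frontier Ω)) :=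
    ⟨(hlow univ).trans_lt (by
      rw [Measure.smul_apply, smul_eq_mul]
      exact ENNReal.mul_lt_top ENNReal.ofReal_lt_top (measure_lt_top _ _))⟩
  have hup : σ ≤ ENNReal.ofReal (12 * 2 ^ N * V / (s * m)) •
      (μH[(N:ℝ) - 1] : Measure (Euc N)).restrict (frontier Ω) := by
    have h1 : σ ≤ ENNReal.ofReal (12 * 2 ^ N * V / (s * m)) •
        (μH[(N:ℝ) - 1] : Measure (Euc N)) := by
      refine measure_le_hausdorffMeasure hq (by positivity) (half_pos hr₁) hσ.frontier_compl
        fun x hx r hr => ?_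
      exact hσ.measure_ball_le h hs hm (hg x hx) hr.1 (hB x hx _ (by linarith [hr.2]))
    have h2 := Measure.restrict_mono (le_refl (frontier Ω)) h1
    rwa [Measure.restrict_eq_self_of_ae_mem, Measure.restrict_smul] at h2
    filter_upwards [measure_eq_zero_iff_ae_notMem.1 hσ.frontier_compl] with x hx
    exact notMem_compl_iff.1 hx
  constructor
  · have hi : Integrable F ((μH[(N:ℝ) - 1] : Measure (Euc N)).restrict (frontier Ω)) :=
      hF.integrable_of_compl_null hK (by
        rw [Measure.restrict_apply hK.measurableSet.compl, compl_inter_self, measure_empty])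
    have h1 := integral_mono_measure hup (Filter.Eventually.of_forall hF0)
      (hi.smul_measure ENNReal.ofReal_ne_top)
    rwa [integral_smul_measure, ENNReal.toReal_ofReal (by positivity), smul_eq_mul] at h1
  · have hi : Integrable F ν := hF.integrable_of_compl_null hK hν0
    have h1 := integral_mono_measure hlow (Filter.Eventually.of_forall hF0)
      (hi.smul_measure ENNReal.ofReal_ne_top)
    rwa [integral_smul_measure, ENNReal.toReal_ofReal (by positivity), smul_eq_mul, hFν] at h1

end BoundaryComparison

section BoundaryEstimate

variable {N : ℕ} {Ω : Set (Euc N)} {u : Euc N → ℝ} {g : Euc N → Euc N}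

theorem EuclideanSpace.norm_sq_le_sum_sq (L : Euc N →L[ℝ] Euc N) :
    ‖L‖ ^ 2 ≤ ∑ i, ∑ j, (L (EuclideanSpace.single i (1:ℝ)) j) ^ 2 := by
  set S := ∑ i, ∑ j, (L (EuclideanSpace.single i (1:ℝ)) j) ^ 2 with hS
  have hS0 : 0 ≤ S := by positivity
  have h1 : ‖L‖ ≤ √S := by
    refine L.opNorm_le_bound (Real.sqrt_nonneg _) fun y => ?_
    refine (sq_le_sq₀ (norm_nonneg _) (by positivity)).1 ?_
    have h2 : ∀ j, L y j = ∑ i, y i * L (EuclideanSpace.single i (1:ℝ)) j := fun j => by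
      have : y = ∑ i, y i • EuclideanSpace.single i (1:ℝ) := by
        ext k
        simp [Finset.sum_apply, Pi.single_apply]
      conv_lhs => rw [this]
      simp [map_sum, Finset.sum_apply]
    rw [mul_pow, Real.sq_sqrt hS0, EuclideanSpace.real_norm_sq_eq (L y),
      EuclideanSpace.real_norm_sq_eq y, hS, Finset.sum_comm, Finset.sum_mul]
    refine Finset.sum_le_sum fun j _ => ?_
    rw [h2, mul_comm]
    exact Finset.sum_mul_sq_le_sq_mul_sq _ _ _
  calc ‖L‖ ^ 2 ≤ √S ^ 2 := by gcongr
    _ = S := Real.sq_sqrt hS0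

namespace TorsionSetup

theorem contDiffOn_sub (h : TorsionSetup Ω u g) (z : Euc N) :
    ContDiffOn ℝ 1 (fun x => x - z - g x) Ω := by
  rw [contDiffOn_euclidean]
  exact fun i => (h.isTorsion.contDiffOn_devi h.isOpen z i).congr fun x hx =>
    (h.devi_eq z hx i).symm

theorem fderiv_sub_apply (h : TorsionSetup Ω u g) (z : Euc N) {x : Euc N} (hx : x ∈ Ω)
    (i j : Fin N) :
    (fderiv ℝ (fun x => x - z - g x) x (EuclideanSpace.single i (1:ℝ))) j = devHess u i j x := by
  have hd : HasFDerivAt (fun x => x - z - g x) (fderiv ℝ (fun x => x - z - g x) x) x :=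
    (((h.contDiffOn_sub z).differentiableOn one_ne_zero).differentiableAt
      (h.isOpen.mem_nhds hx)).hasFDerivAt
  have h1 := ((EuclideanSpace.proj j : Euc N →L[ℝ] ℝ).hasFDerivAt.comp x hd)
  have h2 : HasFDerivAt (devi z u j) ((EuclideanSpace.proj j : Euc N →L[ℝ] ℝ).comp
      (fderiv ℝ (fun x => x - z - g x) x)) x := by
    refine h1.congr_of_eventuallyEq ?_
    filter_upwards [h.isOpen.mem_nhds hx] with y hy
    simpa using h.devi_eq z hy j
  rw [← fderiv_devi h.isOpen h.isTorsion z hx i j, h2.fderiv]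
  rfl

theorem hessEnergy_nonneg (h : TorsionSetup Ω u g) : 0 ≤ hessEnergy Ω u :=
  setIntegral_nonneg h.isOpen.measurableSet fun x hx =>
    mul_nonneg (by linarith [h.neg_of_mem x hx]) (by positivity)

theorem wEnergy_le (h : TorsionSetup Ω u g) (hN : 0 < N) (z : Euc N) :
    wEnergy Ω (fun x => x - z - g x) ≤ ENNReal.ofReal (2 * hessEnergy Ω u) := by
  rw [hessEnergy, ← integral_const_mul, ofReal_integral_eq_lintegral_ofReal
    (h.integrableOn_neg_mul_devHess_sq.const_mul 2)]
  · refine setLIntegral_mono' h.isOpen.measurableSet fun x hx => ?_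
    rw [← ofReal_norm, ← ENNReal.ofReal_pow (norm_nonneg _),
      ← ENNReal.ofReal_pow infDist_nonneg, ← ENNReal.ofReal_mul (by positivity)]
    refine ENNReal.ofReal_le_ofReal ?_
    have h1 := EuclideanSpace.norm_sq_le_sum_sq (fderiv ℝ (fun x => x - z - g x) x)
    simp only [h.fderiv_sub_apply z hx] at h1
    have h2 := h.isTorsion.le_neg_dist_sq hN h.isOpen h.isBounded hx
    rw [← mul_assoc]
    exact mul_le_mul (by linarith) h1 (by positivity) (by linarith [h.neg_of_mem x hx])
  · filter_upwards [ae_restrict_mem h.isOpen.measurableSet] with x hx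
    have := h.neg_of_mem x hx
    exact mul_nonneg two_pos.le (mul_nonneg (by linarith) (by positivity))

/-- The mean value minimises the `L²` distance to constants. -/
theorem integral_norm_sq_le (h : TorsionSetup Ω u g) (hN : 0 < N) (hΩ : Ω.Nonempty) {z c : Euc N}
    (hz : z = ⨍ x in Ω, x) {C : ENNReal} (hC : C ≠ ⊤)
    (hc : (∫⁻ x in Ω, ‖x - z - g x - c‖ₑ ^ 2) ≤ C * wEnergy Ω (fun x => x - z - g x)) :
    ∫ x in Ω, ‖x - z - g x‖ ^ 2 ≤ 2 * C.toReal * hessEnergy Ω u := by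
  have hg := h.continuous
  have i1 : IntegrableOn (fun x => x - z - g x) Ω volume :=
    h.integrableOn_of_continuous (by fun_prop)
  have i2 : IntegrableOn (fun x => ‖x - z - g x‖ ^ 2) Ω volume :=
    h.integrableOn_of_continuous (by fun_prop)
  have i3 : IntegrableOn (fun x => ‖x - z - g x - c‖ ^ 2) Ω volume :=
    h.integrableOn_of_continuous (by fun_prop)
  have i4 : IntegrableOn (fun x => 2 * ⟪c, x - z - g x⟫) Ω volume :=
    h.integrableOn_of_continuous (by fun_prop)
  have h0 : ∫ x in Ω, 2 * ⟪c, x - z - g x⟫ = 0 := by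
    rw [integral_const_mul, integral_inner i1, h.integral_sub_eq_zero hΩ hz, inner_zero_right,
      mul_zero]
  have h1 : ∫ x in Ω, ‖x - z - g x‖ ^ 2 ≤ ∫ x in Ω, ‖x - z - g x - c‖ ^ 2 := by
    calc ∫ x in Ω, ‖x - z - g x‖ ^ 2
        = ∫ x in Ω, (‖x - z - g x‖ ^ 2 - 2 * ⟪c, x - z - g x⟫) := by
          rw [integral_sub i2 i4, h0, sub_zero]
      _ ≤ _ := by
          refine integral_mono (i2.sub i4) i3 fun x => ?_
          have := norm_sub_sq_real (x - z - g x) c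
          rw [real_inner_comm] at this
          simp only
          nlinarith [sq_nonneg ‖c‖]
  refine h1.trans ?_
  have h2 : ENNReal.ofReal (∫ x in Ω, ‖x - z - g x - c‖ ^ 2) ≤
      ENNReal.ofReal (2 * C.toReal * hessEnergy Ω u) := by
    rw [ofReal_integral_eq_lintegral_ofReal i3 (Filter.Eventually.of_forall fun x => by positivity)]
    simp only [ENNReal.ofReal_pow (norm_nonneg _), ofReal_norm]
    refine hc.trans ((mul_le_mul_right (h.wEnergy_le hN z) C).trans_eq ?_)
    rw [mul_comm 2 C.toReal, mul_assoc, ENNReal.ofReal_mul ENNReal.toReal_nonneg,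
      ENNReal.ofReal_toReal hC]
  exact (ENNReal.ofReal_le_ofReal_iff
    (mul_nonneg (by positivity) h.hessEnergy_nonneg)).1 h2

end TorsionSetup

namespace IsLayerLimit

variable {l : Filter ℝ} {σ : Measure (Euc N)}

theorem integral_sq_eq (hσ : IsLayerLimit Ω u l σ) (h : TorsionSetup Ω u g) (z : Euc N) :
    ∫ x, ‖g x‖ ^ 2 * ‖x - z - g x‖ ^ 2 ∂σ =
      N * (∫ x in Ω, ‖x - z - g x‖ ^ 2) + 2 * hessEnergy Ω u := by
  have hg := h.continuous
  have := hσ.neBot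
  exact tendsto_nhds_unique (hσ.tendsto _ (by fun_prop))
    ((h.tendsto_tent_mul_sq z).mono_left hσ.le)

theorem integral_inner_eq (hσ : IsLayerLimit Ω u l σ) (h : TorsionSetup Ω u g) (z : Euc N)
    (t : ℝ) : ∫ x, (t - ‖g x‖ ^ 2) / 2 * ⟪g x, x - z - g x⟫ ∂σ = hessEnergy Ω u := by
  have hg := h.continuous
  have := hσ.neBot
  exact tendsto_nhds_unique (hσ.tendsto _ (by fun_prop))
    ((h.tendsto_tent_mul_inner z t).mono_left hσ.le)

/-- The boundary energy of `∇h` is controlled by the deviation of `|∇u|²` from any constant. -/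
theorem integral_sq_le (hσ : IsLayerLimit Ω u l σ) (h : TorsionSetup Ω u g) {z : Euc N} {K : ℝ}
    (hK : 0 < K)
    (hE : N * (∫ x in Ω, ‖x - z - g x‖ ^ 2) + 2 * hessEnergy Ω u ≤ K * hessEnergy Ω u) (t : ℝ) :
    ∫ x, ‖g x‖ ^ 2 * ‖x - z - g x‖ ^ 2 ∂σ ≤ K ^ 2 * ∫ x, (‖g x‖ ^ 2 - t) ^ 2 ∂σ := by
  have hg := h.continuous
  have h1 := hσ.integral_sq_eq h z
  have h2 := hσ.integral_inner_eq h z t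
  have i1 := hσ.integrable h (f := fun x => ‖g x‖ ^ 2 * ‖x - z - g x‖ ^ 2) (by fun_prop)
  have i2 := hσ.integrable h (f := fun x => (‖g x‖ ^ 2 - t) ^ 2) (by fun_prop)
  have i3 := hσ.integrable h (f := fun x => (t - ‖g x‖ ^ 2) / 2 * ⟪g x, x - z - g x⟫)
    (by fun_prop)
  set J := ∫ x, (‖g x‖ ^ 2 - t) ^ 2 ∂σ
  set L := ∫ x, ‖g x‖ ^ 2 * ‖x - z - g x‖ ^ 2 ∂σ
  have h3 : hessEnergy Ω u ≤ K / 4 * J + 1 / (4 * K) * L := by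
    rw [← h2, ← integral_const_mul, ← integral_const_mul,
      ← integral_add (i2.const_mul _) (i1.const_mul _)]
    refine integral_mono i3 ((i2.const_mul _).add (i1.const_mul _)) fun x => ?_
    simp only
    have hcs : ⟪g x, x - z - g x⟫ ^ 2 ≤ ‖g x‖ ^ 2 * ‖x - z - g x‖ ^ 2 := by
      rw [← mul_pow, ← sq_abs]
      gcongr
      exact abs_real_inner_le_norm _ _
    have h4 : 1 / (4 * K) * ⟪g x, x - z - g x⟫ ^ 2 ≤
        1 / (4 * K) * (‖g x‖ ^ 2 * ‖x - z - g x‖ ^ 2) := by gcongr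
    refine le_trans ?_ (add_le_add_right h4 _)
    have h5 : K / 4 * (‖g x‖ ^ 2 - t) ^ 2 + 1 / (4 * K) * ⟪g x, x - z - g x⟫ ^ 2 -
        (t - ‖g x‖ ^ 2) / 2 * ⟪g x, x - z - g x⟫ =
        1 / (4 * K) * (K * (‖g x‖ ^ 2 - t) + ⟪g x, x - z - g x⟫) ^ 2 := by
      field_simp
      ring
    have h6 : 0 ≤ 1 / (4 * K) * (K * (‖g x‖ ^ 2 - t) + ⟪g x, x - z - g x⟫) ^ 2 := by positivity
    linarith
  have h7 : L ≤ K * hessEnergy Ω u := h1.trans_le hE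
  have h8 : 1 / (4 * K) * L ≤ 1 / (4 * K) * (K * hessEnergy Ω u) := by gcongr
  have h9 : 1 / (4 * K) * (K * hessEnergy Ω u) = hessEnergy Ω u / 4 := by field_simp
  have h10 : hessEnergy Ω u ≤ K * J := by
    have : 0 ≤ K * J := mul_nonneg hK.le (integral_nonneg fun x => sq_nonneg _)
    linarith
  calc L ≤ K * (K * J) := h7.trans (by gcongr)
    _ = K ^ 2 * J := by ring

end IsLayerLimit

theorem exists_torsionSetup (hN : 2 ≤ N) (ho : IsOpen Ω) (hb : Bornology.IsBounded Ω)
    (hΩ : (Ωᶜ).Nonempty) (hu : IsTorsion Ω u) (hg : ContinuousOn g (closure Ω))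
    (hgu : ∀ x ∈ Ω, g x = gradient u x)
    (hi : IntegrableOn (fun x => hessNormSq u x) Ω volume) :
    ∃ G, TorsionSetup Ω u G ∧ EqOn G g (closure Ω) := by
  obtain ⟨G, hG⟩ := ContinuousMap.exists_restrict_eq (isClosed_closure (s := Ω))
    ⟨(closure Ω).domRestrict g, hg.domRestrict⟩
  have hGg : EqOn G g (closure Ω) := fun x hx =>
    congrArg (fun f : C(closure Ω, Euc N) => f ⟨x, hx⟩) hG
  refine ⟨G, ⟨ho, hb, hu, fun x hx => ?_, G.continuous,
    fun x hx => (hGg (subset_closure hx)).trans (hgu x hx), hi⟩, hGg⟩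
  have h1 := hu.le_neg_dist_sq (by omega) ho hb hx
  have h2 := infDist_compl_pos ho hΩ hx
  have : 0 < infDist x Ωᶜ ^ 2 := by positivity
  linarith

end BoundaryEstimate

/-- `L²` bound for `∇h` on the boundary in terms of `u_ν² - R²`. -/
theorem stmt_10 (N : ℕ) (hN : 2 ≤ N) (θ a d m : ℝ) (hθ : θ ∈ Ioc (0:ℝ) (π / 2))
    (ha : 0 < a) (hd : 0 < d) (hm : 0 < m) :
    ∃ C > (0:ℝ), ∀ Ω : Set (Euc N), IsOpen Ω → IsConnected Ω → Bornology.IsBounded Ω →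
      Metric.diam Ω ≤ d → UnifConeCond θ a Ω →
      ∀ u : Euc N → ℝ, IsTorsion Ω u →
      ∀ g : Euc N → Euc N, ContinuousOn g (closure Ω) → (∀ x ∈ Ω, g x = gradient u x) →
      (∀ x ∈ frontier Ω, m ≤ ‖g x‖) →
      IntegrableOn (fun x => hessNormSq u x) Ω volume →
      ∀ z : Euc N, z = (⨍ x in Ω, x) →
      ∀ R : ℝ, R = N * (volume Ω).toReal / (μH[(N:ℝ) - 1] (frontier Ω)).toReal →
      Real.sqrt (∫ x in frontier Ω, ‖x - z - g x‖ ^ 2 ∂(μH[(N:ℝ) - 1])) ≤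
        C * Real.sqrt (∫ x in frontier Ω, (‖g x‖ ^ 2 - R ^ 2) ^ 2 ∂(μH[(N:ℝ) - 1])) := by
  have hs : 0 < sin θ := sin_pos_of_pos_of_lt_pi hθ.1 (by linarith [hθ.2, pi_pos])
  obtain ⟨C, hC, hP⟩ := weighted_poincare (F := Euc N) (d := d) N hs (sin_le_one θ) ha
  obtain ⟨B₁, hB₁, B₂, hB₂, hB⟩ := exists_boundary_comparison hN hs (sin_le_one θ) hm
  set K : ℝ := 2 * N * C.toReal + 2 with hKdef
  have hK : 0 < K := by positivity
  refine ⟨√(B₂ * (K ^ 2 * B₁)), by positivity, ?_⟩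
  intro Ω ho hc hb hd' hcone u hu g hg hgu hgm hi z hz R _
  have : Nontrivial (Euc N) := by
    have : Nonempty (Fin N) := ⟨⟨0, by omega⟩⟩
    infer_instance
  have hΩ : (Ωᶜ).Nonempty := by
    rw [nonempty_compl]
    rintro rfl
    exact NormedSpace.unbounded_univ ℝ (Euc N) hb
  obtain ⟨G, h, hGg⟩ := exists_torsionSetup hN ho hb hΩ hu hg hgu hi
  have hGf : ∀ x ∈ frontier Ω, G x = g x := fun x hx => hGg (frontier_subset_closure hx)
  have hGm : ∀ x ∈ frontier Ω, m ≤ ‖G x‖ := fun x hx => by rw [hGf x hx]; exact hgm x hx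
  have hfat : ∀ x ∈ frontier Ω, ∃ ω, FatCone (sin θ) (a / 2) a Ω x ω :=
    fun x hx => hcone.fatCone hθ hx
  obtain ⟨l, σ, hσ⟩ := h.exists_isLayerLimit hm hGm
  obtain ⟨c, hcv⟩ := hP Ω ho hc hΩ
    (fun x hx y hy => (dist_le_diam_of_mem hb hx hy).trans hd') hfat _ (h.contDiffOn_sub z)
  have hE := h.integral_norm_sq_le (by omega) hc.nonempty hz hC hcv
  have hG := h.continuous
  have hmain := hσ.integral_sq_le h (z := z) hK (by
    have : (N:ℝ) * (∫ x in Ω, ‖x - z - G x‖ ^ 2) ≤ N * (2 * C.toReal * hessEnergy Ω u) := by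
      gcongr
    rw [hKdef]
    linarith) (R ^ 2)
  have h1 := (hB Ω u G a l σ h hΩ ha hfat hGm hσ (fun x => ‖x - z - G x‖ ^ 2) (by fun_prop)
    fun x => by positivity).2
  have h2 := (hB Ω u G a l σ h hΩ ha hfat hGm hσ (fun x => (‖G x‖ ^ 2 - R ^ 2) ^ 2) (by fun_prop)
    fun x => by positivity).1
  have hfm : MeasurableSet (frontier Ω) := isClosed_frontier.measurableSet
  rw [setIntegral_congr_fun (f := fun x => ‖x - z - g x‖ ^ 2) (g := fun x => ‖x - z - G x‖ ^ 2)
      hfm fun x hx => by simp only [hGf x hx],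
    setIntegral_congr_fun (f := fun x => (‖g x‖ ^ 2 - R ^ 2) ^ 2)
      (g := fun x => (‖G x‖ ^ 2 - R ^ 2) ^ 2) hfm fun x hx => by simp only [hGf x hx],
    ← Real.sqrt_mul (by positivity)]
  refine Real.sqrt_le_sqrt (h1.trans ?_)
  calc _ ≤ B₂ * (K ^ 2 * (B₁ * _)) := by gcongr; exact hmain.trans (by gcongr)
    _ = _ := by ring
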